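/- Let {p_k}_{k≥1} be the increasing enumeration of the prime numbers, and let (X,T) be a topological dynamical system with positive topological entropy. Then (X,T) is multivariant mean Li-Yorke chaotic along {p_k}: there exists a Cantor subset K of X such that for every integer n ≥ 2 and all pairwise distinct points x_1, x_2, …, x_n in K one has liminf_{N→∞} (1/N) Σ_{k=1}^N max_{1≤i<j≤n} d(T^{p_k} x_i, T^{p_k} x_j) = 0 and limsup_{N→∞} (1/N) Σ_{k=1}^N min_{1≤i<j≤n} d(T^{p_k} x_i, T^{p_k} x_j) > 0. -/

import Mathlib

open Filter MeasureTheory Topology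

/-- A Cantor set: a nonempty compact perfect totally disconnected subset. -/
def IsCantorSet {X : Type*} [TopologicalSpace X] (K : Set X) : Prop :=
  K.Nonempty ∧ IsCompact K ∧ Perfect K ∧ IsTotallyDisconnected K

/-- `max_{1 ≤ i < j ≤ n} d(y i, y j)`. -/
noncomputable def maxPairDist {X : Type*} [PseudoMetricSpace X] {n : ℕ} (y : Fin n → X) : ℝ :=
  sSup {r : ℝ | ∃ i j : Fin n, i < j ∧ r = dist (y i) (y j)}

/-- `min_{1 ≤ i < j ≤ n} d(y i, y j)`. -/
noncomputable def minPairDist {X : Type*} [PseudoMetricSpace X] {n : ℕ} (y : Fin n → X) : ℝ :=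
  sInf {r : ℝ | ∃ i j : Fin n, i < j ∧ r = dist (y i) (y j)}

/-- The increasing enumeration of the primes, indexed so that `primeSeq 1 = 2`,
`primeSeq 2 = 3`, `primeSeq 3 = 5`, ... -/
noncomputable def primeSeq (k : ℕ) : ℕ := Nat.nth Nat.Prime (k - 1)

namespace MeanLiYorke

open Real

/-- A random variable with finitely many values: a finite labelled measurable partition. -/
structure FinVar (X : Type*) [MeasurableSpace X] where
  /-- the set of values -/
  R : Type
  [fin : Fintype R]
  /-- the variable itself -/
  fn : X → R
  meas : ∀ r, MeasurableSet (fn ⁻¹' {r})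

attribute [instance] FinVar.fin

namespace FinVar

section Basic

variable {X : Type*} [MeasurableSpace X]

/-- `f ≤ g` if the value of `g` determines the value of `f`. -/
instance : LE (FinVar X) := ⟨fun f g => ∀ x y, g.fn x = g.fn y → f.fn x = f.fn y⟩

/-- The joint variable. -/
instance : Max (FinVar X) :=
  ⟨fun f g => ⟨f.R × g.R, fun x => (f.fn x, g.fn x), fun r => by
    have : (fun x => (f.fn x, g.fn x)) ⁻¹' {r} = f.fn ⁻¹' {r.1} ∩ g.fn ⁻¹' {r.2} := by
      ext x; simp [Prod.ext_iff]
    rw [this]; exact (f.meas _).inter (g.meas _)⟩⟩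

lemma le_refl (f : FinVar X) : f ≤ f := fun _ _ h => h

lemma le_trans {f g k : FinVar X} (h : f ≤ g) (h' : g ≤ k) : f ≤ k :=
  fun x y e => h x y (h' x y e)

lemma le_sup_left (f g : FinVar X) : f ≤ f ⊔ g := fun _ _ e => (Prod.ext_iff.1 e).1

lemma le_sup_right (f g : FinVar X) : g ≤ f ⊔ g := fun _ _ e => (Prod.ext_iff.1 e).2

lemma sup_le {f g k : FinVar X} (h : f ≤ k) (h' : g ≤ k) : f ⊔ g ≤ k :=
  fun x y e => Prod.ext (h x y e) (h' x y e)

lemma sup_mono {f g f' g' : FinVar X} (h : f ≤ f') (h' : g ≤ g') : f ⊔ g ≤ f' ⊔ g' :=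
  sup_le (le_trans h (le_sup_left _ _)) (le_trans h' (le_sup_right _ _))

/-- The constant variable. -/
def const (X : Type*) [MeasurableSpace X] : FinVar X where
  R := Unit
  fn := fun _ => ()
  meas := fun _ => by simp

/-- The indicator variable of a measurable set. -/
noncomputable def ind (D : Set X) (hD : MeasurableSet D) : FinVar X where
  R := Bool
  fn := fun x => by classical exact decide (x ∈ D)
  meas := fun r => by
    cases r
    · convert hD.compl using 1; ext x; simp
    · convert hD using 1; ext x; simp

lemma ind_fn_eq {D : Set X} (hD : MeasurableSet D) {x y : X} :
    (ind D hD).fn x = (ind D hD).fn y ↔ (x ∈ D ↔ y ∈ D) := by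
  simp [ind]

lemma ind_preimage_true {D : Set X} (hD : MeasurableSet D) :
    (ind D hD).fn ⁻¹' {(true : Bool)} = D := by
  classical
  ext x
  change decide (x ∈ D) = true ↔ _
  simp

lemma ind_preimage_false {D : Set X} (hD : MeasurableSet D) :
    (ind D hD).fn ⁻¹' {(false : Bool)} = Dᶜ := by
  classical
  ext x
  change decide (x ∈ D) = false ↔ _
  simp

/-- Composition with a measurable map. -/
def comp {Y : Type*} [MeasurableSpace Y] (f : FinVar X) (T : Y → X) (hT : Measurable T) :
    FinVar Y where
  R := f.R
  fn := fun y => f.fn (T y)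
  meas := fun r => hT (f.meas r)

lemma meas_preimage (f : FinVar X) (A : Set f.R) : MeasurableSet (f.fn ⁻¹' A) := by
  have : f.fn ⁻¹' A = ⋃ r ∈ A, f.fn ⁻¹' {r} := by ext x; simp
  rw [this]
  exact MeasurableSet.biUnion (Set.to_countable _) fun r _ => f.meas r

end Basic

section Entropy

variable {X : Type*} [MeasurableSpace X] (μ : Measure X)

/-- Shannon entropy. -/
noncomputable def ent (f : FinVar X) : ℝ := ∑ r, negMulLog (μ.real (f.fn ⁻¹' {r}))

/-- Conditional Shannon entropy of `f` given `g`. -/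
noncomputable def cent (f g : FinVar X) : ℝ := ent μ (f ⊔ g) - ent μ g

lemma negMulLog_sum_le {ι : Type*} (s : Finset ι) (x : ι → ℝ) (hx : ∀ i ∈ s, 0 ≤ x i) :
    negMulLog (∑ i ∈ s, x i) ≤ ∑ i ∈ s, negMulLog (x i) := by
  simp only [negMulLog, neg_mul, Finset.sum_neg_distrib, neg_le_neg_iff, Finset.sum_mul]
  refine Finset.sum_le_sum fun i hi => ?_
  rcases (hx i hi).eq_or_lt with h | h
  · simp [← h]
  · exact mul_le_mul_of_nonneg_left
      (log_le_log h (Finset.single_le_sum hx hi)) h.le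

lemma ent_comp {Y : Type*} [MeasurableSpace Y] (ν : Measure Y) {T : Y → X}
    (hT : MeasurePreserving T ν μ) (f : FinVar X) :
    ent ν (f.comp T hT.measurable) = ent μ f := by
  refine Finset.sum_congr rfl fun r _ => ?_
  congr 1
  exact hT.measureReal_preimage (f.meas r).nullMeasurableSet

lemma cent_comp {T : X → X} (hT : MeasurePreserving T μ μ) (f g : FinVar X) :
    cent μ (f.comp T hT.measurable) (g.comp T hT.measurable) = cent μ f g := by
  unfold cent
  rw [ent_comp μ μ hT g, ← ent_comp μ μ hT (f ⊔ g)]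
  rfl

variable [IsProbabilityMeasure μ]

lemma sum_real_preimage (f : FinVar X) (A : Set X) (hA : MeasurableSet A) :
    ∑ r, μ.real (f.fn ⁻¹' {r} ∩ A) = μ.real A := by
  rw [← measureReal_biUnion_finset]
  · congr 1; ext x; simp
  · intro i _ j _ hij
    refine Set.disjoint_left.2 fun x hx hy => hij ?_
    simp only [Set.mem_inter_iff, Set.mem_preimage, Set.mem_singleton_iff] at hx hy
    rw [← hx.1, hy.1]
  · intro r _; exact (f.meas r).inter hA

lemma sum_real_preimage_univ (f : FinVar X) : ∑ r, μ.real (f.fn ⁻¹' {r}) = 1 := by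
  simpa using sum_real_preimage μ f Set.univ MeasurableSet.univ

lemma ent_nonneg (f : FinVar X) : 0 ≤ ent μ f :=
  Finset.sum_nonneg fun _ _ => negMulLog_nonneg measureReal_nonneg measureReal_le_one

lemma ent_mono {f g : FinVar X} (h : f ≤ g) : ent μ f ≤ ent μ g := by
  classical
  obtain ⟨x₀⟩ : Nonempty X := by
    by_contra hX
    rw [not_nonempty_iff] at hX
    have := measure_univ (μ := μ)
    simp [Set.univ_eq_empty_iff.2 hX] at this
  have : Nonempty f.R := ⟨f.fn x₀⟩
  obtain ⟨φ, hφ⟩ := (Function.factorsThrough_iff (f := g.fn) f.fn).1 (fun x y e => h x y e)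
  have key : ∀ t, μ.real (f.fn ⁻¹' {t}) = ∑ r with φ r = t, μ.real (g.fn ⁻¹' {r}) := by
    intro t
    rw [← measureReal_biUnion_finset]
    · congr 1; ext x; simp [hφ]
    · intro i _ j _ hij
      refine Set.disjoint_left.2 fun x hx hy => hij ?_
      simp only [Set.mem_preimage, Set.mem_singleton_iff] at hx hy
      rw [← hx, hy]
    · intro r _; exact g.meas r
  unfold ent
  calc ∑ t, negMulLog (μ.real (f.fn ⁻¹' {t}))
      ≤ ∑ t, ∑ r with φ r = t, negMulLog (μ.real (g.fn ⁻¹' {r})) := by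
        refine Finset.sum_le_sum fun t _ => ?_
        rw [key]
        exact negMulLog_sum_le _ _ fun _ _ => measureReal_nonneg
    _ = ∑ r, negMulLog (μ.real (g.fn ⁻¹' {r})) :=
        Finset.sum_fiberwise _ _ _

lemma ent_congr {f g : FinVar X} (h : f ≤ g) (h' : g ≤ f) : ent μ f = ent μ g :=
  le_antisymm (ent_mono μ h) (ent_mono μ h')

lemma ent_le_log_card (f : FinVar X) : ent μ f ≤ log (Fintype.card f.R) := by
  have h1 := sum_real_preimage_univ μ f
  have hne : Nonempty f.R := by
    by_contra h
    rw [not_nonempty_iff] at h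
    simp at h1
  have hK : (0 : ℝ) < Fintype.card f.R := by exact_mod_cast Fintype.card_pos
  set p : f.R → ℝ := fun r => μ.real (f.fn ⁻¹' {r}) with hp
  have h2 : ∀ r, negMulLog (p r) - p r * log (Fintype.card f.R) ≤
      (Fintype.card f.R : ℝ)⁻¹ - p r := by
    intro r
    have hp0 : 0 ≤ p r := measureReal_nonneg
    rcases hp0.eq_or_lt with h | h
    · rw [← h]; simp
    · have := log_le_sub_one_of_pos (x := (p r * Fintype.card f.R)⁻¹) (by positivity)
      rw [log_inv, log_mul h.ne' hK.ne'] at this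
      have h3 := mul_le_mul_of_nonneg_left this h.le
      have h4 : p r * ((p r * Fintype.card f.R)⁻¹ - 1) = (Fintype.card f.R : ℝ)⁻¹ - p r := by
        field_simp
      simp only [negMulLog]
      nlinarith
  have h5 := Finset.sum_le_sum fun r (_ : r ∈ Finset.univ) => h2 r
  rw [Finset.sum_sub_distrib, Finset.sum_sub_distrib, ← Finset.sum_mul, h1] at h5
  simp only [Finset.sum_const, Finset.card_univ, nsmul_eq_mul, one_mul] at h5
  rw [mul_inv_cancel₀ hK.ne'] at h5
  unfold ent
  linarith

lemma ent_const : ent μ (const X) = 0 := by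
  refine le_antisymm ((ent_le_log_card μ (const X)).trans_eq ?_) (ent_nonneg μ _)
  change log (Fintype.card Unit) = 0
  simp

/-- Strong subadditivity of entropy for a finite array of masses. -/
lemma sum_negMulLog_submodular {A B C : Type*} [Fintype A] [Fintype B] [Fintype C]
    (p : A → B → C → ℝ) (hp : ∀ a b c, 0 ≤ p a b c) :
    (∑ a, ∑ b, ∑ c, negMulLog (p a b c)) + ∑ c, negMulLog (∑ a, ∑ b, p a b c) ≤
      (∑ a, ∑ c, negMulLog (∑ b, p a b c)) + ∑ b, ∑ c, negMulLog (∑ a, p a b c) := by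
  set u : A → C → ℝ := fun a c => ∑ b, p a b c with hu
  set v : B → C → ℝ := fun b c => ∑ a, p a b c with hv
  set w : C → ℝ := fun c => ∑ a, ∑ b, p a b c with hw
  have hu0 : ∀ a c, 0 ≤ u a c := fun a c => Finset.sum_nonneg fun b _ => hp a b c
  have hv0 : ∀ b c, 0 ≤ v b c := fun b c => Finset.sum_nonneg fun a _ => hp a b c
  have hw0 : ∀ c, 0 ≤ w c := fun c => Finset.sum_nonneg fun a _ => hu0 a c
  have hwu : ∀ c, w c = ∑ a, u a c := fun c => rfl
  have hwv : ∀ c, w c = ∑ b, v b c := fun c => Finset.sum_comm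
  have hpu : ∀ a b c, p a b c ≤ u a c := fun a b c =>
    Finset.single_le_sum (f := fun b => p a b c) (fun b _ => hp a b c) (Finset.mem_univ b)
  have hpv : ∀ a b c, p a b c ≤ v b c := fun a b c =>
    Finset.single_le_sum (f := fun a => p a b c) (fun a _ => hp a b c) (Finset.mem_univ a)
  have hpw : ∀ a b c, p a b c ≤ w c := fun a b c => (hpu a b c).trans
    (Finset.single_le_sum (f := fun a => u a c) (fun a _ => hu0 a c) (Finset.mem_univ a))
  have e1 : ∑ c, negMulLog (w c) = ∑ a, ∑ b, ∑ c, -(p a b c * log (w c)) := by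
    have : ∀ c, negMulLog (w c) = ∑ a, ∑ b, -(p a b c * log (w c)) := by
      intro c
      simp only [negMulLog, neg_mul, Finset.sum_neg_distrib, ← Finset.sum_mul, hw]
    simp_rw [this]
    rw [Finset.sum_comm]
    exact Finset.sum_congr rfl fun a _ => Finset.sum_comm
  have e2 : ∑ a, ∑ c, negMulLog (u a c) = ∑ a, ∑ b, ∑ c, -(p a b c * log (u a c)) := by
    refine Finset.sum_congr rfl fun a _ => ?_
    rw [Finset.sum_comm]
    refine Finset.sum_congr rfl fun c _ => ?_
    simp only [negMulLog, neg_mul, Finset.sum_neg_distrib, ← Finset.sum_mul, hu]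
  have e3 : ∑ b, ∑ c, negMulLog (v b c) = ∑ a, ∑ b, ∑ c, -(p a b c * log (v b c)) := by
    rw [Finset.sum_comm (s := (Finset.univ : Finset A))]
    refine Finset.sum_congr rfl fun b _ => ?_
    rw [Finset.sum_comm]
    refine Finset.sum_congr rfl fun c _ => ?_
    simp only [negMulLog, neg_mul, Finset.sum_neg_distrib, ← Finset.sum_mul, hv]
  have key : ∀ a b c, negMulLog (p a b c) - p a b c * log (w c) ≤
      -(p a b c * log (u a c)) - p a b c * log (v b c) +
        (u a c * v b c / w c - p a b c) := by
    intro a b c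
    rcases (hp a b c).eq_or_lt with h | h
    · rw [← h]
      simp only [negMulLog_zero, zero_mul, neg_zero, sub_zero, zero_add]
      exact div_nonneg (mul_nonneg (hu0 a c) (hv0 b c)) (hw0 c)
    · have h1 := h.trans_le (hpu a b c)
      have h2 := h.trans_le (hpv a b c)
      have h3 := h.trans_le (hpw a b c)
      have h4 := log_le_sub_one_of_pos (x := u a c * v b c / (p a b c * w c)) (by positivity)
      rw [log_div (by positivity) (by positivity), log_mul h1.ne' h2.ne',
        log_mul h.ne' h3.ne'] at h4
      have h5 := mul_le_mul_of_nonneg_left h4 h.le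
      have h6 : p a b c * (u a c * v b c / (p a b c * w c) - 1) =
          u a c * v b c / w c - p a b c := by field_simp
      simp only [negMulLog]
      linarith
  have e4 : ∑ a, ∑ b, ∑ c, (u a c * v b c / w c - p a b c) = 0 := by
    have : ∀ c, ∑ a, ∑ b, (u a c * v b c / w c - p a b c) = 0 := by
      intro c
      simp only [Finset.sum_sub_distrib]
      have : ∑ a, ∑ b, u a c * v b c / w c = w c := by
        simp_rw [mul_div_assoc, ← Finset.mul_sum, ← Finset.sum_div, ← Finset.sum_mul,
          ← hwv, ← hwu]
        rcases eq_or_ne (w c) 0 with h | h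
        · simp [h]
        · field_simp
      rw [this, sub_self]
    calc ∑ a, ∑ b, ∑ c, (u a c * v b c / w c - p a b c)
        = ∑ a, ∑ c, ∑ b, (u a c * v b c / w c - p a b c) :=
          Finset.sum_congr rfl fun a _ => Finset.sum_comm
      _ = ∑ c, ∑ a, ∑ b, (u a c * v b c / w c - p a b c) := Finset.sum_comm
      _ = 0 := Finset.sum_eq_zero fun c _ => this c
  have hsum := Finset.sum_le_sum fun a (_ : a ∈ Finset.univ) =>
    Finset.sum_le_sum fun b (_ : b ∈ Finset.univ) =>
      Finset.sum_le_sum fun c (_ : c ∈ Finset.univ) => key a b c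
  simp only [Finset.sum_add_distrib, Finset.sum_sub_distrib, Finset.sum_neg_distrib] at hsum e4 e1 e2 e3
  rw [e1, e2, e3]
  linarith

lemma ent_submodular (f g k : FinVar X) :
    ent μ (f ⊔ (g ⊔ k)) + ent μ k ≤ ent μ (f ⊔ k) + ent μ (g ⊔ k) := by
  have h := sum_negMulLog_submodular
    (fun (a : f.R) (b : g.R) (c : k.R) => μ.real (f.fn ⁻¹' {a} ∩ (g.fn ⁻¹' {b} ∩ k.fn ⁻¹' {c})))
    (fun _ _ _ => measureReal_nonneg)
  have hs : ∀ (f g : FinVar X) (r : f.R × g.R), (f ⊔ g).fn ⁻¹' {r} =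
      f.fn ⁻¹' {r.1} ∩ g.fn ⁻¹' {r.2} := by
    intro f g r; ext x
    change (f.fn x, g.fn x) = r ↔ _
    simp [Prod.ext_iff]
  have e1 : ent μ (f ⊔ (g ⊔ k)) = ∑ a, ∑ b, ∑ c,
      negMulLog (μ.real (f.fn ⁻¹' {a} ∩ (g.fn ⁻¹' {b} ∩ k.fn ⁻¹' {c}))) := by
    change ∑ r : f.R × (g.R × k.R), negMulLog (μ.real ((f ⊔ (g ⊔ k)).fn ⁻¹' {r})) = _
    rw [Fintype.sum_prod_type]
    refine Finset.sum_congr rfl fun a _ => ?_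
    rw [Fintype.sum_prod_type]
    refine Finset.sum_congr rfl fun b _ => Finset.sum_congr rfl fun c _ => ?_
    rw [hs f (g ⊔ k) (a, (b, c)), hs g k (b, c)]
  have e2 : ∀ f g : FinVar X, ent μ (f ⊔ g) = ∑ a, ∑ c,
      negMulLog (μ.real (f.fn ⁻¹' {a} ∩ g.fn ⁻¹' {c})) := by
    intro f g
    change ∑ r : f.R × g.R, negMulLog (μ.real ((f ⊔ g).fn ⁻¹' {r})) = _
    rw [Fintype.sum_prod_type]
    refine Finset.sum_congr rfl fun a _ => Finset.sum_congr rfl fun c _ => ?_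
    rw [hs f g (a, c)]
  have s1 : ∀ a c, ∑ b, μ.real (f.fn ⁻¹' {a} ∩ (g.fn ⁻¹' {b} ∩ k.fn ⁻¹' {c})) =
      μ.real (f.fn ⁻¹' {a} ∩ k.fn ⁻¹' {c}) := by
    intro a c
    rw [← sum_real_preimage μ g _ ((f.meas a).inter (k.meas c))]
    exact Finset.sum_congr rfl fun b _ => by rw [Set.inter_left_comm]
  have s2 : ∀ b c, ∑ a, μ.real (f.fn ⁻¹' {a} ∩ (g.fn ⁻¹' {b} ∩ k.fn ⁻¹' {c})) =
      μ.real (g.fn ⁻¹' {b} ∩ k.fn ⁻¹' {c}) := fun b c =>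
    sum_real_preimage μ f _ ((g.meas b).inter (k.meas c))
  have s3 : ∀ c, ∑ a, μ.real (f.fn ⁻¹' {a} ∩ k.fn ⁻¹' {c}) = μ.real (k.fn ⁻¹' {c}) := fun c =>
    sum_real_preimage μ f _ (k.meas c)
  simp only [s1, s2, s3] at h
  rw [e1, e2, e2]
  exact h

lemma cent_nonneg (f g : FinVar X) : 0 ≤ cent μ f g :=
  sub_nonneg.2 (ent_mono μ (le_sup_right f g))

lemma cent_mono {f f' : FinVar X} (h : f ≤ f') (g : FinVar X) : cent μ f g ≤ cent μ f' g :=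
  sub_le_sub_right (ent_mono μ (sup_mono h (le_refl g))) _

lemma cent_anti (f : FinVar X) {g g' : FinVar X} (h : g ≤ g') : cent μ f g' ≤ cent μ f g := by
  have h1 := ent_submodular μ f g' g
  have h2 : ent μ (g' ⊔ g) = ent μ g' := ent_congr μ (sup_le (le_refl _) h) (le_sup_left _ _)
  have h3 : ent μ (f ⊔ g') ≤ ent μ (f ⊔ (g' ⊔ g)) :=
    ent_mono μ (sup_mono (le_refl _) (le_sup_left _ _))
  unfold cent
  linarith

lemma cent_le_ent (f g : FinVar X) : cent μ f g ≤ ent μ f := by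
  have h := cent_anti μ f (g := const X) (g' := g) (fun _ _ _ => rfl)
  have h2 : ent μ (f ⊔ const X) = ent μ f :=
    ent_congr μ (sup_le (le_refl _) (fun _ _ _ => rfl)) (le_sup_left _ _)
  have h3 := ent_const μ
  unfold cent at *
  linarith

lemma ent_sup_le (f g : FinVar X) : ent μ (f ⊔ g) ≤ ent μ f + ent μ g := by
  have := cent_le_ent μ f g
  unfold cent at this; linarith

lemma cent_sup (f g k : FinVar X) : cent μ (f ⊔ g) k = cent μ g k + cent μ f (g ⊔ k) := by
  unfold cent
  have : ent μ (f ⊔ g ⊔ k) = ent μ (f ⊔ (g ⊔ k)) := by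
    refine ent_congr μ (fun x y e => ?_) (fun x y e => ?_)
    · obtain ⟨h1, h2⟩ := Prod.ext_iff.1 e
      obtain ⟨h2, h3⟩ := Prod.ext_iff.1 h2
      exact Prod.ext (Prod.ext h1 h2) h3
    · obtain ⟨h1, h2⟩ := Prod.ext_iff.1 e
      obtain ⟨h1, h3⟩ := Prod.ext_iff.1 h1
      exact Prod.ext h1 (Prod.ext h3 h2)
  rw [this]; ring

lemma cent_sup_le (f g k : FinVar X) : cent μ (f ⊔ g) k ≤ cent μ f k + cent μ g k := by
  rw [cent_sup]
  have := cent_anti μ f (le_sup_right g k)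
  linarith

lemma cent_triangle (f g k : FinVar X) : cent μ f k ≤ cent μ f g + cent μ g k := by
  have h1 := cent_mono μ (le_sup_left f g) k
  rw [cent_sup] at h1
  have := cent_anti μ f (le_sup_left g k)
  linarith

lemma ent_le_add_cent (f g : FinVar X) : ent μ f ≤ ent μ g + cent μ f g := by
  have := ent_mono μ (le_sup_left f g)
  unfold cent; linarith

lemma cent_eq_zero_of_le {f g : FinVar X} (h : f ≤ g) : cent μ f g = 0 := by
  unfold cent
  rw [ent_congr μ (sup_le h (le_refl g)) (le_sup_right f g), sub_self]

/-- Two events that differ by little have small conditional entropy. -/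
lemma exists_cent_ind_le {ε : ℝ} (hε : 0 < ε) :
    ∃ δ > 0, ∀ (D D' : Set X) (hD : MeasurableSet D) (hD' : MeasurableSet D'),
      μ.real (symmDiff D D') < δ → cent μ (ind D hD) (ind D' hD') ≤ ε := by
  have hc : Continuous fun p : ℝ => negMulLog p + negMulLog (1 - p) := by fun_prop
  have h0 := (hc.tendsto 0).eventually (eventually_lt_nhds (b := ε) (by simpa using hε))
  obtain ⟨δ, hδ, hδ'⟩ := Metric.eventually_nhds_iff.1 h0
  refine ⟨δ, hδ, fun D D' hD hD' h => ?_⟩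
  have hm := MeasurableSet.symmDiff hD hD'
  have h1 : ent μ (ind _ hm) = negMulLog (μ.real (symmDiff D D')) +
      negMulLog (1 - μ.real (symmDiff D D')) := by
    change ∑ r : Bool, _ = _
    rw [Fintype.sum_bool, ← probReal_compl_eq_one_sub hm]
    exact congrArg₂ _ 
      (congrArg (fun A => negMulLog (μ.real A)) (ind_preimage_true hm))
      (congrArg (fun A => negMulLog (μ.real A)) (ind_preimage_false hm))
  have h2 : ent μ (ind _ hm) < ε := by
    rw [h1]
    refine hδ' ?_
    rw [Real.dist_eq, sub_zero, abs_of_nonneg measureReal_nonneg]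
    exact h
  have h3 : ind D hD ⊔ ind D' hD' ≤ ind _ hm ⊔ ind D' hD' := by
    refine sup_le (fun x y e => ?_) (le_sup_right _ _)
    obtain ⟨h1, h2⟩ := Prod.ext_iff.1 e
    rw [ind_fn_eq] at *
    have a1 := (ind_fn_eq hm).1 h1
    have a2 := (ind_fn_eq hD').1 h2
    simp only [Set.mem_symmDiff] at a1
    tauto
  have h4 := ent_mono μ h3
  have h5 := ent_sup_le μ (ind _ hm) (ind D' hD')
  unfold cent
  linarith

end Entropy

end FinVar

end MeanLiYorke

namespace MeanLiYorke

open Real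

namespace FinVar

section Word

variable {X : Type*} [MeasurableSpace X] {T : X → X}

/-- The names of the points with respect to `Q` along the time window `[a, a + n)`. -/
def word (hT : Measurable T) (Q : FinVar X) (a n : ℕ) : FinVar X where
  R := Fin n → Q.R
  fn := fun x i => Q.fn (T^[a + i] x)
  meas := fun r => by
    have : (fun x (i : Fin n) => Q.fn (T^[a + i] x)) ⁻¹' {r} =
        ⋂ i : Fin n, T^[a + i] ⁻¹' (Q.fn ⁻¹' {r i}) := by
      ext x; simp [funext_iff]
    rw [this]
    exact MeasurableSet.iInter fun i => hT.iterate _ (Q.meas _)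

variable (hT : Measurable T)

lemma word_fn_eq {Q : FinVar X} {a n : ℕ} {x y : X} :
    (word hT Q a n).fn x = (word hT Q a n).fn y ↔
      ∀ i < n, Q.fn (T^[a + i] x) = Q.fn (T^[a + i] y) := by
  change (fun i : Fin n => Q.fn (T^[a + i] x)) = (fun i : Fin n => Q.fn (T^[a + i] y)) ↔ _
  rw [funext_iff, Fin.forall_iff]

lemma word_le_word (Q : FinVar X) {a n b m : ℕ} (h1 : b ≤ a) (h2 : a + n ≤ b + m) :
    word hT Q a n ≤ word hT Q b m := by
  intro x y e
  rw [word_fn_eq] at e ⊢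
  intro i hi
  have := e (a + i - b) (by omega)
  rwa [show b + (a + i - b) = a + i by omega] at this

lemma word_mono {Q Q' : FinVar X} (h : Q ≤ Q') (a n : ℕ) :
    word hT Q a n ≤ word hT Q' a n := by
  intro x y e
  rw [word_fn_eq] at e ⊢
  exact fun i hi => h _ _ (e i hi)

lemma word_add_le (Q : FinVar X) (a m n : ℕ) :
    word hT Q a (m + n) ≤ word hT Q a m ⊔ word hT Q (a + m) n := by
  intro x y e
  obtain ⟨e1, e2⟩ := Prod.ext_iff.1 e
  change (word hT Q a m).fn x = (word hT Q a m).fn y at e1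
  change (word hT Q (a + m) n).fn x = (word hT Q (a + m) n).fn y at e2
  rw [word_fn_eq] at e1 e2 ⊢
  intro i hi
  by_cases h : i < m
  · exact e1 i h
  · have := e2 (i - m) (by omega)
    rwa [show a + m + (i - m) = a + i by omega] at this

lemma word_sup_le (f g : FinVar X) (a n : ℕ) :
    word hT (f ⊔ g) a n ≤ word hT f a n ⊔ word hT g a n := by
  intro x y e
  obtain ⟨e1, e2⟩ := Prod.ext_iff.1 e
  change (word hT f a n).fn x = (word hT f a n).fn y at e1
  change (word hT g a n).fn x = (word hT g a n).fn y at e2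
  rw [word_fn_eq] at e1 e2 ⊢
  exact fun i hi => Prod.ext (e1 i hi) (e2 i hi)

lemma comp_word_le (Q : FinVar X) (a b n : ℕ) :
    (word hT Q a n).comp T^[b] (hT.iterate b) ≤ word hT Q (a + b) n := by
  intro x y e
  rw [word_fn_eq] at e
  change (word hT Q a n).fn (T^[b] x) = (word hT Q a n).fn (T^[b] y)
  rw [word_fn_eq]
  intro i hi
  have := e i hi
  rwa [show a + b + i = (a + i) + b by omega, Function.iterate_add_apply T (a + i),
    Function.iterate_add_apply T (a + i)] at this

lemma word_le_comp (Q : FinVar X) (a b n : ℕ) :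
    word hT Q (a + b) n ≤ (word hT Q a n).comp T^[b] (hT.iterate b) := by
  intro x y e
  change (word hT Q a n).fn (T^[b] x) = (word hT Q a n).fn (T^[b] y) at e
  rw [word_fn_eq] at e ⊢
  intro i hi
  rw [show a + b + i = (a + i) + b by omega, Function.iterate_add_apply T (a + i),
    Function.iterate_add_apply T (a + i)]
  exact e i hi

lemma comp_le_word (Q : FinVar X) {a n b : ℕ} (h1 : a ≤ b) (h2 : b < a + n) :
    Q.comp T^[b] (hT.iterate b) ≤ word hT Q a n := by
  intro x y e
  rw [word_fn_eq] at e
  have := e (b - a) (by omega)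
  rwa [show a + (b - a) = b by omega] at this

lemma comp_sup_le {f g k : FinVar X} (h : f.comp T hT ≤ k) (h' : g.comp T hT ≤ k) :
    (f ⊔ g).comp T hT ≤ k :=
  fun x y e => Prod.ext (h x y e) (h' x y e)

lemma word_succ_le (Q : FinVar X) (a n : ℕ) :
    word hT Q a (n + 1) ≤ word hT Q a n ⊔ Q.comp T^[a + n] (hT.iterate (a + n)) := by
  intro x y e
  obtain ⟨e1, e2⟩ := Prod.ext_iff.1 e
  change (word hT Q a n).fn x = (word hT Q a n).fn y at e1
  rw [word_fn_eq] at e1 ⊢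
  intro i hi
  rcases Nat.lt_succ_iff_lt_or_eq.1 hi with h | rfl
  · exact e1 i h
  · exact e2

lemma word_zero_le (Q : FinVar X) (a : ℕ) (f : FinVar X) : word hT Q a 0 ≤ f := by
  intro x y _
  rw [word_fn_eq]
  intro i hi; omega

lemma word_word_le (Q : FinVar X) (n m : ℕ) :
    word hT (word hT Q 0 n) 0 m ≤ word hT Q 0 (m + n) := by
  intro x y e
  rw [word_fn_eq] at e ⊢
  intro i hi
  rw [word_fn_eq]
  intro j hj
  have := e (j + i) (by omega)
  simp only [zero_add] at this ⊢
  rwa [Function.iterate_add_apply, Function.iterate_add_apply] at this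

end Word

section Rate

variable {X : Type*} [MeasurableSpace X] {μ : Measure X} [IsProbabilityMeasure μ] {T : X → X}
  (hT : MeasurePreserving T μ μ)

lemma ent_word (Q : FinVar X) (a n : ℕ) :
    ent μ (word hT.measurable Q a n) = ent μ (word hT.measurable Q 0 n) := by
  rw [← ent_comp μ μ (hT.iterate a) (word hT.measurable Q 0 n)]
  have h1 := word_le_comp hT.measurable Q 0 a n
  have h2 := comp_word_le hT.measurable Q 0 a n
  rw [zero_add] at h1 h2
  exact ent_congr μ h1 h2

lemma subadditive_ent_word (Q : FinVar X) :
    Subadditive fun n => ent μ (word hT.measurable Q 0 n) := by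
  intro m n
  refine (ent_mono μ (word_add_le hT.measurable Q 0 m n)).trans ?_
  refine (ent_sup_le μ _ _).trans ?_
  rw [ent_word hT Q (0 + m)]

/-- The entropy rate (the entropy of the transformation with respect to a partition). -/
noncomputable def rate (Q : FinVar X) : ℝ := (subadditive_ent_word hT Q).lim

lemma bddBelow_ent_word (Q : FinVar X) :
    BddBelow (Set.range fun n => ent μ (word hT.measurable Q 0 n) / n) :=
  ⟨0, by rintro _ ⟨n, rfl⟩; exact div_nonneg (ent_nonneg μ _) n.cast_nonneg⟩

lemma mul_rate_le (Q : FinVar X) (n : ℕ) :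
    n * rate hT Q ≤ ent μ (word hT.measurable Q 0 n) := by
  rcases Nat.eq_zero_or_pos n with rfl | hn
  · simpa using ent_nonneg μ _
  · have := (subadditive_ent_word hT Q).lim_le_div (bddBelow_ent_word hT Q) hn.ne'
    rw [le_div_iff₀ (by exact_mod_cast hn)] at this
    rw [mul_comm]; exact this

lemma exists_ent_word_le (Q : FinVar X) {ε : ℝ} (hε : 0 < ε) :
    ∃ C, ∀ n : ℕ, ent μ (word hT.measurable Q 0 n) ≤ n * (rate hT Q + ε) + C := by
  have h := (subadditive_ent_word hT Q).tendsto_lim (bddBelow_ent_word hT Q)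
  have h' := h.eventually (eventually_lt_nhds (b := rate hT Q + ε) (by
    change rate hT Q < _; linarith))
  obtain ⟨N, hN⟩ := eventually_atTop.1 h'
  have hr : 0 ≤ rate hT Q := ge_of_tendsto' h
    fun n => div_nonneg (ent_nonneg μ _) n.cast_nonneg
  refine ⟨ent μ (word hT.measurable Q 0 (N + 1)), fun n => ?_⟩
  rcases le_total n (N + 1) with hn | hn
  · have h1 := ent_mono μ (word_le_word hT.measurable Q (Nat.le_refl 0) (by omega : 0 + n ≤ 0 + (N + 1)))
    have : 0 ≤ n * (rate hT Q + ε) := by positivity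
    linarith
  · have h1 := hN n (by omega)
    have hn0 : (0 : ℝ) < n := by exact_mod_cast (by omega : 0 < n)
    rw [div_lt_iff₀ hn0] at h1
    have := ent_nonneg μ (word hT.measurable Q 0 (N + 1))
    linarith

lemma cent_word_le (f G : FinVar X) (a n : ℕ) {c : ℝ}
    (h : ∀ i < n, cent μ (f.comp T^[a + i] (hT.iterate _).measurable) G ≤ c) :
    cent μ (word hT.measurable f a n) G ≤ n * c := by
  induction n with
  | zero =>
    rw [cent_eq_zero_of_le μ (word_zero_le hT.measurable f a G)]; simp
  | succ n ih =>
    have h1 := cent_mono μ (word_succ_le hT.measurable f a n) G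
    have h2 := cent_sup_le μ (word hT.measurable f a n)
      (f.comp T^[a + n] (hT.measurable.iterate (a + n))) G
    have h3 := ih fun i hi => h i (by omega)
    have h4 := h n (by omega)
    push_cast
    linarith

/-- `γ` has zero entropy rate. -/
def IsZero (γ : FinVar X) : Prop :=
  ∀ ε > 0, ∃ C, ∀ n : ℕ, ent μ (word hT.measurable γ 0 n) ≤ n * ε + C

variable {hT}

lemma IsZero.mono {f g : FinVar X} (hg : IsZero hT g) (h : f ≤ g) : IsZero hT f := by
  intro ε hε
  obtain ⟨C, hC⟩ := hg ε hε
  exact ⟨C, fun n => (ent_mono μ (word_mono hT.measurable h 0 n)).trans (hC n)⟩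

lemma IsZero.sup {f g : FinVar X} (hf : IsZero hT f) (hg : IsZero hT g) : IsZero hT (f ⊔ g) := by
  intro ε hε
  obtain ⟨C, hC⟩ := hf (ε / 2) (by positivity)
  obtain ⟨C', hC'⟩ := hg (ε / 2) (by positivity)
  refine ⟨C + C', fun n => ?_⟩
  have h1 := ent_mono μ (word_sup_le hT.measurable f g 0 n)
  have h2 := ent_sup_le μ (word hT.measurable f 0 n) (word hT.measurable g 0 n)
  have h3 := hC n
  have h4 := hC' n
  linarith

lemma IsZero.word {f : FinVar X} (hf : IsZero hT f) (m : ℕ) :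
    IsZero hT (word hT.measurable f 0 m) := by
  intro ε hε
  obtain ⟨C, hC⟩ := hf ε hε
  refine ⟨m * ε + C, fun n => ?_⟩
  have h1 := ent_mono μ (word_word_le hT.measurable f m n)
  have h2 := hC (n + m)
  push_cast at h2
  linarith

lemma isZero_const : IsZero hT (FinVar.const X) := by
  intro ε hε
  refine ⟨0, fun n => ?_⟩
  have h1 : ent μ (FinVar.word hT.measurable (FinVar.const X) 0 n) ≤ ent μ (FinVar.const X) := by
    refine ent_mono μ fun x y _ => ?_
    rw [word_fn_eq]
    exact fun _ _ => rfl
  rw [ent_const] at h1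
  have : 0 ≤ n * ε := by positivity
  linarith

lemma isZero_of_approx {f : FinVar X}
    (h : ∀ ε > 0, ∃ γ, IsZero hT γ ∧ cent μ f γ ≤ ε) : IsZero hT f := by
  intro ε hε
  obtain ⟨γ, hγ, hfγ⟩ := h (ε / 2) (by positivity)
  obtain ⟨C, hC⟩ := hγ (ε / 2) (by positivity)
  refine ⟨C, fun n => ?_⟩
  have h1 := ent_le_add_cent μ (FinVar.word hT.measurable f 0 n) (FinVar.word hT.measurable γ 0 n)
  have h2 := cent_word_le hT f (FinVar.word hT.measurable γ 0 n) 0 n (c := ε / 2) (by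
    intro i hi
    refine _root_.le_trans ?_ hfγ
    rw [← cent_comp μ (hT.iterate (0 + i)) f γ]
    exact cent_anti μ _ (comp_le_word hT.measurable γ (by omega) (by omega)))
  have h3 := hC n
  linarith

lemma isZero_comp_iff {f : FinVar X} : IsZero hT (f.comp T hT.measurable) ↔ IsZero hT f := by
  have h : ∀ n, ent μ (FinVar.word hT.measurable (f.comp T hT.measurable) 0 n) =
      ent μ (FinVar.word hT.measurable f 0 n) := by
    intro n
    rw [← ent_word hT f 1 n]
    refine ent_congr μ (fun x y e => ?_) (fun x y e => ?_)
    · rw [word_fn_eq] at e ⊢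
      intro i hi
      have := e i hi
      rw [show 1 + i = (0 + i) + 1 by omega, Function.iterate_succ', Function.comp,
        Function.comp] at this
      exact this
    · rw [word_fn_eq] at e ⊢
      intro i hi
      have := e i hi
      rw [show 1 + i = (0 + i) + 1 by omega, Function.iterate_succ', Function.comp,
        Function.comp]
      exact this
  simp only [IsZero, h]

lemma rate_le_zero_of_isZero {f : FinVar X} (hf : IsZero hT f) : rate hT f ≤ 0 := by
  refine le_of_forall_pos_le_add fun ε hε => ?_
  obtain ⟨C, hC⟩ := hf (ε / 2) (by positivity)
  by_contra hcon
  push Not at hcon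
  obtain ⟨n, hn⟩ := exists_nat_gt (C / (ε / 2))
  have h1 := mul_rate_le hT f n
  have h2 := hC n
  rw [div_lt_iff₀ (by positivity)] at hn
  have h3 : (n : ℝ) * (0 + ε) ≤ n * rate hT f := by gcongr
  nlinarith

/-- The past gives no information beyond the future when zero-entropy data are known. -/
lemma mul_rate_le_cent (Q : FinVar X) {γ : FinVar X} (hγ : IsZero hT γ) {n : ℕ} (hn : 0 < n)
    (k : ℕ) :
    n * rate hT Q ≤
      cent μ (FinVar.word hT.measurable Q 0 n) (FinVar.word hT.measurable Q n k ⊔ γ) := by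
  set W := FinVar.word hT.measurable with hW
  set g := cent μ (W Q 0 n) (W Q n k ⊔ γ) with hg
  have key : ∀ r : ℕ, cent μ (W Q 0 (r * n)) (W Q (r * n) k ⊔ W γ 0 (r * n)) ≤ r * g := by
    intro r
    induction r with
    | zero =>
      rw [zero_mul, cent_eq_zero_of_le μ (word_zero_le hT.measurable Q 0 _)]; simp
    | succ r ih =>
      set G := W Q ((r + 1) * n) k ⊔ W γ 0 ((r + 1) * n) with hG
      have e : (r + 1) * n = n + r * n := by ring
      have h1 : cent μ (W Q 0 ((r + 1) * n)) G ≤ cent μ (W Q 0 n ⊔ W Q n (r * n)) G := by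
        refine cent_mono μ ?_ G
        have := word_add_le hT.measurable Q 0 n (r * n)
        rw [zero_add] at this
        rw [e]; exact this
      rw [cent_sup] at h1
      have h2 : cent μ (W Q n (r * n)) G ≤ r * g := by
        refine _root_.le_trans ?_ ih
        rw [← cent_comp μ (hT.iterate n) (W Q 0 (r * n))]
        have a1 := word_le_comp hT.measurable Q 0 n (r * n)
        rw [zero_add] at a1
        refine (cent_mono μ a1 G).trans (cent_anti μ _ ?_)
        refine comp_sup_le _ ?_ ?_
        · refine le_trans (comp_word_le hT.measurable Q (r * n) n k) ?_
          rw [hG, e, add_comm n]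
          exact le_sup_left _ _
        · refine le_trans (comp_word_le hT.measurable γ 0 n (r * n)) ?_
          refine le_trans ?_ (le_sup_right _ _)
          exact word_le_word hT.measurable γ (by omega) (by rw [e]; omega)
      have h3 : cent μ (W Q 0 n) (W Q n (r * n) ⊔ G) ≤ g := by
        refine cent_anti μ _ (sup_le ?_ ?_)
        · refine le_trans (word_le_word hT.measurable Q (Nat.le_refl n)
            (by omega : n + k ≤ n + (r * n + k))) ?_
          refine le_trans (word_add_le hT.measurable Q n (r * n) k) ?_
          refine sup_mono (le_refl _) ?_
          rw [hG, e]
          exact le_sup_left _ _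
        · refine le_trans ?_ (le_trans (le_sup_right _ _) (le_sup_right _ _))
          exact comp_le_word hT.measurable γ (b := 0) (Nat.le_refl 0) (by rw [e]; omega)
      push_cast
      linarith
  refine le_of_forall_pos_le_add fun ε hε => ?_
  obtain ⟨C, hC⟩ := hγ (ε / (2 * n)) (by positivity)
  by_contra hcon
  push Not at hcon
  obtain ⟨r, hr⟩ := exists_nat_gt ((ent μ (W Q 0 k) + C) / (ε / 2))
  rw [div_lt_iff₀ (by positivity)] at hr
  have h1 := mul_rate_le hT Q (r * n)
  have h2 := ent_le_add_cent μ (W Q 0 (r * n)) (W Q (r * n) k ⊔ W γ 0 (r * n))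
  have h3 := key r
  have h4 := ent_sup_le μ (W Q (r * n) k) (W γ 0 (r * n))
  have h5 := hC (r * n)
  have h6 : ent μ (W Q (r * n) k) = ent μ (W Q 0 k) := ent_word hT Q (r * n) k
  have h7 : ((r * n : ℕ) : ℝ) * (ε / (2 * n)) = r * (ε / 2) := by
    have : (n : ℝ) ≠ 0 := by positivity
    push_cast; field_simp
  rw [h7] at h5
  push_cast at h1
  have h8 : (r : ℝ) * (g + ε) ≤ r * (n * rate hT Q) := by gcongr
  nlinarith

/-- An event which is, modulo zero-entropy data, measurable with respect to every future
of `Q` has zero entropy. -/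
lemma isZero_of_tail (Q : FinVar X) (D : Set X) (hD : MeasurableSet D)
    (h : ∀ a : ℕ, ∀ ε > 0, ∃ k γ, IsZero hT γ ∧
      cent μ (ind D hD) (FinVar.word hT.measurable Q a k ⊔ γ) ≤ ε) :
    IsZero hT (ind D hD) := by
  set W := FinVar.word hT.measurable with hW
  set f := ind D hD with hf
  have hrate_le : ∀ n : ℕ, n * rate hT Q ≤ cent μ (W Q 0 n) (W f 0 n) := by
    intro n
    rcases Nat.eq_zero_or_pos n with rfl | hn
    · simpa using cent_nonneg μ _ _
    refine le_of_forall_pos_le_add fun ε hε => ?_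
    obtain ⟨k, γ, hγ, hc⟩ := h n (ε / n) (by positivity)
    have h1 := mul_rate_le_cent Q (hγ.word n) hn (k + n)
    have h2 := cent_triangle μ (W Q 0 n) (W f 0 n) (W Q n (k + n) ⊔ W γ 0 n)
    have h3 : cent μ (W f 0 n) (W Q n (k + n) ⊔ W γ 0 n) ≤ n * (ε / n) := by
      refine cent_word_le hT f _ 0 n fun i hi => ?_
      refine _root_.le_trans ?_ hc
      rw [← cent_comp μ (hT.iterate (0 + i)) f]
      refine cent_anti μ _ (comp_sup_le _ ?_ ?_)
      · refine le_trans (comp_word_le hT.measurable Q n (0 + i) k) ?_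
        exact le_trans (word_le_word hT.measurable Q (by omega) (by omega)) (le_sup_left _ _)
      · exact le_trans (comp_le_word hT.measurable γ (by omega) (by omega)) (le_sup_right _ _)
    have h4 : (n : ℝ) * (ε / n) = ε := by field_simp
    linarith
  intro ε hε
  obtain ⟨k, γ, hγ, hc⟩ := h 0 (ε / 3) (by positivity)
  obtain ⟨C, hC⟩ := hγ (ε / 3) (by positivity)
  obtain ⟨C', hC'⟩ := exists_ent_word_le hT Q (ε := ε / 3) (by positivity)
  refine ⟨C + C' + ent μ (W Q 0 k), fun n => ?_⟩
  have h1 : cent μ (W f 0 n) (W Q 0 (n + k) ⊔ W γ 0 n) ≤ n * (ε / 3) := by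
    refine cent_word_le hT f _ 0 n fun i hi => ?_
    refine _root_.le_trans ?_ hc
    rw [← cent_comp μ (hT.iterate (0 + i)) f]
    refine cent_anti μ _ (comp_sup_le _ ?_ ?_)
    · refine le_trans (comp_word_le hT.measurable Q 0 (0 + i) k) ?_
      exact le_trans (word_le_word hT.measurable Q (by omega) (by omega)) (le_sup_left _ _)
    · exact le_trans (comp_le_word hT.measurable γ (by omega) (by omega)) (le_sup_right _ _)
  have h2 := cent_triangle μ (W f 0 n) (W Q 0 (n + k) ⊔ W γ 0 n) (W Q 0 n)
  have h3 := cent_sup_le μ (W Q 0 (n + k)) (W γ 0 n) (W Q 0 n)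
  have h4 := cent_le_ent μ (W γ 0 n) (W Q 0 n)
  have h5 := cent_mono μ (word_add_le hT.measurable Q 0 n k) (W Q 0 n)
  have h6 := cent_sup_le μ (W Q 0 n) (W Q (0 + n) k) (W Q 0 n)
  have h7 := cent_eq_zero_of_le μ (le_refl (W Q 0 n))
  have h8 := cent_le_ent μ (W Q (0 + n) k) (W Q 0 n)
  have h9 : ent μ (W Q (0 + n) k) = ent μ (W Q 0 k) := ent_word hT Q (0 + n) k
  have h10 := hrate_le n
  have h11 := hC n
  have h12 := hC' n
  have h13 : ent μ (W Q 0 n ⊔ W f 0 n) = ent μ (W f 0 n ⊔ W Q 0 n) :=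
    ent_congr μ (sup_le (le_sup_right _ _) (le_sup_left _ _))
      (sup_le (le_sup_right _ _) (le_sup_left _ _))
  have h14 : cent μ (W Q 0 n) (W f 0 n) = ent μ (W Q 0 n) + cent μ (W f 0 n) (W Q 0 n) -
      ent μ (W f 0 n) := by
    unfold cent
    linarith
  have h15 : cent μ (W Q 0 (n + k)) (W Q 0 n) ≤ ent μ (W Q 0 k) := by linarith
  linarith

end Rate

end FinVar

end MeanLiYorke

namespace MeanLiYorke

open Real FinVar

section Closure

variable {X : Type*} [MeasurableSpace X] (μ : Measure X) [IsProbabilityMeasure μ]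

/-- The event `D` is known up to arbitrarily small entropy from the members of `C`. -/
def Known (C : Set (FinVar X)) (D : Set X) : Prop :=
  ∃ hD : MeasurableSet D, ∀ ε > 0, ∃ c ∈ C, cent μ (ind D hD) c ≤ ε

variable {μ} {C : Set (FinVar X)}

lemma Known.union (hdir : ∀ f ∈ C, ∀ g ∈ C, ∃ k ∈ C, f ≤ k ∧ g ≤ k) {D E : Set X}
    (hD : Known μ C D) (hE : Known μ C E) : Known μ C (D ∪ E) := by
  obtain ⟨mD, hD⟩ := hD
  obtain ⟨mE, hE⟩ := hE
  refine ⟨mD.union mE, fun ε hε => ?_⟩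
  obtain ⟨c, hc, hc'⟩ := hD (ε / 2) (by positivity)
  obtain ⟨d, hd, hd'⟩ := hE (ε / 2) (by positivity)
  obtain ⟨k, hk, hck, hdk⟩ := hdir c hc d hd
  refine ⟨k, hk, ?_⟩
  have h1 : ind (D ∪ E) (mD.union mE) ≤ ind D mD ⊔ ind E mE := by
    intro x y e
    obtain ⟨e1, e2⟩ := Prod.ext_iff.1 e
    have e1 := (ind_fn_eq mD).1 e1
    have e2 := (ind_fn_eq mE).1 e2
    rw [ind_fn_eq]
    simp only [Set.mem_union]
    tauto
  have h2 := cent_mono μ h1 k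
  have h3 := cent_sup_le μ (ind D mD) (ind E mE) k
  have h4 := cent_anti μ (ind D mD) hck
  have h5 := cent_anti μ (ind E mE) hdk
  linarith

/-- The `σ`-algebra of events known from a directed family of finite variables. -/
@[reducible] def knownMS (μ : Measure X) [IsProbabilityMeasure μ] (C : Set (FinVar X)) (hne : C.Nonempty)
    (hdir : ∀ f ∈ C, ∀ g ∈ C, ∃ k ∈ C, f ≤ k ∧ g ≤ k) : MeasurableSpace X where
  MeasurableSet' := Known μ C
  measurableSet_empty := by
    refine ⟨MeasurableSet.empty, fun ε hε => ?_⟩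
    obtain ⟨c, hc⟩ := hne
    refine ⟨c, hc, ?_⟩
    rw [cent_eq_zero_of_le μ]
    · exact hε.le
    · intro x y _
      rw [ind_fn_eq]; simp
  measurableSet_compl := by
    rintro D ⟨mD, hD⟩
    refine ⟨mD.compl, fun ε hε => ?_⟩
    obtain ⟨c, hc, hc'⟩ := hD ε hε
    refine ⟨c, hc, (cent_mono μ ?_ c).trans hc'⟩
    intro x y e
    rw [ind_fn_eq] at *
    simp only [Set.mem_compl_iff]
    tauto
  measurableSet_iUnion := by
    intro D hD
    have mD : ∀ i, MeasurableSet (D i) := fun i => (hD i).1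
    refine ⟨MeasurableSet.iUnion mD, fun ε hε => ?_⟩
    have hE : ∀ n, Known μ C (Set.accumulate D n) := by
      intro n
      induction n with
      | zero => simpa using hD 0
      | succ n ih =>
        rw [Set.accumulate_succ]
        exact ih.union hdir (hD (n + 1))
    obtain ⟨δ, hδ, hδ'⟩ := exists_cent_ind_le μ (ε := ε / 2) (by positivity)
    have hlim : Tendsto (fun n => μ.real (Set.accumulate D n)) atTop
        (𝓝 (μ.real (⋃ i, D i))) :=
      (ENNReal.tendsto_toReal (measure_ne_top _ _)).comp tendsto_measure_iUnion_accumulate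
    obtain ⟨n, hn⟩ := (hlim.eventually (eventually_gt_nhds
      (b := μ.real (⋃ i, D i) - δ) (by linarith))).exists
    obtain ⟨mE, hE'⟩ := hE n
    obtain ⟨c, hc, hc'⟩ := hE' (ε / 2) (by positivity)
    refine ⟨c, hc, ?_⟩
    have hsub : Set.accumulate D n ⊆ ⋃ i, D i := Set.accumulate_subset_iUnion n
    have h1 := hδ' (⋃ i, D i) (Set.accumulate D n) (MeasurableSet.iUnion mD) mE (by
      rw [Set.symmDiff_def, Set.sdiff_eq_empty.2 hsub, Set.union_empty,
        measureReal_sdiff hsub mE]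
      linarith)
    have h2 := cent_triangle μ (ind (⋃ i, D i) (MeasurableSet.iUnion mD))
      (ind (Set.accumulate D n) mE) c
    linarith

end Closure

section Pinsker

variable {X : Type*} [MeasurableSpace X] {μ : Measure X} [IsProbabilityMeasure μ] {T : X → X}
  (hT : MeasurePreserving T μ μ)

/-- The Pinsker `σ`-algebra: the events of zero entropy. -/
@[reducible] def pinsker : MeasurableSpace X :=
  knownMS μ {γ | IsZero hT γ} ⟨FinVar.const X, isZero_const (hT := hT)⟩
    fun f hf g hg => ⟨f ⊔ g, IsZero.sup (hT := hT) hf hg, FinVar.le_sup_left f g, FinVar.le_sup_right f g⟩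

lemma measurableSet_pinsker {D : Set X} :
    MeasurableSet[pinsker hT] D ↔ ∃ hD : MeasurableSet D, IsZero hT (ind D hD) := by
  constructor
  · rintro ⟨hD, h⟩
    refine ⟨hD, isZero_of_approx fun ε hε => ?_⟩
    obtain ⟨c, hc, hc'⟩ := h ε hε
    exact ⟨c, hc, hc'⟩
  · rintro ⟨hD, h⟩
    exact ⟨hD, fun ε hε => ⟨_, h, (cent_eq_zero_of_le μ (FinVar.le_refl _)).trans_le hε.le⟩⟩

lemma pinsker_le : pinsker hT ≤ ‹MeasurableSpace X› :=
  fun _ hD => ((measurableSet_pinsker hT).1 hD).1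

lemma measurableSet_pinsker_preimage {D : Set X} (hD : MeasurableSet D) :
    MeasurableSet[pinsker hT] (T ⁻¹' D) ↔ MeasurableSet[pinsker hT] D := by
  rw [measurableSet_pinsker, measurableSet_pinsker]
  constructor
  · rintro ⟨_, h⟩
    exact ⟨hD, isZero_comp_iff.1 h⟩
  · rintro ⟨_, h⟩
    exact ⟨hT.measurable hD, isZero_comp_iff.2 h⟩

lemma measurableSet_pinsker_congr {D E : Set X} (hD : MeasurableSet[pinsker hT] D)
    (hE : MeasurableSet E) (h : E =ᵐ[μ] D) : MeasurableSet[pinsker hT] E := by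
  rw [measurableSet_pinsker] at hD ⊢
  obtain ⟨mD, hD⟩ := hD
  refine ⟨hE, isZero_of_approx fun ε hε => ⟨_, hD, ?_⟩⟩
  obtain ⟨δ, hδ, hδ'⟩ := exists_cent_ind_le μ hε
  refine hδ' E D hE mD ?_
  rw [measureReal_def, measure_symmDiff_eq_zero_iff.2 h]
  simpa using hδ

lemma rate_le_zero_of_pinsker (h : ‹MeasurableSpace X› ≤ pinsker hT) (P : FinVar X) :
    rate hT P ≤ 0 := by
  refine rate_le_zero_of_isZero ?_
  have key : ∀ s : Finset P.R, ∃ γ, IsZero hT γ ∧ ∀ r ∈ s, ind _ (P.meas r) ≤ γ := by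
    intro s
    induction s using Finset.cons_induction with
    | empty => exact ⟨_, isZero_const, by simp⟩
    | cons r s hr ih =>
      obtain ⟨γ, hγ, h'⟩ := ih
      obtain ⟨_, hz⟩ := (measurableSet_pinsker hT).1 (h _ (P.meas r))
      refine ⟨_, hγ.sup hz, fun r' hr' => ?_⟩
      rcases Finset.mem_cons.1 hr' with rfl | hr'
      · exact FinVar.le_sup_right _ _
      · exact FinVar.le_trans (h' r' hr') (FinVar.le_sup_left _ _)
  obtain ⟨γ, hγ, h'⟩ := key Finset.univ
  refine hγ.mono fun x y e => ?_
  have := (ind_fn_eq _).1 (h' (P.fn x) (Finset.mem_univ _) x y e)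
  simp only [Set.mem_preimage, Set.mem_singleton_iff, true_iff] at this
  exact this.symm

/-- The `σ`-algebra generated by the zero-entropy events and the future of `Q` after time `a`. -/
@[reducible] def tailMS (Q : FinVar X) (a : ℕ) : MeasurableSpace X :=
  pinsker hT ⊔ ⨆ k, MeasurableSpace.comap (FinVar.word hT.measurable Q a k).fn ⊤

lemma pinsker_le_tailMS (Q : FinVar X) (a : ℕ) : pinsker hT ≤ tailMS hT Q a := le_sup_left

lemma tailMS_le (Q : FinVar X) (a : ℕ) : tailMS hT Q a ≤ ‹MeasurableSpace X› := by
  refine sup_le (pinsker_le hT) (iSup_le fun k => ?_)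
  rintro _ ⟨S, -, rfl⟩
  exact meas_preimage _ S

lemma measurableSet_tailMS_word (Q : FinVar X) (a k : ℕ)
    (S : Set (FinVar.word hT.measurable Q a k).R) :
    MeasurableSet[tailMS hT Q a] ((FinVar.word hT.measurable Q a k).fn ⁻¹' S) := by
  have h : MeasurableSpace.comap (FinVar.word hT.measurable Q a k).fn ⊤ ≤ tailMS hT Q a :=
    le_trans (le_iSup (fun k => MeasurableSpace.comap (FinVar.word hT.measurable Q a k).fn ⊤) k)
      le_sup_right
  exact h _ ⟨S, trivial, rfl⟩

lemma tailMS_antitone (Q : FinVar X) : Antitone (tailMS hT Q) := by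
  refine antitone_nat_of_succ_le fun a => sup_le_sup_left (iSup_le fun k => ?_) _
  refine le_trans ?_
    (le_iSup (fun k => MeasurableSpace.comap (FinVar.word hT.measurable Q a k).fn ⊤) (k + 1))
  rintro _ ⟨S, -, rfl⟩
  have hle := FinVar.word_le_word hT.measurable Q (by omega : a ≤ a + 1)
    (by omega : a + 1 + k ≤ a + (k + 1))
  refine ⟨(FinVar.word hT.measurable Q a (k + 1)).fn ''
    ((FinVar.word hT.measurable Q (a + 1) k).fn ⁻¹' S), trivial, ?_⟩
  ext x
  constructor
  · rintro ⟨y, hy, e⟩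
    have := hle _ _ e
    simp only [Set.mem_preimage] at hy ⊢
    rwa [← this]
  · intro hx
    exact ⟨x, hx, rfl⟩

lemma iInf_tailMS_le (Q : FinVar X) : ⨅ a, tailMS hT Q a ≤ pinsker hT := by
  intro D hD
  rw [MeasurableSpace.measurableSet_iInf] at hD
  have key : ∀ a, Known μ {f | ∃ k γ, IsZero hT γ ∧
      f = FinVar.word hT.measurable Q a k ⊔ γ} D := by
    intro a
    have hle : tailMS hT Q a ≤ knownMS μ {f | ∃ k γ, IsZero hT γ ∧
        f = FinVar.word hT.measurable Q a k ⊔ γ} ⟨_, 0, _, isZero_const, rfl⟩ (by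
          rintro _ ⟨k, γ, hγ, rfl⟩ _ ⟨k', γ', hγ', rfl⟩
          refine ⟨_, ⟨k + k', _, hγ.sup hγ', rfl⟩, ?_, ?_⟩
          · exact FinVar.sup_mono (word_le_word _ _ (Nat.le_refl a) (by omega))
              (FinVar.le_sup_left _ _)
          · exact FinVar.sup_mono (word_le_word _ _ (Nat.le_refl a) (by omega))
              (FinVar.le_sup_right _ _)) := by
      refine sup_le ?_ (iSup_le fun k => ?_)
      · intro E hE
        obtain ⟨mE, hE⟩ := (measurableSet_pinsker hT).1 hE
        exact ⟨mE, fun ε hε => ⟨_, ⟨0, _, hE, rfl⟩,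
          (cent_eq_zero_of_le μ (FinVar.le_sup_right _ _)).trans_le hε.le⟩⟩
      · rintro _ ⟨S, -, rfl⟩
        refine ⟨meas_preimage _ S, fun ε hε => ⟨_, ⟨k, _, isZero_const, rfl⟩,
          (cent_eq_zero_of_le μ ?_).trans_le hε.le⟩⟩
        refine FinVar.le_trans ?_ (FinVar.le_sup_left _ _)
        intro x y e
        rw [ind_fn_eq]
        simp only [Set.mem_preimage, e]
    exact hle D (hD a)
  have mD : MeasurableSet D := (key 0).1
  refine (measurableSet_pinsker hT).2 ⟨mD, isZero_of_tail Q D mD fun a ε hε => ?_⟩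
  obtain ⟨_, ⟨k, γ, hγ, rfl⟩, h⟩ := (key a).2 ε hε
  exact ⟨k, γ, hγ, h⟩

end Pinsker

end MeanLiYorke

namespace MeanLiYorke

section Backward

variable {Ω : Type*} {m : MeasurableSpace Ω} [m0 : MeasurableSpace Ω] {μ : Measure Ω}

/-- A function which is a.e. measurable for all `σ`-algebras of a decreasing sequence is a.e.
measurable for any `σ`-algebra containing the intersection. -/
lemma aestronglyMeasurable_of_iInf {𝒜 : ℕ → MeasurableSpace Ω} (hanti : Antitone 𝒜)
    (hinf : ⨅ a, 𝒜 a ≤ m) {g : Ω → ℝ}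
    (hg : ∀ a, AEStronglyMeasurable[𝒜 a] g μ) : AEStronglyMeasurable[m] g μ := by
  choose u hu hgu using hg
  refine ⟨fun x => limsup (fun a => u a x) atTop, ?_, ?_⟩
  · have hmeas : ∀ a, Measurable[𝒜 a] (fun x => limsup (fun a => u a x) atTop) := by
      intro a
      have h1 : (fun x => limsup (fun b => u b x) atTop) =
          fun x => limsup (fun b => u (b + a) x) atTop := by
        ext x
        exact (limsup_nat_add (fun b => u b x) a).symm
      rw [h1]
      exact Measurable.limsup (mδ := 𝒜 a) fun b =>
        (hu (b + a)).measurable.mono (hanti (by omega)) (_root_.le_refl _)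
    have : Measurable[⨅ a, 𝒜 a] (fun x => limsup (fun a => u a x) atTop) := by
      intro s hs
      rw [MeasurableSpace.measurableSet_iInf]
      exact fun a => hmeas a hs
    exact (this.mono hinf (_root_.le_refl _)).stronglyMeasurable
  · filter_upwards [ae_all_iff.2 hgu] with x hx
    simp_rw [← hx]
    simp

variable [IsProbabilityMeasure μ]

/-- Convergence in mean of backward martingales. -/
lemma exists_integral_condExp_sub_lt {𝒜 : ℕ → MeasurableSpace Ω} (h𝒜 : ∀ a, 𝒜 a ≤ m0)
    (hanti : Antitone 𝒜) (hm : ∀ a, m ≤ 𝒜 a) (hinf : ⨅ a, 𝒜 a ≤ m)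
    {f : Ω → ℝ} (hf : MemLp f 2 μ) {ε : ℝ} (hε : 0 < ε) :
    ∃ a, ∫ x, |(μ[f | 𝒜 a]) x - (μ[f | m]) x| ∂μ < ε := by
  have hF : ∀ a, Fact (𝒜 a ≤ m0) := fun a => ⟨h𝒜 a⟩
  set U : ℕ → Submodule ℝ (Lp ℝ 2 μ) := fun a => lpMeas ℝ ℝ (𝒜 a) 2 μ with hU
  have hUanti : Antitone U := by
    intro a b hab u hu
    rw [mem_lpMeas_iff_aestronglyMeasurable] at hu ⊢
    exact hu.mono (hanti hab)
  have hcl : ∀ a, IsClosed (U a : Set (Lp ℝ 2 μ)) := fun a => by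
    have : CompleteSpace (U a) := inferInstanceAs (CompleteSpace (lpMeas ℝ ℝ (𝒜 a) 2 μ))
    exact (completeSpace_coe_iff_isComplete.1 this).isClosed
  have hproj : ∀ a, (U a).HasOrthogonalProjection := fun a => by
    have : CompleteSpace (U a) := inferInstanceAs (CompleteSpace (lpMeas ℝ ℝ (𝒜 a) 2 μ))
    infer_instance
  set F := hf.toLp f with hFdef
  obtain ⟨y, hy⟩ : ∃ y, Tendsto (fun a => (U a).starProjection F) atTop (𝓝 y) := by
    have hmono : Monotone fun a => (U a)ᗮ := fun a b hab => Submodule.orthogonal_le (hUanti hab)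
    have h1 := Submodule.starProjection_tendsto_closure_iSup (fun a => (U a)ᗮ) hmono F
    refine ⟨F - _, (tendsto_const_nhds.sub h1).congr fun a => ?_⟩
    rw [Submodule.starProjection_orthogonal_val, sub_sub_cancel]
  have hymem : ∀ b, y ∈ U b := fun b =>
    (hcl b).mem_of_tendsto hy (eventually_atTop.2 ⟨b, fun a ha =>
      hUanti ha (Submodule.starProjection_apply_mem _ _)⟩)
  have hym : AEStronglyMeasurable[m] y μ :=
    aestronglyMeasurable_of_iInf hanti hinf fun a =>
      mem_lpMeas_iff_aestronglyMeasurable.1 (hymem a)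
  have hyint : Integrable y μ :=
    memLp_one_iff_integrable.1 ((Lp.memLp y).mono_exponent one_le_two)
  obtain ⟨a, ha⟩ := ((tendsto_iff_norm_sub_tendsto_zero.1 hy).eventually
    (eventually_lt_nhds (b := ε / 2) (by positivity))).exists
  refine ⟨a, ?_⟩
  have hm0 : m ≤ m0 := (hm a).trans (h𝒜 a)
  have hg : ((U a).starProjection F : Ω → ℝ) =ᵐ[μ] μ[f | 𝒜 a] :=
    hf.condExpL2_ae_eq_condExp (𝕜 := ℝ) (h𝒜 a)
  have h1 : ∫ x, |(μ[f | 𝒜 a]) x - y x| ∂μ ≤ ‖(U a).starProjection F - y‖ := by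
    have e : (((U a).starProjection F - y : Lp ℝ 2 μ) : Ω → ℝ) =ᵐ[μ]
        fun x => (μ[f | 𝒜 a]) x - y x := by
      filter_upwards [Lp.coeFn_sub ((U a).starProjection F) y, hg] with x hx hx'
      rw [hx, Pi.sub_apply, hx']
    rw [Lp.norm_def, eLpNorm_congr_ae e]
    have hdiff_int : Integrable (fun x => (μ[f | 𝒜 a]) x - y x) μ := integrable_condExp.sub hyint
    have h2 : ∫ x, |(μ[f | 𝒜 a]) x - y x| ∂μ =
        (eLpNorm (fun x => (μ[f | 𝒜 a]) x - y x) 1 μ).toReal := by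
      rw [eLpNorm_one_eq_lintegral_enorm]
      exact integral_norm_eq_lintegral_enorm hdiff_int.aestronglyMeasurable
    rw [h2]
    refine ENNReal.toReal_mono ?_ (eLpNorm_le_eLpNorm_of_exponent_le one_le_two
      hdiff_int.aestronglyMeasurable)
    rw [← eLpNorm_congr_ae e]
    exact Lp.eLpNorm_ne_top _
  have h2 : ∫ x, |y x - (μ[f | m]) x| ∂μ ≤ ∫ x, |(μ[f | 𝒜 a]) x - y x| ∂μ := by
    have e1 : μ[(μ[f | 𝒜 a]) - ⇑y | m] =ᵐ[μ] fun x => (μ[f | m]) x - y x := by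
      have e2 := condExp_sub (μ := μ) (integrable_condExp (m := 𝒜 a) (f := f)) hyint m
      have e3 := condExp_condExp_of_le (μ := μ) (f := f) (hm a) (h𝒜 a)
      have e4 := condExp_of_aestronglyMeasurable' hm0 hym hyint
      filter_upwards [e2, e3, e4] with x h2 h3 h4
      rw [h2, Pi.sub_apply, h3, h4]
    have h3 := integral_abs_condExp_le (μ := μ) (m := m) ((μ[f | 𝒜 a]) - ⇑y)
    refine le_trans (le_of_eq (integral_congr_ae ?_)) h3
    filter_upwards [e1] with x hx
    rw [hx, abs_sub_comm]
  have h3 : ∫ x, |(μ[f | 𝒜 a]) x - (μ[f | m]) x| ∂μ ≤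
      ∫ x, |(μ[f | 𝒜 a]) x - y x| ∂μ + ∫ x, |y x - (μ[f | m]) x| ∂μ := by
    have i1 : Integrable (fun x => |(μ[f | 𝒜 a]) x - y x|) μ := (integrable_condExp.sub hyint).abs
    have i2 : Integrable (fun x => |y x - (μ[f | m]) x|) μ := (hyint.sub integrable_condExp).abs
    rw [← integral_add i1 i2]
    exact integral_mono (integrable_condExp.sub integrable_condExp).abs (i1.add i2)
      fun x => abs_sub_le _ _ _
  linarith

end Backward

end MeanLiYorke

namespace MeanLiYorke

open FinVar ProbabilityTheory

section CondIndep

variable {Ω : Type*} {m 𝒜 : MeasurableSpace Ω} [m0 : MeasurableSpace Ω] {μ : Measure Ω}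
  [IsProbabilityMeasure μ]

lemma integrable_indicator_one {A : Set Ω} (hA : MeasurableSet A) :
    Integrable (A.indicator fun _ => (1 : ℝ)) μ :=
  (integrable_const (1 : ℝ)).indicator hA

/-- The conditional dependence of an event `B` and an event `A ∈ 𝒜` is controlled by the effect
of `𝒜` on the conditional probability of `B`. -/
lemma abs_condExp_inter_sub_le (hm : m ≤ 𝒜) (h𝒜 : 𝒜 ≤ m0) {A B : Set Ω}
    (hA : MeasurableSet[𝒜] A) (hB : MeasurableSet B) :
    ∀ᵐ y ∂μ, |(μ⟦A ∩ B | m⟧) y - (μ⟦A | m⟧) y * (μ⟦B | m⟧) y| ≤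
      (μ[fun x => |(μ⟦B | 𝒜⟧) x - (μ⟦B | m⟧) x| | m]) y := by
  have hm0 : m ≤ m0 := hm.trans h𝒜
  set a : Ω → ℝ := A.indicator fun _ => 1 with ha
  set b : Ω → ℝ := B.indicator fun _ => 1 with hb
  have hai : Integrable a μ := integrable_indicator_one (h𝒜 _ hA)
  have hbi : Integrable b μ := integrable_indicator_one hB
  have hab : (A ∩ B).indicator (fun _ => (1 : ℝ)) = a * b := by
    ext x
    by_cases h1 : x ∈ A <;> by_cases h2 : x ∈ B <;> simp [a, b, h1, h2]
  have hmul : ∀ {g : Ω → ℝ}, Integrable g μ → Integrable (a * g) μ := by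
    intro g hg
    have : a * g = A.indicator g := by
      ext x
      by_cases h1 : x ∈ A <;> simp [a, h1]
    rw [this]
    exact hg.indicator (h𝒜 _ hA)
  have hasm : StronglyMeasurable[𝒜] a := stronglyMeasurable_const.indicator hA
  have e1 : μ[a * b | 𝒜] =ᵐ[μ] a * μ[b | 𝒜] :=
    condExp_mul_of_stronglyMeasurable_left hasm (hmul hbi) hbi
  have e2 : μ[a * b | m] =ᵐ[μ] μ[a * μ[b | 𝒜] | m] :=
    (condExp_condExp_of_le hm h𝒜).symm.trans (condExp_congr_ae e1)
  have e3 : μ[a * μ[b | m] | m] =ᵐ[μ] μ[a | m] * μ[b | m] :=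
    condExp_mul_of_stronglyMeasurable_right stronglyMeasurable_condExp
      (hmul integrable_condExp) hai
  have e4 : μ[a * μ[b | 𝒜] - a * μ[b | m] | m] =ᵐ[μ]
      μ[a * μ[b | 𝒜] | m] - μ[a * μ[b | m] | m] :=
    condExp_sub (hmul integrable_condExp) (hmul integrable_condExp) m
  have hd : Integrable (fun x => |(μ[b | 𝒜]) x - (μ[b | m]) x|) μ :=
    (integrable_condExp.sub integrable_condExp).abs
  have hdiff_int : Integrable (a * μ[b | 𝒜] - a * μ[b | m]) μ :=
    (hmul integrable_condExp).sub (hmul integrable_condExp)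
  have key : ∀ x, |(a * μ[b | 𝒜] - a * μ[b | m]) x| ≤ |(μ[b | 𝒜]) x - (μ[b | m]) x| := by
    intro x
    by_cases h1 : x ∈ A <;> simp [a, h1]
  have e5 := condExp_mono (m := m) hdiff_int hd (ae_of_all _ fun x => (le_abs_self _).trans (key x))
  have e6 := condExp_mono (m := m) hdiff_int.neg hd
    (ae_of_all _ fun x => (neg_le_abs _).trans (key x))
  have e7 := condExp_neg (μ := μ) (a * μ[b | 𝒜] - a * μ[b | m]) m
  filter_upwards [e2, e3, e4, e5, e6, e7] with y h2 h3 h4 h5 h6 h7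
  rw [hab, h2]
  rw [h7, Pi.neg_apply, h4, Pi.sub_apply, h3, Pi.mul_apply] at h6
  rw [h4, Pi.sub_apply, h3, Pi.mul_apply] at h5
  exact abs_le'.2 ⟨h5, h6⟩

variable [StandardBorelSpace Ω]

/-- Along a decreasing sequence of `σ`-algebras whose intersection is contained in `m`, events
become conditionally independent given `m` of any fixed event. -/
lemma ae_exists_condIndep {𝒜 : ℕ → MeasurableSpace Ω} (h𝒜 : ∀ a, 𝒜 a ≤ m0)
    (hanti : Antitone 𝒜) (hm : ∀ a, m ≤ 𝒜 a) (hinf : ⨅ a, 𝒜 a ≤ m) {B : Set Ω}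
    (hB : MeasurableSet B) {𝒞 : ℕ → Set (Set Ω)} (h𝒞 : ∀ a, (𝒞 a).Countable)
    (h𝒞' : ∀ a, ∀ A ∈ 𝒞 a, MeasurableSet[𝒜 a] A) :
    ∀ᵐ y ∂μ, ∀ η > 0, ∃ a, ∀ A ∈ 𝒞 a,
      |(condExpKernel μ m y).real (A ∩ B) -
        (condExpKernel μ m y).real A * (condExpKernel μ m y).real B| ≤ η := by
  have hm0 : m ≤ m0 := (hm 0).trans (h𝒜 0)
  set Δ : ℕ → Ω → ℝ := fun a => μ[fun x => |(μ⟦B | 𝒜 a⟧) x - (μ⟦B | m⟧) x| | m] with hΔ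
  have h1 : ∀ᵐ y ∂μ, ∀ a, ∀ A ∈ 𝒞 a,
      |(condExpKernel μ m y).real (A ∩ B) -
        (condExpKernel μ m y).real A * (condExpKernel μ m y).real B| ≤ Δ a y := by
    rw [ae_all_iff]
    intro a
    rw [ae_ball_iff (h𝒞 a)]
    intro A hA
    have mA := h𝒜 a _ (h𝒞' a A hA)
    filter_upwards [abs_condExp_inter_sub_le (μ := μ) (hm a) (h𝒜 a) (h𝒞' a A hA) hB,
      condExpKernel_ae_eq_condExp (μ := μ) hm0 mA, condExpKernel_ae_eq_condExp (μ := μ) hm0 hB,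
      condExpKernel_ae_eq_condExp (μ := μ) hm0 (mA.inter hB)] with y h1 h2 h3 h4
    rw [h2, h3, h4]
    exact h1
  have hΔ0 : ∀ a, 0 ≤ᵐ[μ] Δ a := fun a => condExp_nonneg (ae_of_all _ fun x => abs_nonneg _)
  have h2 : ∀ q : ℕ, ∀ᵐ y ∂μ, ∃ a, Δ a y ≤ 1 / ((q : ℝ) + 1) := by
    intro q
    have hq : (0 : ℝ) < 1 / ((q : ℝ) + 1) := by positivity
    set S := {y | ¬ ∃ a, Δ a y ≤ 1 / ((q : ℝ) + 1)} with hS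
    change μ S = 0
    rw [← measureReal_eq_zero_iff]
    refine le_antisymm (le_of_forall_pos_le_add fun ε hε => ?_) measureReal_nonneg
    obtain ⟨a, ha⟩ := exists_integral_condExp_sub_lt (μ := μ) h𝒜 hanti hm hinf
      (f := B.indicator fun _ => (1 : ℝ)) (memLp_indicator_const 2 hB 1
        (Or.inr (measure_ne_top _ _))) (ε := ε * (1 / ((q : ℝ) + 1))) (by positivity)
    have h3 := mul_meas_ge_le_integral_of_nonneg (hΔ0 a) integrable_condExp (1 / ((q : ℝ) + 1))
    rw [hΔ, integral_condExp hm0] at h3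
    have h4 : μ.real S ≤ μ.real {x | 1 / ((q : ℝ) + 1) ≤ Δ a x} := by
      refine measureReal_mono fun y hy => ?_
      by_contra h
      exact hy ⟨a, (not_le.1 h).le⟩
    have h5 := h3.trans_lt ha
    rw [mul_comm] at h5
    have h6 := lt_of_mul_lt_mul_right h5 hq.le
    rw [zero_add]
    exact h4.trans h6.le
  filter_upwards [h1, ae_all_iff.2 h2] with y hy1 hy2 η hη
  obtain ⟨q, hq⟩ := exists_nat_one_div_lt hη
  obtain ⟨a, ha⟩ := hy2 q
  exact ⟨a, fun A hA => (hy1 a A hA).trans (ha.trans hq.le)⟩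

end CondIndep

section Fibre

variable {X : Type*} [MeasurableSpace X] [StandardBorelSpace X] {μ : Measure X}
  [IsProbabilityMeasure μ]

/-- The conditional measure on the Pinsker fibre through a point. -/
noncomputable def fibre {T : X → X} (hT : MeasurePreserving T μ μ) (y : X) : Measure X :=
  condExpKernel μ (pinsker hT) y

instance {T : X → X} (hT : MeasurePreserving T μ μ) (y : X) :
    IsProbabilityMeasure (fibre hT y) := by
  unfold fibre; infer_instance

lemma ae_fibre_indep {T : X → X} (hT : MeasurePreserving T μ μ) (Q : FinVar X) {B : Set X}
    (hB : MeasurableSet B) :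
    ∀ᵐ y ∂μ, ∀ η > 0, ∃ a : ℕ, ∀ (k : ℕ) (S : Set (word hT.measurable Q a k).R),
      |(fibre hT y).real ((word hT.measurable Q a k).fn ⁻¹' S ∩ B) -
        (fibre hT y).real ((word hT.measurable Q a k).fn ⁻¹' S) * (fibre hT y).real B| ≤ η := by
  have h := ae_exists_condIndep (μ := μ) (m := pinsker hT) (𝒜 := tailMS hT Q)
    (tailMS_le hT Q) (tailMS_antitone hT Q) (pinsker_le_tailMS hT Q) (iInf_tailMS_le hT Q) hB
    (𝒞 := fun a => ⋃ k, Set.range fun S : Set (word hT.measurable Q a k).R =>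
      (word hT.measurable Q a k).fn ⁻¹' S)
    (fun a => Set.countable_iUnion fun k => Set.countable_range _)
    (fun a A hA => by
      obtain ⟨k, S, rfl⟩ := Set.mem_iUnion.1 hA
      exact measurableSet_tailMS_word hT Q a k S)
  filter_upwards [h] with y hy η hη
  obtain ⟨a, ha⟩ := hy η hη
  exact ⟨a, fun k S => ha _ (Set.mem_iUnion.2 ⟨k, S, rfl⟩)⟩

lemma measurable_fibre_apply {T : X → X} (hT : MeasurePreserving T μ μ) {B : Set X}
    (hB : MeasurableSet B) : Measurable[pinsker hT] fun y => fibre hT y B :=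
  measurable_condExpKernel hB

/-- The fibre measures are equivariant on each event. -/
lemma ae_fibre_comp_real {T : X ≃ᵐ X} (hT : MeasurePreserving T μ μ) {B : Set X}
    (hB : MeasurableSet B) :
    ∀ᵐ y ∂μ, (fibre hT (T y)).real B = (fibre hT y).real (T ⁻¹' B) := by
  have hm := pinsker_le hT
  have h1 : (fun y => (fibre hT y).real B) =ᵐ[μ] μ⟦B | pinsker hT⟧ :=
    condExpKernel_ae_eq_condExp hm hB
  have h2 : (fun y => (fibre hT y).real (T ⁻¹' B)) =ᵐ[μ] μ⟦T ⁻¹' B | pinsker hT⟧ :=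
    condExpKernel_ae_eq_condExp hm (hT.measurable hB)
  have hTm : Measurable[pinsker hT, pinsker hT] T := fun D hD =>
    (measurableSet_pinsker_preimage hT (hm D hD)).2 hD
  have hu : Measurable[pinsker hT] fun y => (fibre hT y).real B :=
    (measurable_fibre_apply hT hB).ennreal_toReal
  have hui : Integrable (fun y => (fibre hT y).real B) μ :=
    (integrable_condExp (μ := μ)).congr h1.symm
  refine EventuallyEq.trans ?_ h2.symm
  refine ae_eq_condExp_of_forall_setIntegral_eq hm
    (integrable_indicator_one (hT.measurable hB))
    (fun s hs _ => (hT.integrable_comp_of_integrable hui).integrableOn) (fun s hs _ => ?_)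
    (hu.comp hTm).stronglyMeasurable.aestronglyMeasurable
  have hs' : MeasurableSet[pinsker hT] (T.symm ⁻¹' s) := by
    rw [← measurableSet_pinsker_preimage hT (T.symm.measurable (hm s hs))]
    convert hs using 1
    ext x; simp
  have hss : s = T ⁻¹' (T.symm ⁻¹' s) := by ext x; simp
  have e1 : ∫ x in s, (fibre hT (T x)).real B ∂μ =
      ∫ x in T.symm ⁻¹' s, (fibre hT x).real B ∂μ := by
    conv_lhs => rw [hss]
    exact hT.setIntegral_preimage_emb T.measurableEmbedding (fun y => (fibre hT y).real B) _
  have e2 : ∫ x in T.symm ⁻¹' s, (fibre hT x).real B ∂μ =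
      ∫ x in T.symm ⁻¹' s, B.indicator (fun _ => (1 : ℝ)) x ∂μ := by
    rw [setIntegral_congr_ae (g := μ⟦B | pinsker hT⟧) (hm _ hs')
      (h1.mono fun x hx _ => hx)]
    exact setIntegral_condExp hm (integrable_indicator_one hB) hs'
  have e3 : ∫ x in s, (T ⁻¹' B).indicator (fun _ => (1 : ℝ)) x ∂μ =
      ∫ x in T.symm ⁻¹' s, B.indicator (fun _ => (1 : ℝ)) x ∂μ := by
    conv_lhs => rw [hss]
    exact hT.setIntegral_preimage_emb T.measurableEmbedding (B.indicator fun _ => (1 : ℝ)) _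
  rw [e1, e2, e3]

/-- If a.e. fibre measure gives a given event measure `0` or `1`, the event is Pinsker. -/
lemma measurableSet_pinsker_of_fibre {T : X → X} (hT : MeasurePreserving T μ μ) {B : Set X}
    (hB : MeasurableSet B) (h : ∀ᵐ y ∂μ, fibre hT y B = 0 ∨ fibre hT y B = 1) :
    MeasurableSet[pinsker hT] B := by
  have hm := pinsker_le hT
  set S := {y | fibre hT y B = 1} with hS
  have hSm : MeasurableSet[pinsker hT] S :=
    measurable_fibre_apply hT hB (measurableSet_singleton 1)
  refine measurableSet_pinsker_congr hT hSm hB ?_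
  have h1 : (fun y => (fibre hT y).real B) =ᵐ[μ] μ⟦B | pinsker hT⟧ :=
    condExpKernel_ae_eq_condExp hm hB
  have key : ∀ s, MeasurableSet[pinsker hT] s →
      ∫ y in s, (fibre hT y).real B ∂μ = μ.real (B ∩ s) := by
    intro s hs
    rw [setIntegral_congr_ae (g := μ⟦B | pinsker hT⟧) (hm _ hs) (h1.mono fun x hx _ => hx),
      setIntegral_condExp hm (integrable_indicator_one hB) hs, integral_indicator hB,
      Measure.restrict_restrict hB]
    simp
  have k1 : μ.real (B ∩ S) = μ.real S := by
    rw [← key S hSm, setIntegral_congr_fun (g := fun _ => (1 : ℝ)) (hm _ hSm)]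
    · simp
    · intro y hy
      change (fibre hT y B).toReal = 1
      rw [show fibre hT y B = 1 from hy]; simp
  have k2 : μ.real (B ∩ Sᶜ) = 0 := by
    rw [← key Sᶜ hSm.compl, setIntegral_congr_ae (g := fun _ => (0 : ℝ)) (hm _ hSm.compl)]
    · simp
    · filter_upwards [h] with y hy hyS
      rcases hy with hy | hy
      · simp [measureReal_def, hy]
      · exact absurd hy hyS
  rw [measureReal_eq_zero_iff] at k2
  have k3 : μ (S \ B) = 0 := by
    rw [← measureReal_eq_zero_iff]
    have := measureReal_inter_add_sdiff (μ := μ) (s := S) hB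
    rw [Set.inter_comm] at this
    linarith
  exact measure_symmDiff_eq_zero_iff.1 (by
    rw [Set.symmDiff_def, measure_union_null_iff]
    exact ⟨by rw [Set.sdiff_eq]; exact k2, k3⟩)

end Fibre

end MeanLiYorke

namespace MeanLiYorke

open FinVar ProbabilityTheory
open scoped ENNReal

lemma ae_forall_iterate {X : Type*} [MeasurableSpace X] {μ : Measure X} {T : X → X}
    (hT : MeasurePreserving T μ μ) {P : X → Prop} (h : ∀ᵐ y ∂μ, P y) :
    ∀ᵐ y ∂μ, ∀ p, P (T^[p] y) :=
  ae_all_iff.2 fun p => (hT.iterate p).quasiMeasurePreserving.ae h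

section Equivariance

variable {X : Type*} [MeasurableSpace X] [StandardBorelSpace X] {μ : Measure X}
  [IsProbabilityMeasure μ] {T : X ≃ᵐ X} (hT : MeasurePreserving T μ μ)

/-- The fibre measures are equivariant. -/
lemma ae_fibre_eq_map : ∀ᵐ y ∂μ, fibre hT (T y) = (fibre hT y).map T := by
  set C := generateSetAlgebra (MeasurableSpace.countableGeneratingSet X) with hC
  have hCc : C.Countable := countable_generateSetAlgebra MeasurableSpace.countable_countableGeneratingSet
  have hgen : ‹MeasurableSpace X› = MeasurableSpace.generateFrom C := by
    rw [hC, generateFrom_generateSetAlgebra_eq, MeasurableSpace.generateFrom_countableGeneratingSet]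
  have hCm : ∀ B ∈ C, MeasurableSet B := fun B hB => by
    rw [hgen]; exact MeasurableSpace.measurableSet_generateFrom hB
  have hpi : IsPiSystem C := fun s hs t ht _ => isSetAlgebra_generateSetAlgebra.inter_mem hs ht
  have h : ∀ᵐ y ∂μ, ∀ B ∈ C, (fibre hT (T y)).real B = (fibre hT y).real (T ⁻¹' B) :=
    (ae_ball_iff hCc).2 fun B hB => ae_fibre_comp_real hT (hCm B hB)
  filter_upwards [h] with y hy
  refine ext_of_generate_finite C hgen hpi (fun B hB => ?_) ?_
  · rw [Measure.map_apply T.measurable (hCm B hB)]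
    have := hy B hB
    rwa [measureReal_def, measureReal_def, ENNReal.toReal_eq_toReal_iff' (by simp) (by simp)] at this
  · rw [Measure.map_apply T.measurable MeasurableSet.univ]
    simp

lemma ae_fibre_iterate_eq_map :
    ∀ᵐ y ∂μ, ∀ p, fibre hT (T^[p] y) = (fibre hT y).map T^[p] := by
  filter_upwards [ae_forall_iterate hT (ae_fibre_eq_map hT)] with y hy
  intro p
  induction p with
  | zero => simp
  | succ p ih =>
    rw [Function.iterate_succ_apply', hy p, ih, Measure.map_map T.measurable
      (T.measurable.iterate p), ← Function.iterate_succ']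

lemma measurable_fibre_prod_apply {S : Set (X × X)} (hS : MeasurableSet S) :
    Measurable fun y => ((fibre hT y).prod (fibre hT y)) S := by
  have h : Measurable[pinsker hT] fun y =>
      (condExpKernel μ (pinsker hT) ×ₖ condExpKernel μ (pinsker hT)) y S :=
    Kernel.measurable_coe _ hS
  simp only [Kernel.prod_apply] at h
  exact h.mono (pinsker_le hT) le_rfl

end Equivariance

section Atoms

variable {X : Type*} [MeasurableSpace X]

/-- The names along late time windows are almost independent of the event `B`. -/
def AsympIndep {T : X → X} (hT : Measurable T) (κ : Measure X) (Q : FinVar X) (B : Set X) : Prop :=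
  ∀ η > 0, ∃ a : ℕ, ∀ (k : ℕ) (S : Set (word hT Q a k).R),
    |κ.real ((word hT Q a k).fn ⁻¹' S ∩ B) - κ.real ((word hT Q a k).fn ⁻¹' S) * κ.real B| ≤ η

lemma AsympIndep.exists_iterate {T : X → X} {hT : Measurable T} {κ : Measure X} {Q : FinVar X}
    {B : Set X} (h : AsympIndep hT κ Q B) {η : ℝ} (hη : 0 < η) :
    ∃ a : ℕ, ∀ p ≥ a, ∀ S : Set Q.R, |κ.real ((fun z => Q.fn (T^[p] z)) ⁻¹' S ∩ B) -
      κ.real ((fun z => Q.fn (T^[p] z)) ⁻¹' S) * κ.real B| ≤ η := by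
  obtain ⟨a, ha⟩ := h η hη
  refine ⟨a, fun p hp S => ?_⟩
  have := ha (p - a + 1) {w | w (Fin.last _) ∈ S}
  have e : (word hT Q a (p - a + 1)).fn ⁻¹' {w | w (Fin.last _) ∈ S} =
      (fun z => Q.fn (T^[p] z)) ⁻¹' S := by
    ext z
    change Q.fn (T^[a + (p - a)] z) ∈ S ↔ Q.fn (T^[p] z) ∈ S
    rw [show a + (p - a) = p by omega]
  rwa [e] at this

variable [MetricSpace X] [CompactSpace X] [BorelSpace X]

lemma measurableSet_dist_lt (r : ℝ) : MeasurableSet {z : X × X | dist z.1 z.2 < r} :=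
  (isOpen_lt (by fun_prop) (by fun_prop)).measurableSet

lemma measurableSet_le_dist (r : ℝ) : MeasurableSet {z : X × X | r ≤ dist z.1 z.2} :=
  (isClosed_le (by fun_prop) (by fun_prop)).measurableSet

/-- A fibre measure with an atom concentrates under iteration. -/
lemma tendsto_prod_le_dist_of_atom {T : X → X} (hT : Measurable T) {κ : Measure X}
    [IsProbabilityMeasure κ] {Q : FinVar X} {r : ℝ}
    (hQ : ∀ x y, Q.fn x = Q.fn y → dist x y < r) {𝓑 : Set (Set X)}
    (h𝓑 : TopologicalSpace.IsTopologicalBasis 𝓑) (hind : ∀ B ∈ 𝓑, AsympIndep hT κ Q B) {x : X}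
    (hx : 0 < κ.real {x}) :
    Tendsto (fun p => (κ.prod κ) {z | r ≤ dist (T^[p] z.1) (T^[p] z.2)}) atTop (𝓝 0) := by
  set A : ℕ → Set X := fun p => (fun z => Q.fn (T^[p] z)) ⁻¹' {Q.fn (T^[p] x)}ᶜ with hA
  have key : ∀ ε > 0, ∃ a : ℕ, ∀ p ≥ a, κ.real (A p) ≤ ε := by
    intro ε hε
    set η := ε * κ.real {x} / 2 with hη
    have hη0 : 0 < η := by positivity
    obtain ⟨U, hU, hUo, hUm⟩ := Set.exists_isOpen_le_add {x} κ
      (ε := ENNReal.ofReal η) (by simpa using hη0)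
    obtain ⟨B, hB, hxB, hBU⟩ := h𝓑.exists_subset_of_mem_open (Set.singleton_subset_iff.1 hU) hUo
    obtain ⟨a, ha⟩ := (hind B hB).exists_iterate hη0
    refine ⟨a, fun p hp => ?_⟩
    have h1 := ha p hp {Q.fn (T^[p] x)}ᶜ
    change |κ.real (A p ∩ B) - κ.real (A p) * κ.real B| ≤ η at h1
    have hxm : κ.real {x} ≤ κ.real B := measureReal_mono (by simpa using hxB)
    have hBle : κ.real B ≤ κ.real {x} + η := by
      have := ENNReal.toReal_mono (by simp) ((measure_mono hBU).trans hUm)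
      rwa [ENNReal.toReal_add (by simp) (by simp), ENNReal.toReal_ofReal hη0.le] at this
    have h2 : κ.real (A p ∩ B) ≤ η := by
      have e1 : κ.real (A p ∩ B) ≤ κ.real (B \ {x}) :=
        measureReal_mono fun z hz => ⟨hz.2, fun e => by
          rw [Set.mem_singleton_iff] at e
          subst e
          exact hz.1 rfl⟩
      have e2 := measureReal_sdiff_add_inter (μ := κ) (s := B) (measurableSet_singleton x)
      rw [Set.inter_eq_self_of_subset_right (by simpa using hxB)] at e2
      linarith
    have h3 : κ.real (A p) * κ.real B ≤ 2 * η := by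
      have := (abs_le.1 h1).1
      linarith
    have h4 : κ.real (A p) * κ.real {x} ≤ ε * κ.real {x} :=
      (mul_le_mul_of_nonneg_left hxm measureReal_nonneg).trans (h3.trans (by rw [hη]; linarith))
    exact le_of_mul_le_mul_right h4 hx
  have hsub : ∀ p, (κ.prod κ) {z | r ≤ dist (T^[p] z.1) (T^[p] z.2)} ≤ 2 * κ (A p) := by
    intro p
    have e : {z : X × X | r ≤ dist (T^[p] z.1) (T^[p] z.2)} ⊆
        (A p ×ˢ Set.univ) ∪ (Set.univ ×ˢ A p) := by
      rintro ⟨u, v⟩ huv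
      by_contra hn
      simp only [hA, Set.mem_union, Set.mem_prod, Set.mem_univ, and_true, true_and,
        Set.mem_preimage, Set.mem_compl_iff, Set.mem_singleton_iff, not_or, not_not] at hn
      exact absurd (hQ _ _ (hn.1.trans hn.2.symm)) (not_lt.2 huv)
    refine (measure_mono e).trans ((measure_union_le _ _).trans ?_)
    rw [Measure.prod_prod, Measure.prod_prod]
    simp [two_mul]
  have hlim : Tendsto (fun p => κ (A p)) atTop (𝓝 0) := by
    rw [ENNReal.tendsto_atTop_zero]
    intro ε hε
    by_cases hε' : ε = ∞
    · exact ⟨0, fun n _ => hε' ▸ le_top⟩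
    · obtain ⟨a, ha⟩ := key ε.toReal (ENNReal.toReal_pos hε.ne' hε')
      refine ⟨a, fun p hp => ?_⟩
      exact (ENNReal.toReal_le_toReal (by simp) hε').1 (ha p hp)
  have h2 : Tendsto (fun p => 2 * κ (A p)) atTop (𝓝 0) := by
    simpa using ENNReal.Tendsto.const_mul hlim (Or.inr (by simp : (2 : ℝ≥0∞) ≠ ∞))
  exact tendsto_of_tendsto_of_tendsto_of_le_of_le tendsto_const_nhds h2 (fun _ => zero_le) hsub

end Atoms

end MeanLiYorke

namespace MeanLiYorke

open FinVar ProbabilityTheory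
open scoped ENNReal

section Diagonal

variable {X : Type*} [MeasurableSpace X] [MetricSpace X] [CompactSpace X] [BorelSpace X]
  {μ : Measure X} [IsProbabilityMeasure μ]

lemma prod_map_apply {κ : Measure X} [IsProbabilityMeasure κ] {g : X → X} (hg : Measurable g)
    {S : Set (X × X)} (hS : MeasurableSet S) :
    ((κ.map g).prod (κ.map g)) S = (κ.prod κ) {z | (g z.1, g z.2) ∈ S} := by
  rw [Measure.map_prod_map _ _ hg hg, Measure.map_apply (hg.prodMap hg) hS]
  rfl

lemma exists_atom_of_diagonal {κ : Measure X} [IsProbabilityMeasure κ]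
    (h : (κ.prod κ) (Set.diagonal X) ≠ 0) : ∃ x, 0 < κ.real {x} := by
  by_contra hn
  push Not at hn
  apply h
  rw [Measure.prod_apply measurableSet_diagonal]
  have : ∀ x, κ (Prod.mk x ⁻¹' Set.diagonal X) = 0 := by
    intro x
    have e : Prod.mk x ⁻¹' Set.diagonal X = {x} := by
      ext z; simp [eq_comm]
    rw [e]
    have := le_antisymm (hn x) measureReal_nonneg
    rwa [measureReal_eq_zero_iff] at this
  simp [this]

/-- A system of positive entropy has, with positive probability, fibre measures without atoms. -/
lemma measure_diagonal_eq_zero_pos {T : X ≃ᵐ X} (hT : MeasurePreserving T μ μ) {P : FinVar X}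
    (hP : 0 < rate hT P) {Q : ℕ → FinVar X}
    (hQ : ∀ j x y, (Q j).fn x = (Q j).fn y → dist x y < 1 / ((j : ℝ) + 1)) :
    0 < μ {y | ((fibre hT y).prod (fibre hT y)) (Set.diagonal X) = 0} := by
  by_contra hn
  have h0 : ∀ᵐ y ∂μ, ((fibre hT y).prod (fibre hT y)) (Set.diagonal X) ≠ 0 := by
    rw [ae_iff]
    simpa using hn
  set 𝓑 := TopologicalSpace.countableBasis X
  have hind : ∀ᵐ y ∂μ, ∀ j, ∀ B ∈ 𝓑, AsympIndep hT.measurable (fibre hT y) (Q j) B := by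
    refine ae_all_iff.2 fun j => (ae_ball_iff (TopologicalSpace.countable_countableBasis X)).2
      fun B hB => ae_fibre_indep hT (Q j) ?_
    exact (TopologicalSpace.isOpen_of_mem_countableBasis hB).measurableSet
  have hlim : ∀ᵐ y ∂μ, ∀ j : ℕ, Tendsto (fun p => ((fibre hT (T^[p] y)).prod
      (fibre hT (T^[p] y))) {z | 1 / ((j : ℝ) + 1) ≤ dist z.1 z.2}) atTop (𝓝 0) := by
    filter_upwards [h0, hind, ae_fibre_iterate_eq_map hT] with y hy hy1 hy2
    intro j
    obtain ⟨x, hx⟩ := exists_atom_of_diagonal hy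
    have := tendsto_prod_le_dist_of_atom hT.measurable (hQ j)
      (TopologicalSpace.isBasis_countableBasis X) (hy1 j) hx
    refine this.congr fun p => ?_
    rw [hy2 p, prod_map_apply (T.measurable.iterate p) (measurableSet_le_dist _)]
    rfl
  have hzero : ∀ᵐ y ∂μ, ∀ j : ℕ, ((fibre hT y).prod (fibre hT y))
      {z | 1 / ((j : ℝ) + 1) ≤ dist z.1 z.2} = 0 := by
    refine ae_all_iff.2 fun j => ?_
    have hm := measurable_fibre_prod_apply hT (measurableSet_le_dist (X := X) (1 / ((j : ℝ) + 1)))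
    have h1 : Tendsto (fun p : ℕ => ∫⁻ y, ((fibre hT (T^[p] y)).prod
        (fibre hT (T^[p] y))) {z | 1 / ((j : ℝ) + 1) ≤ dist z.1 z.2} ∂μ) atTop
        (𝓝 (∫⁻ _, 0 ∂μ)) := by
      refine tendsto_lintegral_of_dominated_convergence (fun _ => 1)
        (fun p => hm.comp (T.measurable.iterate p)) (fun p => Eventually.of_forall fun y => prob_le_one)
        (by simp) ?_
      filter_upwards [hlim] with y hy using hy j
    have h2 : ∀ p : ℕ, ∫⁻ y, ((fibre hT (T^[p] y)).prod
        (fibre hT (T^[p] y))) {z | 1 / ((j : ℝ) + 1) ≤ dist z.1 z.2} ∂μ =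
        ∫⁻ y, ((fibre hT y).prod (fibre hT y)) {z | 1 / ((j : ℝ) + 1) ≤ dist z.1 z.2} ∂μ :=
      fun p => (hT.iterate p).lintegral_comp hm
    simp only [h2, lintegral_zero] at h1
    have h3 := tendsto_nhds_unique h1 tendsto_const_nhds
    exact (lintegral_eq_zero_iff hm).1 h3.symm
  have hpin : ‹MeasurableSpace X› ≤ pinsker hT := by
    intro B hB
    refine measurableSet_pinsker_of_fibre hT hB ?_
    filter_upwards [hzero] with y hy
    have h1 : ((fibre hT y).prod (fibre hT y)) (B ×ˢ Bᶜ) = 0 := by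
      refine measure_mono_null ?_ (measure_iUnion_null hy)
      rintro ⟨u, v⟩ ⟨hu, hv⟩
      have huv : 0 < dist u v := dist_pos.2 fun e => hv (e ▸ hu)
      obtain ⟨j, hj⟩ := exists_nat_one_div_lt huv
      exact Set.mem_iUnion.2 ⟨j, hj.le⟩
    rw [Measure.prod_prod, mul_eq_zero, prob_compl_eq_zero_iff hB] at h1
    exact h1
  exact absurd (rate_le_zero_of_pinsker hT hpin P) (not_le.2 hP)

end Diagonal

section Frequency

/-- The upper frequency with which the orbit of `y` visits `Y` along the times `s`. -/
noncomputable def upperFreq {X : Type*} (T : X → X) (s : ℕ → ℕ) (Y : Set X) (y : X) : ℝ≥0∞ :=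
  limsup (fun N : ℕ => (N : ℝ≥0∞)⁻¹ * ∑ k ∈ Finset.Icc 1 N, Y.indicator 1 (T^[s k] y)) atTop

lemma upperFreq_mono {X : Type*} (T : X → X) (s : ℕ → ℕ) {Y Y' : Set X} (h : Y ⊆ Y') (y : X) :
    upperFreq T s Y y ≤ upperFreq T s Y' y := by
  refine limsup_le_limsup (Eventually.of_forall fun N => ?_)
  dsimp only
  gcongr

lemma avg_le_one (N : ℕ) (f : ℕ → ℝ≥0∞) (hf : ∀ k, f k ≤ 1) :
    (N : ℝ≥0∞)⁻¹ * ∑ k ∈ Finset.Icc 1 N, f k ≤ 1 := by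
  calc (N : ℝ≥0∞)⁻¹ * ∑ k ∈ Finset.Icc 1 N, f k ≤ (N : ℝ≥0∞)⁻¹ * N := by
        gcongr
        calc ∑ k ∈ Finset.Icc 1 N, f k ≤ ∑ k ∈ Finset.Icc 1 N, 1 := Finset.sum_le_sum fun k _ => hf k
          _ = N := by simp
    _ ≤ 1 := ENNReal.inv_mul_le_one _

lemma upperFreq_le_one {X : Type*} (T : X → X) (s : ℕ → ℕ) (Y : Set X) (y : X) :
    upperFreq T s Y y ≤ 1 := by
  refine limsup_le_of_le (by isBoundedDefault) (Eventually.of_forall fun N => ?_)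
  exact avg_le_one N _ fun k => Set.indicator_le_self' (by simp) _

variable {X : Type*} [MeasurableSpace X] {μ : Measure X} [IsProbabilityMeasure μ] {T : X → X}

lemma measurable_upperFreq (hT : Measurable T) (s : ℕ → ℕ) {Y : Set X} (hY : MeasurableSet Y) :
    Measurable (upperFreq T s Y) := by
  refine Measurable.limsup fun N => ?_
  refine Measurable.const_mul (Finset.measurable_sum _ fun k _ => ?_) _
  exact (measurable_one.indicator hY).comp (hT.iterate _)

lemma measure_le_measure_upperFreq_pos (hT : MeasurePreserving T μ μ) (s : ℕ → ℕ) {Y : Set X}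
    (hY : MeasurableSet Y) : μ Y ≤ μ {y | 0 < upperFreq T s Y y} := by
  have hmeas : ∀ k, Measurable fun y => Y.indicator (1 : X → ℝ≥0∞) (T^[s k] y) := fun k =>
    (measurable_one.indicator hY).comp (hT.measurable.iterate _)
  have h := limsup_lintegral_le (μ := μ) (f := fun (N : ℕ) y =>
    (N : ℝ≥0∞)⁻¹ * ∑ k ∈ Finset.Icc 1 N, Y.indicator 1 (T^[s k] y)) (fun _ => 1)
    (fun N => Measurable.const_mul (Finset.measurable_sum _ fun k _ => hmeas k) _)
    (fun N => Eventually.of_forall fun y => avg_le_one N _ fun k =>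
      Set.indicator_le_self' (by simp) _) (by simp)
  have hdiff_int : ∀ N : ℕ, 1 ≤ N → ∫⁻ y, (N : ℝ≥0∞)⁻¹ * ∑ k ∈ Finset.Icc 1 N,
      Y.indicator 1 (T^[s k] y) ∂μ = μ Y := by
    intro N hN
    rw [lintegral_const_mul _ (Finset.measurable_sum _ fun k _ => hmeas k),
      lintegral_finsetSum _ fun k _ => hmeas k]
    have : ∀ k, ∫⁻ y, Y.indicator 1 (T^[s k] y) ∂μ = μ Y := fun k => by
      rw [(hT.iterate (s k)).lintegral_comp (measurable_one.indicator hY), lintegral_indicator_one hY]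
    simp only [this, Finset.sum_const, Nat.card_Icc, nsmul_eq_mul, Nat.add_sub_cancel]
    rw [← mul_assoc, ENNReal.inv_mul_cancel (by simp; omega) (by simp), one_mul]
  have hlim : limsup (fun N : ℕ => ∫⁻ y, (N : ℝ≥0∞)⁻¹ * ∑ k ∈ Finset.Icc 1 N,
      Y.indicator 1 (T^[s k] y) ∂μ) atTop = μ Y := by
    refine Tendsto.limsup_eq (tendsto_const_nhds.congr' ?_)
    filter_upwards [eventually_ge_atTop 1] with N hN using (hdiff_int N hN).symm
  rw [hlim] at h
  refine h.trans ?_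
  have hms : MeasurableSet {y | 0 < upperFreq T s Y y} :=
    measurableSet_lt measurable_const (measurable_upperFreq hT.measurable s hY)
  rw [← lintegral_indicator_one hms]
  refine lintegral_mono fun y => ?_
  change upperFreq T s Y y ≤ _
  by_cases hy : 0 < upperFreq T s Y y
  · rw [Set.indicator_of_mem (by exact hy)]
    exact upperFreq_le_one T s Y y
  · simp [not_lt.1 hy]

end Frequency

end MeanLiYorke

namespace MeanLiYorke

open FinVar ProbabilityTheory
open scoped ENNReal

section GoodFibre

lemma exists_frequently_card_of_upperFreq_pos {X : Type*} {T : X → X} {s : ℕ → ℕ} {Y : Set X}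
    {y : X} (h : 0 < upperFreq T s Y y) [DecidablePred (· ∈ Y)] :
    ∃ c : ℝ, 0 < c ∧ ∃ᶠ N : ℕ in atTop,
      c * N ≤ ((Finset.Icc 1 N).filter fun k => T^[s k] y ∈ Y).card := by
  obtain ⟨c, hc0, hc⟩ := exists_between h
  have hct : c ≠ ∞ := (hc.trans_le (upperFreq_le_one T s Y y)).ne_top ∘ fun e => by simp [e]
  refine ⟨c.toReal, ENNReal.toReal_pos hc0.ne' hct, ?_⟩
  refine ((frequently_lt_of_lt_limsup (by isBoundedDefault) hc).and_eventually
    (eventually_ge_atTop 1)).mono ?_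
  rintro N ⟨hN, hN1⟩
  have hsum : ∑ k ∈ Finset.Icc 1 N, Y.indicator (1 : X → ℝ≥0∞) (T^[s k] y) =
      ((Finset.Icc 1 N).filter fun k => T^[s k] y ∈ Y).card := by
    rw [Finset.card_filter]
    push_cast
    exact Finset.sum_congr rfl fun k _ => by simp [Set.indicator_apply]
  rw [hsum] at hN
  have hN0 : (N : ℝ≥0∞) ≠ 0 := by simp; omega
  have h2 : c * N ≤ ((Finset.Icc 1 N).filter fun k => T^[s k] y ∈ Y).card := by
    calc c * N ≤ ((N : ℝ≥0∞)⁻¹ * ((Finset.Icc 1 N).filter fun k => T^[s k] y ∈ Y).card) * N := by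
          gcongr
      _ = _ := by
          rw [mul_comm (N : ℝ≥0∞)⁻¹, mul_assoc, ENNReal.inv_mul_cancel hN0 (by simp), mul_one]
  have := ENNReal.toReal_mono (by simp) h2
  simpa using this

variable {X : Type*} [MeasurableSpace X] [MetricSpace X] [CompactSpace X] [BorelSpace X]
  {μ : Measure X} [IsProbabilityMeasure μ]

lemma tendsto_prod_dist_lt {κ : Measure X} [IsProbabilityMeasure κ]
    (h : (κ.prod κ) (Set.diagonal X) = 0) :
    Tendsto (fun q : ℕ => (κ.prod κ) {z | dist z.1 z.2 < 1 / ((q : ℝ) + 1)}) atTop (𝓝 0) := by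
  have hanti : Antitone fun q : ℕ => {z : X × X | dist z.1 z.2 < 1 / ((q : ℝ) + 1)} :=
    fun a b hab z (hz : dist z.1 z.2 < 1 / ((b : ℝ) + 1)) =>
      show dist z.1 z.2 < 1 / ((a : ℝ) + 1) from hz.trans_le (Nat.one_div_le_one_div hab)
  have h1 := tendsto_measure_iInter_atTop (μ := κ.prod κ)
    (fun q : ℕ => (measurableSet_dist_lt (X := X) (1 / ((q : ℝ) + 1))).nullMeasurableSet) hanti
    ⟨0, by simp⟩
  have e : ⋂ q : ℕ, {z : X × X | dist z.1 z.2 < 1 / ((q : ℝ) + 1)} = Set.diagonal X := by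
    ext ⟨u, v⟩
    simp only [Set.mem_iInter, Set.mem_ofPred_eq, Set.mem_diagonal_iff]
    constructor
    · intro hq
      by_contra hne
      obtain ⟨q, hq'⟩ := exists_nat_one_div_lt (dist_pos.2 hne)
      exact absurd (hq q) (not_lt.2 hq'.le)
    · rintro rfl q
      simp only [dist_self]
      positivity
  rw [e, h] at h1
  exact h1

/-- A system of positive entropy carries a measure whose late names are asymptotically independent
of the basic open sets, and whose images are often, along the times `s`, far from atomic. -/
theorem exists_good_measure {T : X ≃ᵐ X} (hT : MeasurePreserving T μ μ) {P : FinVar X}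
    (hP : 0 < rate hT P) {Q : ℕ → FinVar X}
    (hQ : ∀ j x y, (Q j).fn x = (Q j).fn y → dist x y < 1 / ((j : ℝ) + 1)) (s : ℕ → ℕ) :
    ∃ κ : Measure X, IsProbabilityMeasure κ ∧
      (∀ j, ∀ B ∈ TopologicalSpace.countableBasis X, AsympIndep T.measurable κ (Q j) B) ∧
      ∀ θ : ℝ, 0 < θ → ∃ r : ℝ, 0 < r ∧ ∃ c : ℝ, 0 < c ∧ ∃ᶠ N : ℕ in atTop,
        c * N ≤ ((Finset.Icc 1 N).filter fun k =>
          (κ.prod κ).real {z | dist (T^[s k] z.1) (T^[s k] z.2) < r} ≤ θ).card := by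
  set D := {y | ((fibre hT y).prod (fibre hT y)) (Set.diagonal X) = 0} with hD
  have hDpos : 0 < μ D := measure_diagonal_eq_zero_pos hT hP hQ
  set Y : ℕ → ℕ → Set X := fun n q => {y | ((fibre hT y).prod (fibre hT y))
    {z | dist z.1 z.2 < 1 / ((q : ℝ) + 1)} ≤ ENNReal.ofReal (1 / ((n : ℝ) + 1))} with hY
  have hYm : ∀ n q, MeasurableSet (Y n q) := fun n q =>
    measurableSet_le (measurable_fibre_prod_apply hT (measurableSet_dist_lt _)) measurable_const
  set L : ℕ → Set X := fun n => ⋃ q, {y | 0 < upperFreq T s (Y n q) y} with hL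
  have hLm : ∀ n, MeasurableSet (L n) := fun n => MeasurableSet.iUnion fun q =>
    measurableSet_lt measurable_const (measurable_upperFreq T.measurable s (hYm n q))
  have hLanti : Antitone L := by
    intro n n' hn
    refine Set.iUnion_mono fun q y hy => lt_of_lt_of_le hy (upperFreq_mono T s ?_ y)
    exact fun z hz => _root_.le_trans hz (ENNReal.ofReal_le_ofReal (Nat.one_div_le_one_div hn))
  have hLle : ∀ n, μ D ≤ μ (L n) := by
    intro n
    have hmono : Monotone (Y n) := by
      intro q q' hq y hy
      refine (measure_mono ?_).trans (show _ ≤ _ from hy)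
      intro z (hz : dist z.1 z.2 < _)
      exact hz.trans_le (Nat.one_div_le_one_div hq)
    have h1 : D ⊆ ⋃ q, Y n q := by
      intro y hy
      have h2 := tendsto_prod_dist_lt (κ := fibre hT y) hy
      have h3 : ∀ᶠ q : ℕ in atTop, ((fibre hT y).prod (fibre hT y))
          {z | dist z.1 z.2 < 1 / ((q : ℝ) + 1)} < ENNReal.ofReal (1 / ((n : ℝ) + 1)) :=
        h2.eventually_lt_const (by rw [ENNReal.ofReal_pos]; positivity)
      obtain ⟨q, hq⟩ := h3.exists
      exact Set.mem_iUnion.2 ⟨q, hq.le⟩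
    refine (measure_mono h1).trans ?_
    rw [hmono.measure_iUnion]
    refine iSup_le fun q => (measure_le_measure_upperFreq_pos hT s (hYm n q)).trans ?_
    exact measure_mono (Set.subset_iUnion (fun q => {y | 0 < upperFreq T s (Y n q) y}) q)
  have hLpos : 0 < μ (⋂ n, L n) := by
    have h1 := tendsto_measure_iInter_atTop (μ := μ) (fun n => (hLm n).nullMeasurableSet) hLanti
      ⟨0, by simp⟩
    exact hDpos.trans_le (ge_of_tendsto' h1 hLle)
  have hind : ∀ᵐ y ∂μ, ∀ j, ∀ B ∈ TopologicalSpace.countableBasis X,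
      AsympIndep T.measurable (fibre hT y) (Q j) B := by
    refine ae_all_iff.2 fun j => (ae_ball_iff (TopologicalSpace.countable_countableBasis X)).2
      fun B hB => ae_fibre_indep hT (Q j) ?_
    exact (TopologicalSpace.isOpen_of_mem_countableBasis hB).measurableSet
  have hfreq : ∃ᵐ y ∂μ, y ∈ ⋂ n, L n := by
    rw [frequently_ae_iff]
    exact hLpos.ne'
  obtain ⟨y, hyL, hy1, hy2⟩ := (hfreq.and_eventually (hind.and (ae_fibre_iterate_eq_map hT))).exists
  refine ⟨fibre hT y, inferInstance, hy1, fun θ hθ => ?_⟩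
  obtain ⟨n, hn⟩ := exists_nat_one_div_lt hθ
  obtain ⟨q, hq⟩ := Set.mem_iUnion.1 (Set.mem_iInter.1 hyL n)
  classical
  obtain ⟨c, hc, hfr⟩ := exists_frequently_card_of_upperFreq_pos hq
  refine ⟨1 / ((q : ℝ) + 1), by positivity, c, hc, hfr.mono fun N hN => hN.trans ?_⟩
  refine Nat.cast_le.2 (Finset.card_le_card fun k hk => ?_)
  rw [Finset.mem_filter] at hk ⊢
  refine ⟨hk.1, ?_⟩
  have h1 := hk.2
  simp only [hY, Set.mem_ofPred_eq] at h1
  rw [hy2, prod_map_apply (T.measurable.iterate _) (measurableSet_dist_lt _)] at h1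
  have h2 := ENNReal.toReal_mono (by simp) h1
  rw [ENNReal.toReal_ofReal (by positivity)] at h2
  exact h2.trans hn.le

end GoodFibre

end MeanLiYorke

namespace MeanLiYorke

open FinVar ProbabilityTheory

section Names

variable {X : Type*} [MeasurableSpace X]

lemma prod_real_rel (ν ν' : Measure X) [IsProbabilityMeasure ν] [IsProbabilityMeasure ν']
    (f : FinVar X) (R : f.R → f.R → Prop) [∀ u v, Decidable (R u v)] :
    (ν.prod ν').real {z | R (f.fn z.1) (f.fn z.2)} =
      ∑ u, ∑ v, if R u v then ν.real (f.fn ⁻¹' {u}) * ν'.real (f.fn ⁻¹' {v}) else 0 := by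
  set g : FinVar (X × X) := f.comp Prod.fst measurable_fst ⊔ f.comp Prod.snd measurable_snd
  have hS : MeasurableSet {z : X × X | R (f.fn z.1) (f.fn z.2)} :=
    g.meas_preimage {w | R w.1 w.2}
  rw [← sum_real_preimage (ν.prod ν') g _ hS]
  change ∑ w : f.R × f.R, _ = _
  rw [Fintype.sum_prod_type]
  refine Finset.sum_congr rfl fun u _ => Finset.sum_congr rfl fun v _ => ?_
  change (ν.prod ν').real ((fun z : X × X => (f.fn z.1, f.fn z.2)) ⁻¹' {(u, v)} ∩
    {z | R (f.fn z.1) (f.fn z.2)}) = _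
  have e : (fun z : X × X => (f.fn z.1, f.fn z.2)) ⁻¹' {(u, v)} = (f.fn ⁻¹' {u}) ×ˢ (f.fn ⁻¹' {v}) := by
    ext z
    simp [Prod.ext_iff]
  split_ifs with h
  · rw [Set.inter_eq_self_of_subset_left, e, measureReal_prod_prod]
    intro z hz
    rw [e] at hz
    have h1 : f.fn z.1 = u := hz.1
    have h2 : f.fn z.2 = v := hz.2
    change R (f.fn z.1) (f.fn z.2)
    rwa [h1, h2]
  · rw [measureReal_eq_zero_iff]
    convert measure_empty (μ := ν.prod ν')
    refine Set.eq_empty_of_forall_notMem fun z hz => h ?_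
    have hz1 := hz.1
    rw [e] at hz1
    have h1 : f.fn z.1 = u := hz1.1
    have h2 : f.fn z.2 = v := hz1.2
    have h3 : R (f.fn z.1) (f.fn z.2) := hz.2
    rwa [h1, h2] at h3

/-- Measures whose name distributions are close to those of `κ` have, up to a small error, the
same pair statistics. -/
lemma prod_real_rel_le (κ ν ν' : Measure X) [IsProbabilityMeasure κ] [IsProbabilityMeasure ν]
    [IsProbabilityMeasure ν'] (f : FinVar X) (R : f.R → f.R → Prop) {η : ℝ} (hη : 0 ≤ η)
    (hη1 : η ≤ 1) (h : ∀ u, ν.real (f.fn ⁻¹' {u}) ≤ κ.real (f.fn ⁻¹' {u}) + η)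
    (h' : ∀ u, ν'.real (f.fn ⁻¹' {u}) ≤ κ.real (f.fn ⁻¹' {u}) + η) :
    (ν.prod ν').real {z | R (f.fn z.1) (f.fn z.2)} ≤
      (κ.prod κ).real {z | R (f.fn z.1) (f.fn z.2)} + 3 * η * (Fintype.card f.R) ^ 2 := by
  classical
  rw [prod_real_rel, prod_real_rel]
  have : 3 * η * (Fintype.card f.R : ℝ) ^ 2 = ∑ _u : f.R, ∑ _v : f.R, 3 * η := by
    simp; ring
  rw [this, ← Finset.sum_add_distrib]
  refine Finset.sum_le_sum fun u _ => ?_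
  rw [← Finset.sum_add_distrib]
  refine Finset.sum_le_sum fun v _ => ?_
  split_ifs with hR
  · have a1 : κ.real (f.fn ⁻¹' {u}) ≤ 1 := measureReal_le_one
    have a2 : κ.real (f.fn ⁻¹' {v}) ≤ 1 := measureReal_le_one
    have b1 : 0 ≤ κ.real (f.fn ⁻¹' {u}) := measureReal_nonneg
    calc ν.real (f.fn ⁻¹' {u}) * ν'.real (f.fn ⁻¹' {v})
        ≤ (κ.real (f.fn ⁻¹' {u}) + η) * (κ.real (f.fn ⁻¹' {v}) + η) :=
          mul_le_mul (h u) (h' v) measureReal_nonneg (by positivity)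
      _ ≤ _ := by nlinarith
  · positivity

lemma AsympIndep.of_le {T : X → X} {hT : Measurable T} {κ : Measure X} {Q : FinVar X} {B : Set X}
    {η : ℝ} {a a' : ℕ} (haa : a ≤ a')
    (ha : ∀ (k : ℕ) (S : Set (word hT Q a k).R), |κ.real ((word hT Q a k).fn ⁻¹' S ∩ B) -
      κ.real ((word hT Q a k).fn ⁻¹' S) * κ.real B| ≤ η)
    (k : ℕ) (S : Set (word hT Q a' k).R) : |κ.real ((word hT Q a' k).fn ⁻¹' S ∩ B) -
      κ.real ((word hT Q a' k).fn ⁻¹' S) * κ.real B| ≤ η := by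
  have := ha (a' - a + k) {w | (fun i : Fin k => w ⟨a' - a + i, by omega⟩) ∈ S}
  have e : (word hT Q a (a' - a + k)).fn ⁻¹'
      {w | (fun i : Fin k => w ⟨a' - a + i, by omega⟩) ∈ S} = (word hT Q a' k).fn ⁻¹' S := by
    ext z
    change (fun i : Fin k => Q.fn (T^[a + (a' - a + i)] z)) ∈ S ↔
      (fun i : Fin k => Q.fn (T^[a' + i] z)) ∈ S
    have : ∀ i : ℕ, a + (a' - a + i) = a' + i := fun i => by omega
    simp only [this]
  rwa [e] at this

end Names

section Support

variable {X : Type*} [MeasurableSpace X] [MetricSpace X] [CompactSpace X]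

lemma exists_basic_subset {κ : Measure X} [IsProbabilityMeasure κ] {V : Set X} (hV : IsOpen V)
    (h : (V ∩ κ.support).Nonempty) :
    ∃ C ∈ TopologicalSpace.countableBasis X, C ⊆ V ∧ 0 < κ.real C := by
  obtain ⟨x, hxV, hx⟩ := h
  obtain ⟨C, hC, hxC, hCV⟩ :=
    (TopologicalSpace.isBasis_countableBasis X).exists_subset_of_mem_open hxV hV
  refine ⟨C, hC, hCV, ?_⟩
  have := (Measure.mem_support_iff_forall x).1 hx C
    ((TopologicalSpace.isOpen_of_mem_countableBasis hC).mem_nhds hxC)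
  exact ENNReal.toReal_pos this.ne' (by simp)

/-- Finitely many open sets meeting the support contain points of the support with close orbits
during an arbitrarily long time. -/
lemma exists_close_orbits {T : X → X} (hT : Measurable T) {κ : Measure X} [IsProbabilityMeasure κ]
    {Q : FinVar X} {ε : ℝ} (hQ : ∀ x y, Q.fn x = Q.fn y → dist x y < ε)
    (hind : ∀ B ∈ TopologicalSpace.countableBasis X, AsympIndep hT κ Q B) {n : ℕ}
    {V : Fin n → Set X} (hV : ∀ i, IsOpen (V i)) (hVE : ∀ i, (V i ∩ κ.support).Nonempty) :
    ∃ a, ∀ M, ∃ x : Fin n → X, (∀ i, x i ∈ V i ∩ κ.support) ∧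
      ∀ p, a ≤ p → p < M → ∀ i j, dist (T^[p] (x i)) (T^[p] (x j)) < ε := by
  classical
  choose C hCb hCV hCpos using fun i => exists_basic_subset (hV i) (hVE i)
  obtain ⟨δ, hδ0, hδ⟩ : ∃ δ : ℝ, 0 < δ ∧ ∀ i, δ ≤ κ.real (C i) := by
    rcases isEmpty_or_nonempty (Fin n) with he | he
    · exact ⟨1, one_pos, fun i => he.elim i⟩
    · obtain ⟨i, hi⟩ := Finite.exists_min fun i => κ.real (C i)
      exact ⟨_, hCpos i, hi⟩
  set η := δ / (n + 1) with hη
  have hη0 : 0 < η := by positivity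
  choose a ha using fun i => hind (C i) (hCb i) η hη0
  set b := Finset.univ.sup a with hb
  have hab : ∀ i, a i ≤ b := fun i => Finset.le_sup (Finset.mem_univ i)
  refine ⟨b, fun M => ?_⟩
  set W := word hT Q b M with hW
  obtain ⟨w, hw⟩ : ∃ w : W.R, ∀ i, κ.real (W.fn ⁻¹' {w} ∩ C i) ≠ 0 := by
    by_contra hn
    push Not at hn
    choose ι hι using hn
    have h1 : ∀ i, κ.real (W.fn ⁻¹' (ι ⁻¹' {i}) ∩ C i) = 0 := by
      intro i
      have hnull : κ (⋃ w ∈ ι ⁻¹' {i}, W.fn ⁻¹' {w} ∩ C i) = 0 := by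
        refine (measure_biUnion_null_iff (Set.to_countable _)).2 fun w hw => ?_
        have h3 := hι w
        rw [show ι w = i from hw, measureReal_eq_zero_iff] at h3
        exact h3
      rw [measureReal_eq_zero_iff]
      refine measure_mono_null (fun z hz => ?_) hnull
      exact Set.mem_biUnion hz.1 ⟨rfl, hz.2⟩
    have h2 : ∀ i, κ.real (W.fn ⁻¹' (ι ⁻¹' {i})) ≤ 1 / (n + 1) := by
      intro i
      have h3 := AsympIndep.of_le (hab i) (ha i) M (ι ⁻¹' {i})
      rw [h1, zero_sub, abs_neg] at h3
      have h4 := (le_abs_self _).trans h3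
      have h5 : κ.real (W.fn ⁻¹' (ι ⁻¹' {i})) * δ ≤ 1 / (n + 1) * δ :=
        (mul_le_mul_of_nonneg_left (hδ i) measureReal_nonneg).trans
          (h4.trans (by rw [hη]; ring_nf; rfl))
      exact le_of_mul_le_mul_right h5 hδ0
    have h3 : (1 : ℝ) ≤ ∑ i : Fin n, κ.real (W.fn ⁻¹' (ι ⁻¹' {i})) := by
      have h4 : (Set.univ : Set X) ⊆ ⋃ i ∈ (Finset.univ : Finset (Fin n)), W.fn ⁻¹' (ι ⁻¹' {i}) := by
        intro z _
        simp
      calc (1 : ℝ) = κ.real Set.univ := by simp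
        _ ≤ κ.real (⋃ i ∈ (Finset.univ : Finset (Fin n)), W.fn ⁻¹' (ι ⁻¹' {i})) :=
          measureReal_mono h4 (measure_ne_top _ _)
        _ ≤ _ := measureReal_biUnion_finset_le _ _
    have h4 : ∑ i : Fin n, κ.real (W.fn ⁻¹' (ι ⁻¹' {i})) ≤ n * (1 / (n + 1)) := by
      refine (Finset.sum_le_sum fun i _ => h2 i).trans ?_
      simp
    have h5 : (n : ℝ) * (1 / (n + 1)) < 1 := by
      rw [mul_one_div, div_lt_one (by positivity)]
      linarith
    linarith
  have hx : ∀ i, ∃ x, x ∈ (W.fn ⁻¹' {w} ∩ C i) ∩ κ.support := fun i => by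
    refine Measure.nonempty_inter_support_of_pos ?_
    rw [pos_iff_ne_zero]
    intro e
    exact hw i (by rw [measureReal_def, e]; rfl)
  choose x hx using hx
  refine ⟨x, fun i => ⟨hCV i (hx i).1.2, (hx i).2⟩, fun p hp hpM i j => hQ _ _ ?_⟩
  have e : W.fn (x i) = W.fn (x j) := ((hx i).1.1 : W.fn (x i) = w).trans
    ((hx j).1.1 : W.fn (x j) = w).symm
  rw [hW, word_fn_eq] at e
  have := e (p - b) (by omega)
  rwa [show b + (p - b) = p by omega] at this

end Support

end MeanLiYorke

namespace MeanLiYorke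

open FinVar ProbabilityTheory

lemma card_filter_lt_le {s : ℕ → ℕ} (hs : ∀ k, k ≤ s k + 1) (N a : ℕ) :
    ((Finset.Icc 1 N).filter fun k => s k < a).card ≤ a := by
  have : ((Finset.Icc 1 N).filter fun k => s k < a) ⊆ Finset.Icc 1 a := by
    intro k hk
    rw [Finset.mem_filter, Finset.mem_Icc] at hk
    have := hs k
    rw [Finset.mem_Icc]
    omega
  simpa using Finset.card_le_card this

lemma map_pi_pair {X : Type*} [MeasurableSpace X] {n : ℕ} (ν : Fin n → Measure X)
    [∀ i, IsProbabilityMeasure (ν i)] {i j : Fin n} (hij : i ≠ j) :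
    (Measure.pi ν).map (fun x => (x i, x j)) = (ν i).prod (ν j) := by
  have h := (iIndepFun_pi (μ := ν) (X := fun _ x => x) fun i => aemeasurable_id).indepFun hij
  rw [indepFun_iff_map_prod_eq_prod_map_map
    (measurable_pi_apply i).aemeasurable (measurable_pi_apply j).aemeasurable] at h
  rw [h]
  have e : ∀ k, (Measure.pi ν).map (fun x => x k) = ν k := fun k =>
    (measurePreserving_eval ν k).map_eq
  rw [e, e]

/-- If finitely many events with indices in `G` all have probability at most `1 / 2`, then some
point outside a given null set avoids at least half of them. -/
lemma exists_avoid_half {Ω : Type*} [MeasurableSpace Ω] {π : Measure Ω} [IsProbabilityMeasure π]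
    {Z : Set Ω} (hZ : π Z = 0) (G : Finset ℕ) (A : ℕ → Set Ω) (hA : ∀ k, MeasurableSet (A k))
    (h : ∀ k ∈ G, π.real (A k) ≤ 1 / 2) [∀ x, DecidablePred fun k => x ∉ A k] :
    ∃ x ∉ Z, (G.card : ℝ) / 2 ≤ (G.filter fun k => x ∉ A k).card := by
  classical
  have hi : ∀ k, Integrable ((A k).indicator fun _ => (1 : ℝ)) π :=
    fun k => integrable_indicator_one (hA k)
  obtain ⟨x, hxZ, hx⟩ := exists_notMem_null_le_integral
    (f := fun x => ∑ k ∈ G, (A k).indicator (fun _ => (1 : ℝ)) x)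
    (integrable_finsetSum _ fun k _ => hi k) hZ
  refine ⟨x, hxZ, ?_⟩
  rw [integral_finsetSum _ fun k _ => hi k] at hx
  have h1 : ∑ k ∈ G, ∫ a, (A k).indicator (fun _ => (1 : ℝ)) a ∂π ≤ G.card / 2 := by
    calc ∑ k ∈ G, ∫ a, (A k).indicator (fun _ => (1 : ℝ)) a ∂π ≤ ∑ k ∈ G, (1 / 2 : ℝ) := by
          refine Finset.sum_le_sum fun k hk => ?_
          rw [integral_indicator_const _ (hA k)]
          simpa using h k hk
      _ = _ := by simp; ring
  have h2 : ∑ k ∈ G, (A k).indicator (fun _ => (1 : ℝ)) x = (G.filter fun k => x ∈ A k).card := by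
    rw [Finset.card_filter]
    push_cast
    exact Finset.sum_congr rfl fun k _ => by simp [Set.indicator_apply]
  have h3 := Finset.card_filter_add_card_filter_not (s := G) (fun k => x ∈ A k)
  have h4 : ((G.filter fun k => x ∈ A k).card : ℝ) + (G.filter fun k => x ∉ A k).card = G.card := by
    exact_mod_cast h3
  linarith

variable {X : Type*} [MeasurableSpace X] [MetricSpace X] [CompactSpace X] [BorelSpace X]

/-- Finitely many open sets meeting the support contain points of the support whose orbits are
separated for a fixed proportion of the times up to some large time. -/
lemma exists_separated_orbits {T : X → X} (hT : Measurable T) {κ : Measure X}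
    [IsProbabilityMeasure κ] {Q : ℕ → FinVar X}
    (hQ : ∀ j x y, (Q j).fn x = (Q j).fn y → dist x y < 1 / ((j : ℝ) + 1))
    (hind : ∀ j, ∀ B ∈ TopologicalSpace.countableBasis X, AsympIndep hT κ (Q j) B) {s : ℕ → ℕ}
    (hs : ∀ k, k ≤ s k + 1)
    (hfr : ∀ θ : ℝ, 0 < θ → ∃ r : ℝ, 0 < r ∧ ∃ c : ℝ, 0 < c ∧ ∃ᶠ N : ℕ in atTop,
      c * N ≤ ((Finset.Icc 1 N).filter fun k =>
        (κ.prod κ).real {z | dist (T^[s k] z.1) (T^[s k] z.2) < r} ≤ θ).card) (n : ℕ) :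
    ∃ r : ℝ, 0 < r ∧ ∃ c : ℝ, 0 < c ∧ ∀ V : Fin n → Set X, (∀ i, IsOpen (V i)) →
      (∀ i, (V i ∩ κ.support).Nonempty) → ∀ q : ℕ, ∃ N ≥ q, ∃ x : Fin n → X,
        (∀ i, x i ∈ V i ∩ κ.support) ∧ c * N ≤ ((Finset.Icc 1 N).filter fun k =>
          ∀ i j, i < j → r ≤ dist (T^[s k] (x i)) (T^[s k] (x j))).card := by
  classical
  set θ : ℝ := 1 / (4 * (n + 1) ^ 2) with hθ
  have hθ0 : 0 < θ := by positivity
  obtain ⟨r, hr, c, hc, hfreq⟩ := hfr θ hθ0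
  refine ⟨r / 2, by positivity, c / 4, by positivity, fun V hV hVE q => ?_⟩
  choose C hCb hCV hCpos using fun i => exists_basic_subset (hV i) (hVE i)
  have hCm : ∀ i, MeasurableSet (C i) := fun i =>
    (TopologicalSpace.isOpen_of_mem_countableBasis (hCb i)).measurableSet
  obtain ⟨j, hj⟩ := exists_nat_one_div_lt (show 0 < r / 4 by positivity)
  set F := Q j with hF
  have hFd : ∀ x y, F.fn x = F.fn y → dist x y < r / 4 := fun x y e => (hQ j x y e).trans hj
  set R : F.R → F.R → Prop := fun u v => ∃ z z', F.fn z = u ∧ F.fn z' = v ∧ dist z z' < r / 2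
    with hR
  have hR1 : ∀ z z', R (F.fn z) (F.fn z') → dist z z' < r := by
    rintro z z' ⟨y, y', e, e', hd⟩
    have h1 := hFd _ _ e
    have h2 := hFd _ _ e'
    have h3 := dist_triangle4 z y y' z'
    rw [dist_comm z y] at h3
    linarith
  set m : ℝ := (Fintype.card F.R : ℝ) with hm
  set η : ℝ := θ / (3 * m ^ 2 + 1 + θ) with hη
  have hm0 : 0 ≤ m := Nat.cast_nonneg _
  have hη0 : 0 < η := by positivity
  have hη1 : η ≤ 1 := by
    rw [hη, div_le_one (by positivity)]
    nlinarith
  have hηθ : 3 * η * m ^ 2 ≤ θ := by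
    rw [hη, mul_comm 3, mul_assoc, div_mul_eq_mul_div, div_le_iff₀ (by positivity)]
    exact mul_le_mul_of_nonneg_left (by linarith) hθ0.le
  choose a ha using fun i => (hind j (C i) (hCb i)).exists_iterate (mul_pos hη0 (hCpos i))
  set b := Finset.univ.sup a with hb
  have hab : ∀ i, a i ≤ b := fun i => Finset.le_sup (Finset.mem_univ i)
  set ν : Fin n → Measure X := fun i => κ[|C i] with hν
  have hνp : ∀ i, IsProbabilityMeasure (ν i) := fun i =>
    cond_isProbabilityMeasure fun e => (hCpos i).ne' (by rw [measureReal_def, e]; rfl)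
  have hνle : ∀ i, ∀ p ≥ b, ∀ u, (ν i).real ((F.comp T^[p] (hT.iterate p)).fn ⁻¹' {u}) ≤
      κ.real ((F.comp T^[p] (hT.iterate p)).fn ⁻¹' {u}) + η := by
    intro i p hp u
    have h1 := ha i p ((hab i).trans hp) {u}
    change |κ.real ((F.comp T^[p] (hT.iterate p)).fn ⁻¹' {u} ∩ C i) -
      κ.real ((F.comp T^[p] (hT.iterate p)).fn ⁻¹' {u}) * κ.real (C i)| ≤ _ at h1
    have h2 := (le_abs_self _).trans h1
    rw [hν, measureReal_def, cond_apply (hCm i), ENNReal.toReal_mul, ENNReal.toReal_inv,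
      ← measureReal_def, ← measureReal_def, Set.inter_comm, inv_mul_eq_div, div_le_iff₀ (hCpos i)]
    linarith
  set bad : ℕ → Set (X × X) := fun p => {z | R (F.fn (T^[p] z.1)) (F.fn (T^[p] z.2))} with hbad
  have hbadm : ∀ p, MeasurableSet (bad p) := by
    intro p
    exact (F.comp (fun z : X × X => T^[p] z.1) ((hT.iterate p).comp measurable_fst) ⊔
      F.comp (fun z : X × X => T^[p] z.2) ((hT.iterate p).comp measurable_snd)).meas_preimage
      {w | R w.1 w.2}
  set π := Measure.pi ν with hπ
  set A : ℕ → Set (Fin n → X) := fun p => ⋃ i, ⋃ i', ⋃ (_ : i < i'), {x | (x i, x i') ∈ bad p}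
    with hA
  have hAm : ∀ p, MeasurableSet (A p) := fun p => MeasurableSet.iUnion fun i =>
    MeasurableSet.iUnion fun i' => MeasurableSet.iUnion fun _ =>
      ((measurable_pi_apply i).prodMk (measurable_pi_apply i')) (hbadm p)
  have hpair : ∀ p ≥ b, (κ.prod κ).real {z | dist (T^[p] z.1) (T^[p] z.2) < r} ≤ θ →
      ∀ i i', i < i' → π.real {x | (x i, x i') ∈ bad p} ≤ 2 * θ := by
    intro p hp hgood i i' hii
    have h1 : π.real {x | (x i, x i') ∈ bad p} = ((ν i).prod (ν i')).real (bad p) := by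
      rw [← map_pi_pair ν hii.ne, map_measureReal_apply (by fun_prop) (hbadm p)]
      rfl
    rw [h1]
    have h2 := prod_real_rel_le κ (ν i) (ν i') (F.comp T^[p] (hT.iterate p)) R hη0.le hη1
      (hνle i p hp) (hνle i' p hp)
    refine h2.trans ?_
    have h3 : (κ.prod κ).real (bad p) ≤ θ := by
      refine (measureReal_mono ?_ (measure_ne_top _ _)).trans hgood
      exact fun z hz => hR1 _ _ hz
    change (κ.prod κ).real (bad p) + 3 * η * m ^ 2 ≤ _
    linarith
  have hAle : ∀ p ≥ b, (κ.prod κ).real {z | dist (T^[p] z.1) (T^[p] z.2) < r} ≤ θ →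
      π.real (A p) ≤ 1 / 2 := by
    intro p hp hgood
    have h1 : ∀ i i', π.real (⋃ (_ : i < i'), {x | (x i, x i') ∈ bad p}) ≤ 2 * θ := by
      intro i i'
      by_cases hii : i < i'
      · simpa [hii] using hpair p hp hgood i i' hii
      · simp only [hii, Set.iUnion_of_empty, measureReal_empty]
        positivity
    calc π.real (A p) ≤ ∑ i, π.real (⋃ i', ⋃ (_ : i < i'), {x | (x i, x i') ∈ bad p}) :=
          measureReal_iUnion_fintype_le _
      _ ≤ ∑ i, ∑ i', π.real (⋃ (_ : i < i'), {x | (x i, x i') ∈ bad p}) :=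
          Finset.sum_le_sum fun i _ => measureReal_iUnion_fintype_le _
      _ ≤ ∑ _i : Fin n, ∑ _i' : Fin n, 2 * θ :=
          Finset.sum_le_sum fun i _ => Finset.sum_le_sum fun i' _ => h1 i i'
      _ = n ^ 2 / (n + 1) ^ 2 * (1 / 2) := by
          simp only [Finset.sum_const, Finset.card_univ, Fintype.card_fin, nsmul_eq_mul, hθ]
          field_simp
          ring
      _ ≤ 1 / 2 := by
          have : (n : ℝ) ^ 2 / (n + 1) ^ 2 ≤ 1 := by
            rw [div_le_one (by positivity)]
            gcongr
            linarith
          linarith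
  obtain ⟨N, hN, hNq⟩ := (hfreq.and_eventually ((eventually_ge_atTop q).and
    (eventually_ge_atTop ⌈2 * b / c⌉₊))).exists
  refine ⟨N, hNq.1, ?_⟩
  have hNb : (2 : ℝ) * b ≤ c * N := by
    have := (Nat.le_ceil _).trans (Nat.cast_le (α := ℝ).2 hNq.2)
    rwa [div_le_iff₀ hc, mul_comm (N : ℝ)] at this
  set G₀ := (Finset.Icc 1 N).filter fun k =>
    (κ.prod κ).real {z | dist (T^[s k] z.1) (T^[s k] z.2) < r} ≤ θ with hG₀
  set G := G₀.filter fun k => b ≤ s k with hG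
  have hGcard : (G₀.card : ℝ) ≤ G.card + b := by
    have h1 := Finset.card_filter_add_card_filter_not (s := G₀) (fun k => b ≤ s k)
    have h2 : (G₀.filter fun k => ¬ b ≤ s k).card ≤ b := by
      refine (Finset.card_le_card ?_).trans (card_filter_lt_le hs N b)
      intro k hk
      simp only [hG₀, Finset.mem_filter, not_le] at hk ⊢
      exact ⟨hk.1.1, hk.2⟩
    have : G₀.card ≤ G.card + b := by
      rw [← h1]
      exact Nat.add_le_add_left h2 _
    exact_mod_cast this
  have hnull : π {x | ¬ ∀ i, x i ∈ C i ∩ κ.support} = 0 := by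
    have h1 : ∀ i, ∀ᵐ x ∂π, x i ∈ C i ∩ κ.support := by
      intro i
      have h2 : ∀ᵐ y ∂(ν i), y ∈ C i ∩ κ.support := by
        have h3 : ∀ᵐ y ∂(ν i), y ∈ C i := ae_cond_mem (hCm i)
        have h4 : ∀ᵐ y ∂(ν i), y ∈ κ.support :=
          (cond_absolutelyContinuous (μ := κ) (s := C i)).ae_le Measure.support_mem_ae
        filter_upwards [h3, h4] with y a b using ⟨a, b⟩
      exact (measurePreserving_eval ν i).quasiMeasurePreserving.ae h2
    exact ae_iff.1 (ae_all_iff.2 h1)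
  obtain ⟨x, hxZ, hx⟩ := exists_avoid_half hnull G (fun k => A (s k)) (fun k => hAm _) (by
    intro k hk
    simp only [hG, hG₀, Finset.mem_filter] at hk
    exact hAle _ hk.2 hk.1.2)
  have hxC : ∀ i, x i ∈ C i ∩ κ.support := not_not.1 hxZ
  refine ⟨x, fun i => ⟨hCV i (hxC i).1, (hxC i).2⟩, ?_⟩
  have hsub : (G.filter fun k => x ∉ A (s k)) ⊆ (Finset.Icc 1 N).filter fun k =>
      ∀ i j, i < j → r / 2 ≤ dist (T^[s k] (x i)) (T^[s k] (x j)) := by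
    intro k hk
    simp only [hG, hG₀, Finset.mem_filter] at hk
    rw [Finset.mem_filter]
    refine ⟨hk.1.1.1, fun i i' hii => ?_⟩
    by_contra hlt
    apply hk.2
    simp only [hA, Set.mem_iUnion]
    exact ⟨i, i', hii, _, _, rfl, rfl, not_le.1 hlt⟩
  have hcard := Nat.cast_le (α := ℝ).2 (Finset.card_le_card hsub)
  refine le_trans ?_ hcard
  refine le_trans ?_ hx
  linarith

end MeanLiYorke

namespace MeanLiYorke

section Mycielski

variable {X : Type*} [MetricSpace X] {E : Set X}

/-- Open sets meeting `E` can be shrunk so that the product over an injective choice of them lies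
in a given relatively dense open relation. -/
lemma exists_shrink_of_dense {J : Type*} {n : ℕ} {O : Set (Fin n → X)} (hO : IsOpen O)
    (hd : ∀ V : Fin n → Set X, (∀ i, IsOpen (V i)) → (∀ i, (V i ∩ E).Nonempty) →
      ∃ x ∈ O, ∀ i, x i ∈ V i ∩ E)
    {σ : Fin n → J} (hσ : Function.Injective σ) {V : J → Set X}
    (hV : ∀ j, IsOpen (V j) ∧ (V j ∩ E).Nonempty) :
    ∃ W : J → Set X, (∀ j, IsOpen (W j) ∧ (W j ∩ E).Nonempty) ∧ (∀ j, W j ⊆ V j) ∧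
      ∀ x : Fin n → X, (∀ i, x i ∈ W (σ i)) → x ∈ O := by
  classical
  obtain ⟨x, hxO, hx⟩ := hd (fun i => V (σ i)) (fun i => (hV _).1) fun i => (hV _).2
  obtain ⟨B, hB, hBO⟩ := isOpen_pi_iff'.1 hO x hxO
  refine ⟨fun j => V j ∩ ⋂ i, if σ i = j then B i else Set.univ, fun j => ⟨?_, ?_⟩,
    fun j => Set.inter_subset_left, fun y hy => hBO fun i _ => ?_⟩
  · refine (hV j).1.inter (isOpen_iInter_of_finite fun i => ?_)
    split_ifs
    exacts [(hB i).1, isOpen_univ]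
  · by_cases hj : ∃ i, σ i = j
    · obtain ⟨i, rfl⟩ := hj
      refine ⟨x i, ⟨(hx i).1, Set.mem_iInter.2 fun k => ?_⟩, (hx i).2⟩
      split_ifs with h
      · rw [hσ h]
        exact (hB i).2
      · trivial
    · obtain ⟨y, hyV, hyE⟩ := (hV j).2
      refine ⟨y, ⟨hyV, Set.mem_iInter.2 fun k => ?_⟩, hyE⟩
      rw [if_neg fun h => hj ⟨k, h⟩]
      trivial
  · have := Set.mem_iInter.1 (hy i).2 i
    rwa [if_pos rfl] at this

variable {n : ℕ → ℕ} {O : ∀ l, Set (Fin (n l) → X)}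

lemma exists_shrink_of_dense_finset (hO : ∀ l, IsOpen (O l))
    (hd : ∀ l, ∀ V : Fin (n l) → Set X, (∀ i, IsOpen (V i)) → (∀ i, (V i ∩ E).Nonempty) →
      ∃ x ∈ O l, ∀ i, x i ∈ V i ∩ E)
    {J : Type*} (S : Finset (Σ l, Fin (n l) → J)) {V : J → Set X}
    (hV : ∀ j, IsOpen (V j) ∧ (V j ∩ E).Nonempty) :
    ∃ W : J → Set X, (∀ j, IsOpen (W j) ∧ (W j ∩ E).Nonempty) ∧ (∀ j, W j ⊆ V j) ∧
      ∀ τ ∈ S, Function.Injective τ.2 →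
        ∀ x : Fin (n τ.1) → X, (∀ i, x i ∈ W (τ.2 i)) → x ∈ O τ.1 := by
  classical
  induction S using Finset.induction_on with
  | empty => exact ⟨V, hV, fun _ => le_rfl, by simp⟩
  | insert τ S _ ih =>
    obtain ⟨W, hW, hWV, hWO⟩ := ih
    by_cases hτ : Function.Injective τ.2
    · obtain ⟨W', hW', hWW, hWO'⟩ := exists_shrink_of_dense (hO τ.1) (hd τ.1) hτ hW
      refine ⟨W', hW', fun j => (hWW j).trans (hWV j), fun τ' hτ' hinj x hx => ?_⟩
      rcases Finset.mem_insert.1 hτ' with rfl | h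
      · exact hWO' x hx
      · exact hWO τ' h hinj x fun i => hWW _ (hx i)
    · refine ⟨W, hW, hWV, fun τ' hτ' hinj x hx => ?_⟩
      rcases Finset.mem_insert.1 hτ' with rfl | h
      · exact absurd hinj hτ
      · exact hWO τ' h hinj x hx

lemma exists_shrink_closure {J : Type*} {V : J → Set X}
    (hV : ∀ j, IsOpen (V j) ∧ (V j ∩ E).Nonempty) {ε : ℝ} (hε : 0 < ε) :
    ∃ W : J → Set X, (∀ j, IsOpen (W j) ∧ (W j ∩ E).Nonempty) ∧ (∀ j, closure (W j) ⊆ V j) ∧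
      ∀ j, ∀ x ∈ W j, ∀ y ∈ W j, dist x y < ε := by
  have h : ∀ j, ∃ W : Set X, (IsOpen W ∧ (W ∩ E).Nonempty) ∧ closure W ⊆ V j ∧
      ∀ x ∈ W, ∀ y ∈ W, dist x y < ε := by
    intro j
    obtain ⟨e, heV, heE⟩ := (hV j).2
    obtain ⟨δ, hδ, hball⟩ := Metric.nhds_basis_closedBall.mem_iff.1 ((hV j).1.mem_nhds heV)
    refine ⟨Metric.ball e (min δ (ε / 2)), ⟨Metric.isOpen_ball, e, Metric.mem_ball_self
      (by positivity), heE⟩, ?_, fun x hx y hy => ?_⟩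
    · exact Metric.closure_ball_subset_closedBall.trans
        ((Metric.closedBall_subset_closedBall (min_le_left _ _)).trans hball)
    · have h1 := (Metric.mem_ball.1 hx).trans_le (min_le_right _ _)
      have h2 := (Metric.mem_ball.1 hy).trans_le (min_le_right _ _)
      have h3 := dist_triangle_right x y e
      linarith
  choose W h1 h2 h3 using h
  exact ⟨W, h1, h2, h3⟩

lemma exists_split (hperf : ∀ V, IsOpen V → (V ∩ E).Nonempty → ∃ x ∈ V ∩ E, ∃ y ∈ V ∩ E, x ≠ y)
    {J : Type*} {V : J → Set X} (hV : ∀ j, IsOpen (V j) ∧ (V j ∩ E).Nonempty) :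
    ∃ W : J → Bool → Set X, (∀ j b, IsOpen (W j b) ∧ (W j b ∩ E).Nonempty) ∧
      (∀ j b, W j b ⊆ V j) ∧ ∀ j, Disjoint (W j true) (W j false) := by
  have h : ∀ j, ∃ W : Bool → Set X, (∀ b, IsOpen (W b) ∧ (W b ∩ E).Nonempty) ∧
      (∀ b, W b ⊆ V j) ∧ Disjoint (W true) (W false) := by
    intro j
    obtain ⟨x, hx, y, hy, hxy⟩ := hperf _ (hV j).1 (hV j).2
    obtain ⟨A, B, hA, hB, hxA, hyB, hAB⟩ := t2_separation hxy
    refine ⟨fun b => V j ∩ bif b then A else B, ?_, fun b => Set.inter_subset_left, ?_⟩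
    · rintro (_ | _)
      · exact ⟨(hV j).1.inter hB, y, ⟨hy.1, hyB⟩, hy.2⟩
      · exact ⟨(hV j).1.inter hA, x, ⟨hx.1, hxA⟩, hx.2⟩
    · exact hAB.mono Set.inter_subset_right Set.inter_subset_right
  choose W h1 h2 h3 using h
  exact ⟨W, h1, h2, h3⟩

lemma exists_next_level (hO : ∀ l, IsOpen (O l))
    (hd : ∀ l, ∀ V : Fin (n l) → Set X, (∀ i, IsOpen (V i)) → (∀ i, (V i ∩ E).Nonempty) →
      ∃ x ∈ O l, ∀ i, x i ∈ V i ∩ E)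
    (hperf : ∀ V, IsOpen V → (V ∩ E).Nonempty → ∃ x ∈ V ∩ E, ∃ y ∈ V ∩ E, x ≠ y) (m : ℕ)
    {V : (Fin m → Bool) → Set X} (hV : ∀ j, IsOpen (V j) ∧ (V j ∩ E).Nonempty) :
    ∃ W : (Fin (m + 1) → Bool) → Set X, (∀ j, IsOpen (W j) ∧ (W j ∩ E).Nonempty) ∧
      (∀ j, closure (W j) ⊆ V (Fin.init j)) ∧
      (∀ j k, Fin.init j = Fin.init k → j ≠ k → Disjoint (W j) (W k)) ∧
      (∀ j, ∀ x ∈ W j, ∀ y ∈ W j, dist x y < 1 / ((m : ℝ) + 1)) ∧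
      ∀ l ≤ m, ∀ σ : Fin (n l) → Fin (m + 1) → Bool, Function.Injective σ →
        ∀ x : Fin (n l) → X, (∀ i, x i ∈ W (σ i)) → x ∈ O l := by
  classical
  obtain ⟨V₁, hV₁, hV₁V, hdis⟩ := exists_split hperf hV
  obtain ⟨V₂, hV₂, hcl, hdiam⟩ := exists_shrink_closure (ε := 1 / ((m : ℝ) + 1))
    (V := fun j : Fin (m + 1) → Bool => V₁ (Fin.init j) (j (Fin.last m))) (fun j => hV₁ _ _)
    (by positivity)
  obtain ⟨W, hW, hWV, hWO⟩ := exists_shrink_of_dense_finset hO hd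
    ((Finset.range (m + 1)).sigma fun l => (Finset.univ : Finset (Fin (n l) → Fin (m + 1) → Bool)))
    hV₂
  have hWV₁ : ∀ j, closure (W j) ⊆ V₁ (Fin.init j) (j (Fin.last m)) := fun j =>
    (closure_mono (hWV j)).trans (hcl j)
  refine ⟨W, hW, fun j => (hWV₁ j).trans (hV₁V _ _), fun j k hjk hne => ?_,
    fun j x hx y hy => hdiam j x (hWV j hx) y (hWV j hy), fun l hl σ hσ x hx => ?_⟩
  · have h1 := subset_closure.trans (hWV₁ j)
    have h2 := subset_closure.trans (hWV₁ k)
    rw [hjk] at h1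
    have hlast : j (Fin.last m) ≠ k (Fin.last m) := by
      intro e
      apply hne
      rw [← Fin.snoc_init_self j, ← Fin.snoc_init_self k, hjk, e]
    have h3 : Disjoint (V₁ (Fin.init k) (j (Fin.last m))) (V₁ (Fin.init k) (k (Fin.last m))) := by
      cases hb : j (Fin.last m) <;> cases hb' : k (Fin.last m) <;> simp_all
      exact (hdis _).symm
    exact h3.mono h1 h2
  · exact hWO ⟨l, σ⟩ (by simp; omega) hσ x hx

/-- A form of Mycielski's theorem: countably many open relations which are dense along a set
without isolated points admit a common independent Cantor set. -/
theorem exists_independent_cantor [CompactSpace X] (hE : E.Nonempty) (hO : ∀ l, IsOpen (O l))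
    (hd : ∀ l, ∀ V : Fin (n l) → Set X, (∀ i, IsOpen (V i)) → (∀ i, (V i ∩ E).Nonempty) →
      ∃ x ∈ O l, ∀ i, x i ∈ V i ∩ E)
    (hperf : ∀ V, IsOpen V → (V ∩ E).Nonempty → ∃ x ∈ V ∩ E, ∃ y ∈ V ∩ E, x ≠ y) :
    ∃ K : Set X, (K.Nonempty ∧ IsCompact K ∧ Perfect K ∧ IsTotallyDisconnected K) ∧
      ∀ l, ∀ x : Fin (n l) → X, (∀ i, x i ∈ K) → Function.Injective x → x ∈ O l := by
  choose! next hnext using fun (m : ℕ) (V : (Fin m → Bool) → Set X)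
    (hV : ∀ j, IsOpen (V j) ∧ (V j ∩ E).Nonempty) => exists_next_level hO hd hperf m hV
  set U : ∀ m, (Fin m → Bool) → Set X := fun m =>
    Nat.rec (motive := fun m => (Fin m → Bool) → Set X) (fun _ => Set.univ) next m with hU
  have hUs : ∀ m, U (m + 1) = next m (U m) := fun m => rfl
  have hUV : ∀ m, ∀ j, IsOpen (U m j) ∧ (U m j ∩ E).Nonempty := by
    intro m
    induction m with
    | zero => exact fun j => ⟨isOpen_univ, by simpa [hU] using hE⟩
    | succ m ih =>
      rw [hUs]
      exact (hnext m _ ih).1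
  have hUn := fun m => hnext m (U m) (hUV m)
  simp only [← hUs] at hUn
  set res : (ℕ → Bool) → ∀ m, Fin m → Bool := fun α m i => α i with hres
  have hinit : ∀ α m, Fin.init (res α (m + 1)) = res α m := fun α m => rfl
  have hcl : ∀ α m, closure (U (m + 1) (res α (m + 1))) ⊆ U m (res α m) := fun α m =>
    (hUn m).2.1 (res α (m + 1))
  have hpt : ∀ α, ∃ x, ∀ m, x ∈ U m (res α m) := by
    intro α
    obtain ⟨x, hx⟩ := IsCompact.nonempty_iInter_of_sequence_nonempty_isCompact_isClosed
      (fun m => closure (U m (res α m)))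
      (fun m => (hcl α m).trans subset_closure)
      (fun m => (hUV m _).2.mono (Set.inter_subset_left.trans subset_closure))
      isClosed_closure.isCompact (fun m => isClosed_closure)
    exact ⟨x, fun m => hcl α m (Set.mem_iInter.1 hx (m + 1))⟩
  choose f hf using hpt
  have hresne : ∀ {α β : ℕ → Bool} {k m : ℕ}, α k ≠ β k → k < m → res α m ≠ res β m :=
    fun hk hm e => hk (congrFun e ⟨_, hm⟩)
  have hinj : Function.Injective f := by
    intro α β hαβ
    by_contra hne
    have hex : ∃ m, res α m ≠ res β m := by
      obtain ⟨k, hk⟩ := Function.ne_iff.1 hne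
      exact ⟨k + 1, hresne hk k.lt_succ_self⟩
    classical
    have hmin := Nat.find_spec hex
    have hlt := fun k => Nat.find_min hex (m := k)
    cases hm : Nat.find hex with
    | zero =>
      rw [hm] at hmin
      exact hmin (funext fun i => i.elim0)
    | succ m =>
      rw [hm] at hmin
      have h1 : res α m = res β m := not_not.1 (hlt m (by omega))
      exact Set.disjoint_left.1 ((hUn m).2.2.1 _ _ (by rw [hinit, hinit, h1]) hmin)
        (hf α (m + 1)) (hαβ ▸ hf β (m + 1))
  have hcont : Continuous f := by
    rw [continuous_iff_continuousAt]
    intro α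
    rw [ContinuousAt, Metric.tendsto_nhds]
    intro ε hε
    obtain ⟨m, hm⟩ := exists_nat_one_div_lt hε
    have h1 : ∀ᶠ β in 𝓝 α, ∀ i : Fin (m + 1), β i = α i := by
      rw [eventually_all]
      intro i
      exact (continuous_apply (i : ℕ)).continuousAt.eventually
        ((isOpen_discrete {α i}).mem_nhds rfl)
    filter_upwards [h1] with β hβ
    have h2 : res β (m + 1) = res α (m + 1) := funext hβ
    exact ((hUn m).2.2.2.1 _ _ (h2 ▸ hf β (m + 1)) _ (hf α (m + 1))).trans hm
  have hemb := hcont.isClosedEmbedding hinj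
  refine ⟨Set.range f, ⟨Set.range_nonempty f, isCompact_range hcont, ⟨hemb.isClosed_range, ?_⟩, ?_⟩,
    fun l x hx hxinj => ?_⟩
  · rintro _ ⟨α, rfl⟩
    rw [accPt_iff_nhds]
    intro W hW
    have hlim : Tendsto (fun m => Function.update α m (!α m)) atTop (𝓝 α) := by
      rw [tendsto_pi_nhds]
      intro k
      refine tendsto_const_nhds.congr' ?_
      filter_upwards [eventually_gt_atTop k] with m hm
      rw [Function.update_of_ne hm.ne]
    obtain ⟨m, hm⟩ := ((hcont.tendsto α).comp hlim |>.eventually hW).exists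
    refine ⟨_, ⟨hm, Set.mem_range_self _⟩, fun e => ?_⟩
    have := congrFun (hinj e) m
    simp at this
  · rw [hemb.isEmbedding.isTotallyDisconnected_range]
    infer_instance
  · choose α hα using hx
    have hαinj : Function.Injective α := fun i j e => hxinj (by rw [← hα i, ← hα j, e])
    have hsep : ∃ m, l ≤ m ∧ Function.Injective fun i => res (α i) (m + 1) := by
      have h1 : ∀ i j, ∃ k, i ≠ j → α i k ≠ α j k := by
        intro i j
        by_cases hij : i = j
        · exact ⟨0, fun h => absurd hij h⟩
        · obtain ⟨k, hk⟩ := Function.ne_iff.1 (hαinj.ne hij)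
          exact ⟨k, fun _ => hk⟩
      choose k hk using h1
      refine ⟨l + Finset.univ.sup fun p : Fin (n l) × Fin (n l) => k p.1 p.2, by omega,
        fun i j e => ?_⟩
      by_contra hij
      have h2 : k i j ≤ Finset.univ.sup fun p : Fin (n l) × Fin (n l) => k p.1 p.2 :=
        Finset.le_sup (f := fun p : Fin (n l) × Fin (n l) => k p.1 p.2) (Finset.mem_univ (i, j))
      exact hresne (hk i j hij) (by omega) e
    obtain ⟨m, hlm, hm⟩ := hsep
    exact (hUn m).2.2.2.2 l hlm _ hm x fun i => hα i ▸ hf (α i) (m + 1)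

end Mycielski

end MeanLiYorke

namespace MeanLiYorke

section NullFrontier

variable {X : Type*} [MeasurableSpace X]

lemma measure_frontier_iInter_eq_zero [TopologicalSpace X] {μ : Measure X} {ι : Type*} [Finite ι]
    {A : ι → Set X} (hA : ∀ i, μ (frontier (A i)) = 0) : μ (frontier (⋂ i, A i)) = 0 := by
  have hsub : frontier (⋂ i, A i) ⊆ ⋃ i, frontier (A i) := by
    intro x hx
    rw [frontier, interior_iInter_of_finite] at hx
    obtain ⟨i, hi⟩ : ∃ i, x ∉ interior (A i) := by
      simpa [Set.mem_iInter] using hx.2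
    exact Set.mem_iUnion.2 ⟨i, closure_mono (Set.iInter_subset A i) hx.1, hi⟩
  have := Finite.to_countable (α := ι)
  exact measure_mono_null hsub (measure_iUnion_null hA)

/-- Finite Borel partitions into cells of small diameter with negligible boundaries. -/
lemma exists_finVar_dist_lt [MetricSpace X] [CompactSpace X] [BorelSpace X] (μ : Measure X)
    [IsFiniteMeasure μ] {ε : ℝ} (hε : 0 < ε) :
    ∃ Q : FinVar X, (∀ x y, Q.fn x = Q.fn y → dist x y < ε) ∧
      ∀ r, μ (frontier (Q.fn ⁻¹' {r})) = 0 := by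
  classical
  have hball : ∀ x : X, ∃ ρ ∈ Set.Ioo 0 (ε / 2), μ (frontier (Metric.ball x ρ)) = 0 := by
    intro x
    obtain ⟨ρ, hρ, h⟩ := exists_null_frontier_thickening μ {x} (half_pos hε)
    exact ⟨ρ, hρ, by rwa [Metric.thickening_singleton] at h⟩
  choose ρ hρ hμ using hball
  obtain ⟨t, ht⟩ := isCompact_univ.elim_finite_subcover (fun x : X => Metric.ball x (ρ x))
    (fun x => Metric.isOpen_ball) (fun x _ => Set.mem_iUnion.2 ⟨x, Metric.mem_ball_self (hρ x).1⟩)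
  let c : Fin t.card → X := fun i => (t.equivFin.symm i : X)
  have hpre : ∀ r : Fin t.card → Bool,
      (fun x i => decide (x ∈ Metric.ball (c i) (ρ (c i)))) ⁻¹' {r} =
        ⋂ i, if r i then Metric.ball (c i) (ρ (c i)) else (Metric.ball (c i) (ρ (c i)))ᶜ := by
    intro r
    ext x
    simp only [Set.mem_preimage, Set.mem_singleton_iff, funext_iff, Set.mem_iInter]
    refine forall_congr' fun i => ?_
    cases r i <;> simp
  refine ⟨⟨Fin t.card → Bool, fun x i => decide (x ∈ Metric.ball (c i) (ρ (c i))), fun r => ?_⟩,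
    fun x y hxy => ?_, fun r => ?_⟩
  · rw [hpre]
    refine MeasurableSet.iInter fun i => ?_
    split_ifs
    · exact measurableSet_ball
    · exact measurableSet_ball.compl
  · obtain ⟨z, hz, hx⟩ := Set.mem_iUnion₂.1 (ht (Set.mem_univ x))
    have hc : c (t.equivFin ⟨z, hz⟩) = z := by simp [c]
    have h := congrFun hxy (t.equivFin ⟨z, hz⟩)
    have hy : y ∈ Metric.ball z (ρ z) := by
      rw [← hc] at hx ⊢
      exact (decide_eq_decide.1 h).1 hx
    have h1 := Metric.mem_ball.1 hx
    have h2 := Metric.mem_ball'.1 hy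
    have h3 := (hρ z).2
    linarith [dist_triangle x z y]
  · change μ (frontier ((fun x i => decide (x ∈ Metric.ball (c i) (ρ (c i)))) ⁻¹' {r})) = 0
    rw [hpre]
    refine measure_frontier_iInter_eq_zero fun i => ?_
    split_ifs
    · exact hμ _
    · rw [frontier_compl]; exact hμ _

lemma FinVar.measure_frontier_word_eq_zero [TopologicalSpace X] [OpensMeasurableSpace X]
    {μ : Measure X} {T : X → X} (hT : MeasurePreserving T μ μ) (hTc : Continuous T) {Q : FinVar X}
    (hQ : ∀ r, μ (frontier (Q.fn ⁻¹' {r})) = 0) (n : ℕ) (r : Fin n → Q.R) :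
    μ (frontier ((FinVar.word hT.measurable Q 0 n).fn ⁻¹' {r})) = 0 := by
  have : (FinVar.word hT.measurable Q 0 n).fn ⁻¹' {r} =
      ⋂ i : Fin n, T^[0 + i] ⁻¹' (Q.fn ⁻¹' {r i}) := by
    ext x
    simp only [Set.mem_preimage, Set.mem_singleton_iff, Set.mem_iInter]
    exact funext_iff
  rw [this]
  refine measure_frontier_iInter_eq_zero fun i => ?_
  refine measure_mono_null ((hTc.iterate _).frontier_preimage_subset _) ?_
  rw [(hT.iterate _).measure_preimage isClosed_frontier.measurableSet.nullMeasurableSet]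
  exact hQ _

end NullFrontier

end MeanLiYorke

namespace MeanLiYorke

open Real

namespace FinVar

section Averages

variable {X : Type*} [MeasurableSpace X]

lemma neg_log_le_ent (σ : Measure X) [IsProbabilityMeasure σ] (f : FinVar X) {δ : ℝ}
    (h : ∀ r, σ.real (f.fn ⁻¹' {r}) ≤ δ) : -log δ ≤ ent σ f := by
  have h1 : -log δ = ∑ r, σ.real (f.fn ⁻¹' {r}) * -log δ := by
    rw [← Finset.sum_mul, sum_real_preimage_univ, one_mul]
  rw [h1]
  refine Finset.sum_le_sum fun r _ => ?_
  rw [negMulLog, neg_mul, mul_neg, neg_le_neg_iff]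
  rcases (measureReal_nonneg (μ := σ) (s := f.fn ⁻¹' {r})).eq_or_lt with h0 | h0
  · rw [← h0]; simp
  · exact mul_le_mul_of_nonneg_left (log_le_log h0 (h r)) h0.le

lemma exists_finset_sup (σ : Measure X) [IsProbabilityMeasure σ] (g : ℕ → FinVar X)
    (I : Finset ℕ) :
    ∃ S : FinVar X, (∀ x y, S.fn x = S.fn y → ∀ i ∈ I, (g i).fn x = (g i).fn y) ∧
      ent σ S ≤ ∑ i ∈ I, ent σ (g i) := by
  classical
  induction I using Finset.induction_on with
  | empty => exact ⟨const X, by simp, by simp [ent_const]⟩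
  | insert a I ha ih =>
    obtain ⟨S, h1, h2⟩ := ih
    refine ⟨g a ⊔ S, fun x y e i hi => ?_, ?_⟩
    · rcases Finset.mem_insert.1 hi with rfl | hi
      · exact le_sup_left _ _ x y e
      · exact h1 x y (le_sup_right _ _ x y e) i hi
    · rw [Finset.sum_insert ha]
      exact (ent_sup_le σ _ _).trans (by linarith)

variable {T : X → X} (hT : Measurable T)

lemma ent_map_iterate (σ : Measure X) [IsProbabilityMeasure σ] (Q : FinVar X) (a n : ℕ) :
    ent (σ.map T^[a]) (word hT Q 0 n) = ent σ (word hT Q a n) := by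
  have h1 := word_le_comp hT Q 0 a n
  have h2 := comp_word_le hT Q 0 a n
  rw [zero_add] at h1 h2
  rw [← ent_comp _ σ ((hT.iterate a).measurePreserving σ)]
  exact ent_congr σ h2 h1

lemma ent_word_le_mul (σ : Measure X) [IsProbabilityMeasure σ] (Q : FinVar X) (a n : ℕ) :
    ent σ (word hT Q a n) ≤ n * log (Fintype.card Q.R) := by
  refine (ent_le_log_card σ _).trans (le_of_eq ?_)
  have : Fintype.card (word hT Q a n).R = Fintype.card Q.R ^ n := by
    change Fintype.card (Fin n → Q.R) = _
    simp
  rw [this]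
  push_cast
  rw [log_pow]

/-- The name of length `n` is determined by an initial segment and by the names of length `m`
starting at the times congruent to a given residue modulo `m`. -/
lemma ent_word_le_residue (σ : Measure X) [IsProbabilityMeasure σ] (Q : FinVar X) {m j : ℕ}
    (hj : j < m) (n : ℕ) :
    ent σ (word hT Q 0 n) ≤ m * log (Fintype.card Q.R) +
      ∑ i ∈ (Finset.range n).filter (fun i => i % m = j), ent σ (word hT Q i m) := by
  obtain ⟨S, h1, h2⟩ := exists_finset_sup σ (fun i => word hT Q i m)
    ((Finset.range n).filter (fun i => i % m = j))
  have h3 : word hT Q 0 n ≤ word hT Q 0 m ⊔ S := by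
    intro x y e
    have e1 := le_sup_left _ _ x y e
    have e2 := h1 x y (le_sup_right _ _ x y e)
    rw [word_fn_eq] at e1 ⊢
    intro i hi
    by_cases hij : i < j
    · exact e1 i (by omega)
    · have hmod : (i - j) % m < m := Nat.mod_lt _ (by omega)
      have hdiv := Nat.div_add_mod (i - j) m
      have hmem : j + m * ((i - j) / m) ∈ (Finset.range n).filter (fun i => i % m = j) := by
        rw [Finset.mem_filter, Finset.mem_range, Nat.add_mul_mod_self_left, Nat.mod_eq_of_lt hj]
        omega
      have := (word_fn_eq hT).1 (e2 _ hmem) ((i - j) % m) hmod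
      rwa [show j + m * ((i - j) / m) + (i - j) % m = 0 + i by omega] at this
  have h4 := ent_mono σ h3
  have h5 := ent_sup_le σ (word hT Q 0 m) S
  have h6 := ent_word_le_mul hT σ Q 0 m
  linarith

lemma mul_ent_word_le (σ : Measure X) [IsProbabilityMeasure σ] (Q : FinVar X) {m : ℕ}
    (hm : 0 < m) (n : ℕ) :
    m * ent σ (word hT Q 0 n) ≤ m * (m * log (Fintype.card Q.R)) +
      ∑ i ∈ Finset.range n, ent σ (word hT Q i m) := by
  have h1 := Finset.sum_le_sum fun j (hj : j ∈ Finset.range m) =>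
    ent_word_le_residue hT σ Q (Finset.mem_range.1 hj) n
  rw [Finset.sum_add_distrib, Finset.sum_fiberwise_of_maps_to
    (fun i _ => Finset.mem_range.2 (Nat.mod_lt i hm))] at h1
  simpa using h1

end Averages

end FinVar

section Averages

variable {X : Type*} [MeasurableSpace X]

/-- The average of the first `n` images of a measure. -/
noncomputable def orbitAverage (T : X → X) (σ : Measure X) (n : ℕ) : Measure X :=
  (n : ENNReal)⁻¹ • ∑ i ∈ Finset.range n, σ.map T^[i]

variable {T : X → X} (σ : Measure X) [IsProbabilityMeasure σ]

lemma isProbabilityMeasure_orbitAverage (hT : Measurable T) {n : ℕ} (hn : n ≠ 0) :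
    IsProbabilityMeasure (orbitAverage T σ n) := by
  constructor
  have : ∀ i, σ.map T^[i] Set.univ = 1 := fun i => by
    rw [Measure.map_apply (hT.iterate i) MeasurableSet.univ]; simp
  simp only [orbitAverage, Measure.smul_apply, Measure.finsetSum_apply, this, smul_eq_mul]
  simp [ENNReal.inv_mul_cancel, hn]

lemma orbitAverage_real (hT : Measurable T) (n : ℕ) (A : Set X) :
    (orbitAverage T σ n).real A = ∑ i ∈ Finset.range n, (n : ℝ)⁻¹ * (σ.map T^[i]).real A := by
  have : ∀ i, IsProbabilityMeasure (σ.map T^[i]) := fun i =>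
    Measure.isProbabilityMeasure_map (hT.iterate i).aemeasurable
  rw [orbitAverage, measureReal_ennreal_smul_apply, measureReal_def, Measure.finsetSum_apply,
    ENNReal.toReal_sum (fun _ _ => measure_ne_top _ _), Finset.mul_sum]
  simp [measureReal_def]

lemma sum_ent_le_mul_ent_orbitAverage (hT : Measurable T) (f : FinVar X) {n : ℕ} (hn : n ≠ 0) :
    ∑ i ∈ Finset.range n, FinVar.ent (σ.map T^[i]) f ≤ n * FinVar.ent (orbitAverage T σ n) f := by
  have hn' : (0 : ℝ) < n := by positivity
  have key : ∑ i ∈ Finset.range n, (n : ℝ)⁻¹ * FinVar.ent (σ.map T^[i]) f ≤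
      FinVar.ent (orbitAverage T σ n) f := by
    simp only [FinVar.ent, Finset.mul_sum]
    rw [Finset.sum_comm]
    refine Finset.sum_le_sum fun r _ => ?_
    rw [orbitAverage_real σ hT]
    refine concaveOn_negMulLog.le_map_sum (fun _ _ => by positivity) ?_
      (fun _ _ => measureReal_nonneg)
    simp [hn]
  rw [← Finset.mul_sum, inv_mul_le_iff₀ hn'] at key
  exact key

lemma integral_orbitAverage [TopologicalSpace X] [OpensMeasurableSpace X]
    (hT : Measurable T) (n : ℕ) (f : BoundedContinuousFunction X ℝ) :
    ∫ x, f x ∂(orbitAverage T σ n) =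
      (n : ℝ)⁻¹ * ∑ i ∈ Finset.range n, ∫ x, f (T^[i] x) ∂σ := by
  have : ∀ i, IsProbabilityMeasure (σ.map T^[i]) := fun i =>
    Measure.isProbabilityMeasure_map (hT.iterate i).aemeasurable
  rw [orbitAverage, integral_smul_measure, integral_finsetSum_measure]
  · simp only [ENNReal.toReal_inv, ENNReal.toReal_natCast, smul_eq_mul]
    congr 1
    refine Finset.sum_congr rfl fun i _ => ?_
    exact integral_map (hT.iterate i).aemeasurable
      f.continuous.measurable.aestronglyMeasurable
  · exact fun i _ => f.integrable _

lemma abs_integral_orbitAverage_comp_sub_le [TopologicalSpace X] [OpensMeasurableSpace X]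
    (hT : Measurable T) (hTc : Continuous T) (n : ℕ) (f : BoundedContinuousFunction X ℝ) :
    |∫ x, f (T x) ∂(orbitAverage T σ n) - ∫ x, f x ∂(orbitAverage T σ n)| ≤
      (n : ℝ)⁻¹ * (2 * ‖f‖) := by
  have h1 := integral_orbitAverage σ hT n (f.compContinuous ⟨T, hTc⟩)
  have h2 := integral_orbitAverage σ hT n f
  simp only [BoundedContinuousFunction.compContinuous_apply, ContinuousMap.coe_mk] at h1
  have h3 : ∀ i, ∫ x, f (T (T^[i] x)) ∂σ = ∫ x, f (T^[i + 1] x) ∂σ := fun i => by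
    simp only [Function.iterate_succ_apply']
  simp only [h3] at h1
  rw [h1, h2, ← mul_sub, ← Finset.sum_sub_distrib,
    Finset.sum_range_sub (fun i => ∫ x, f (T^[i] x) ∂σ), abs_mul, abs_of_nonneg (by positivity)]
  have h4 : ∀ i, |∫ x, f (T^[i] x) ∂σ| ≤ ‖f‖ := fun i => by
    have := norm_integral_le_of_norm_le_const (μ := σ) (f := fun x => f (T^[i] x))
      (Eventually.of_forall fun x => f.norm_coe_le_norm _)
    simpa using this
  refine mul_le_mul_of_nonneg_left ?_ (by positivity)
  have := abs_sub (∫ x, f (T^[n] x) ∂σ) (∫ x, f (T^[0] x) ∂σ)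
  linarith [h4 n, h4 0]

end Averages

end MeanLiYorke

namespace MeanLiYorke

lemma exists_separated_finsets {X : Type*} [MetricSpace X] {T : X → X}
    (hent : 0 < Dynamics.coverEntropy T Set.univ) :
    ∃ ε, 0 < ε ∧ ∃ h : ℝ, 0 < h ∧ ∃ᶠ n : ℕ in atTop, ∃ s : Finset X, Real.exp (h * n) ≤ s.card ∧
      ∀ x ∈ s, ∀ y ∈ s, (∀ k < n, dist (T^[k] x) (T^[k] y) < ε) → x = y := by
  rw [Dynamics.coverEntropy_eq_iSup_basis_netEntropyEntourage Metric.uniformity_basis_dist] at hent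
  simp only [lt_iSup_iff] at hent
  obtain ⟨ε, hε, h⟩ := hent
  obtain ⟨a, ha0, ha⟩ := EReal.lt_iff_exists_real_btwn.1 h
  have ha0' : 0 < a := by exact_mod_cast ha0
  refine ⟨ε, hε, a / 2, by positivity, ?_⟩
  have hfr := ExpGrowth.frequently_exp_le ha
  refine (hfr.and_eventually (eventually_ge_atTop 1)).mono fun n hn => ?_
  obtain ⟨hn, hn1⟩ := hn
  by_contra hcon
  push Not at hcon
  have hnet : Dynamics.netMaxcard T Set.univ {p : X × X | dist p.1 p.2 < ε} n ≤
      (⌊Real.exp (a / 2 * n)⌋₊ : ℕ∞) := by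
    refine iSup₂_le fun s hs => ?_
    have hlt : (s.card : ℝ) < Real.exp (a / 2 * n) := by
      by_contra hle
      obtain ⟨x, hx, y, hy, hxy, hne⟩ := hcon s (not_lt.1 hle)
      exact Set.disjoint_left.1 (hs.2 hx hy hne) (Dynamics.mem_dynEntourage.2 hxy)
        (Dynamics.mem_dynEntourage.2 fun k _ => by simpa using hε)
    exact_mod_cast Nat.le_floor hlt.le
  have h1 : EReal.exp ((a : EReal) * n) ≤ EReal.exp ((a / 2 * n : ℝ) : EReal) := by
    refine hn.trans ?_
    rw [EReal.exp_coe]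
    refine (ENat.toENNReal_le.2 hnet).trans ?_
    rw [ENat.toENNReal_coe, ← ENNReal.ofReal_natCast]
    exact ENNReal.ofReal_le_ofReal (Nat.floor_le (Real.exp_pos _).le)
  have h2 := EReal.exp_le_exp_iff.1 h1
  have h3 : a * n ≤ a / 2 * n := by exact_mod_cast h2
  have h4 : (1 : ℝ) ≤ n := by exact_mod_cast hn1
  nlinarith

lemma log_card_le_ent_uniform {X : Type*} [MeasurableSpace X] (s : Finset X) (hs : s.Nonempty)
    (f : FinVar X) (hf : ∀ x ∈ s, ∀ y ∈ s, f.fn x = f.fn y → x = y) :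
    Real.log s.card ≤ FinVar.ent (PMF.uniformOfFinset s hs).toMeasure f := by
  classical
  rw [← neg_neg (Real.log s.card), ← Real.log_inv]
  refine FinVar.neg_log_le_ent _ f fun r => ?_
  rw [measureReal_def, PMF.toMeasure_uniformOfFinset_apply hs _ (f.meas r), ENNReal.toReal_div]
  simp only [ENNReal.toReal_natCast]
  rw [div_eq_mul_inv]
  refine mul_le_of_le_one_left (by positivity) ?_
  rw [Nat.cast_le_one, Finset.card_le_one]
  intro x hx y hy
  rw [Finset.mem_filter] at hx hy
  exact hf x hx.1 y hy.1 (hx.2.trans hy.2.symm)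

/-- A system of positive topological entropy has an invariant measure of positive entropy. -/
theorem exists_invariant_measure_rate_pos {X : Type*} [MeasurableSpace X] [MetricSpace X]
    [CompactSpace X] [BorelSpace X] {T : X → X} (hTc : Continuous T)
    (hent : 0 < Dynamics.coverEntropy T Set.univ) :
    ∃ (μ : Measure X) (_ : IsProbabilityMeasure μ) (hT : MeasurePreserving T μ μ) (P : FinVar X),
      0 < FinVar.rate hT P := by
  obtain ⟨ε, hε, h, hh, hfr⟩ := exists_separated_finsets hent
  have hTm : Measurable T := hTc.measurable
  set L : Filter ℕ := atTop ⊓ 𝓟 {n | ∃ s : Finset X, Real.exp (h * n) ≤ s.card ∧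
      ∀ x ∈ s, ∀ y ∈ s, (∀ k < n, dist (T^[k] x) (T^[k] y) < ε) → x = y} with hL
  have hLne : L.NeBot := frequently_mem_iff_neBot.1 hfr
  let 𝒰 := Ultrafilter.of L
  have h𝒰 : (𝒰 : Filter ℕ) ≤ L := Ultrafilter.of_le L
  have hgood : ∀ᶠ n : ℕ in 𝒰, n ≠ 0 ∧ ∃ s : Finset X, Real.exp (h * n) ≤ s.card ∧
      ∀ x ∈ s, ∀ y ∈ s, (∀ k < n, dist (T^[k] x) (T^[k] y) < ε) → x = y := by
    have h1 : ∀ᶠ n : ℕ in 𝒰, n ≠ 0 :=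
      (h𝒰.trans inf_le_left) (eventually_ne_atTop 0)
    exact h1.and ((h𝒰.trans inf_le_right) (mem_principal_self _))
  have hσ : ∀ n : ℕ, ∃ ν : ProbabilityMeasure X, (n ≠ 0 ∧ ∃ s : Finset X,
      Real.exp (h * n) ≤ s.card ∧
      ∀ x ∈ s, ∀ y ∈ s, (∀ k < n, dist (T^[k] x) (T^[k] y) < ε) → x = y) →
      ∃ σ : Measure X, IsProbabilityMeasure σ ∧ (ν : Measure X) = orbitAverage T σ n ∧
        ∀ Q : FinVar X, (∀ x y, Q.fn x = Q.fn y → dist x y < ε) →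
          h * n ≤ FinVar.ent σ (FinVar.word hTm Q 0 n) := by
    intro n
    by_cases hn : n ≠ 0 ∧ ∃ s : Finset X, Real.exp (h * n) ≤ s.card ∧
      ∀ x ∈ s, ∀ y ∈ s, (∀ k < n, dist (T^[k] x) (T^[k] y) < ε) → x = y
    · obtain ⟨hn0, s, hs, hsep⟩ := hn
      have hcard : (0 : ℝ) < s.card := (Real.exp_pos _).trans_le hs
      have hne : s.Nonempty := Finset.card_pos.1 (by exact_mod_cast hcard)
      refine ⟨⟨orbitAverage T (PMF.uniformOfFinset s hne).toMeasure n,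
        isProbabilityMeasure_orbitAverage _ hTm hn0⟩, fun _ =>
        ⟨(PMF.uniformOfFinset s hne).toMeasure, inferInstance, rfl, fun Q hQ => ?_⟩⟩
      refine ((Real.le_log_iff_exp_le hcard).2 hs).trans (log_card_le_ent_uniform s hne _ ?_)
      intro x hx y hy hxy
      rw [FinVar.word_fn_eq] at hxy
      exact hsep x hx y hy fun k hk => hQ _ _ (by simpa using hxy k hk)
    · obtain ⟨m, hm, s, hs, -⟩ := hgood.exists
      have hcard : (0 : ℝ) < s.card := (Real.exp_pos _).trans_le hs
      obtain ⟨x, -⟩ : s.Nonempty := Finset.card_pos.1 (by exact_mod_cast hcard)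
      exact ⟨⟨Measure.dirac x, inferInstance⟩, fun h => absurd h hn⟩
  choose ν hν using hσ
  obtain ⟨μ, -, hμ⟩ := isCompact_univ.ultrafilter_le_nhds (𝒰.map ν) (by simp)
  have hlim : Tendsto ν 𝒰 (𝓝 μ) := hμ
  have hinv : Tendsto (fun n : ℕ => (n : ℝ)⁻¹) 𝒰 (𝓝 0) :=
    tendsto_inv_atTop_nhds_zero_nat.mono_left (h𝒰.trans inf_le_left)
  have hT : MeasurePreserving T (μ : Measure X) μ := by
    refine ⟨hTm, ?_⟩
    have : IsProbabilityMeasure ((μ : Measure X).map T) :=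
      Measure.isProbabilityMeasure_map hTm.aemeasurable
    refine ext_of_forall_integral_eq_of_IsFiniteMeasure fun f => ?_
    rw [integral_map hTm.aemeasurable f.continuous.measurable.aestronglyMeasurable]
    have h1 := ProbabilityMeasure.tendsto_iff_forall_integral_tendsto.1 hlim f
    have h2 := ProbabilityMeasure.tendsto_iff_forall_integral_tendsto.1 hlim
      (f.compContinuous ⟨T, hTc⟩)
    have h3 := h2.sub h1
    have h4 : Tendsto (fun n : ℕ => (n : ℝ)⁻¹ * (2 * ‖f‖)) 𝒰 (𝓝 0) := by
      simpa using hinv.mul_const (2 * ‖f‖)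
    have h5 := squeeze_zero_norm' (hgood.mono fun n hn => ?_) h4 |> tendsto_nhds_unique h3
    · exact sub_eq_zero.1 h5
    · obtain ⟨σ, hσ, hνσ, -⟩ := hν n hn
      rw [hνσ]
      exact abs_integral_orbitAverage_comp_sub_le σ hTm hTc n f
  obtain ⟨P, hP, hPf⟩ := exists_finVar_dist_lt (μ : Measure X) hε
  refine ⟨μ, inferInstance, hT, P, hh.trans_le ?_⟩
  have key : ∀ m : ℕ, 0 < m → m * h ≤ FinVar.ent (μ : Measure X) (FinVar.word hTm P 0 m) := by
    intro m hm
    set W := FinVar.word hTm P 0 m with hW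
    have h1 : Tendsto (fun n => FinVar.ent (ν n : Measure X) W) 𝒰
        (𝓝 (FinVar.ent (μ : Measure X) W)) := by
      refine tendsto_finsetSum _ fun r _ => (Real.continuous_negMulLog.tendsto _).comp ?_
      have := ProbabilityMeasure.tendsto_measure_of_null_frontier_of_tendsto' hlim
        (FinVar.measure_frontier_word_eq_zero hT hTc hPf m r)
      exact (ENNReal.tendsto_toReal (measure_ne_top _ _)).comp this
    set C := Real.log (Fintype.card P.R) with hC
    have h2 : Tendsto (fun n : ℕ => m * h - (n : ℝ)⁻¹ * (m * (m * C))) 𝒰 (𝓝 (m * h)) := by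
      simpa using tendsto_const_nhds.sub (hinv.mul_const (m * (m * C)))
    refine le_of_tendsto_of_tendsto h2 h1 (hgood.mono fun n hn => ?_)
    obtain ⟨σ, hσ, hνσ, hent⟩ := hν n hn
    have hn0 : (0 : ℝ) < n := by exact_mod_cast Nat.pos_of_ne_zero hn.1
    have a1 := FinVar.mul_ent_word_le hTm σ P hm n
    have a2 := sum_ent_le_mul_ent_orbitAverage σ hTm W hn.1
    have a3 := mul_le_mul_of_nonneg_left (hent P hP) (Nat.cast_nonneg (α := ℝ) m)
    simp only [hW, FinVar.ent_map_iterate hTm] at a2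
    rw [← hνσ, ← hW] at a2
    change m * h - (n : ℝ)⁻¹ * (m * (m * C)) ≤ FinVar.ent (ν n : Measure X) W
    have a4 : m * h * n ≤ m * (m * C) + n * FinVar.ent (ν n : Measure X) W := by nlinarith
    have a5 : (n : ℝ)⁻¹ * (m * h * n) ≤
        (n : ℝ)⁻¹ * (m * (m * C) + n * FinVar.ent (ν n : Measure X) W) := by gcongr
    have a6 : (n : ℝ)⁻¹ * (m * h * n) = m * h := by field_simp
    have a7 : (n : ℝ)⁻¹ * (n * FinVar.ent (ν n : Measure X) W) =
      FinVar.ent (ν n : Measure X) W := by field_simp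
    rw [mul_add, a6, a7] at a5
    linarith
  refine ge_of_tendsto ((FinVar.subadditive_ent_word hT P).tendsto_lim
    (FinVar.bddBelow_ent_word hT P)) ((eventually_gt_atTop 0).mono fun m hm => ?_)
  rw [le_div_iff₀ (by exact_mod_cast hm), mul_comm]
  exact key m hm

end MeanLiYorke

namespace MeanLiYorke

section Relations

variable {X : Type*} [MetricSpace X]

/-- Tuples whose orbits along `s` are close on average over some long time window. -/
def proximalTuples (T : X → X) (s : ℕ → ℕ) (n q : ℕ) : Set (Fin n → X) :=
  {x | ∃ N, q < N ∧ ∑ k ∈ Finset.Icc 1 N, ∑ i, ∑ j, dist (T^[s k] (x i)) (T^[s k] (x j)) <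
    N / ((q : ℝ) + 1)}

/-- Tuples whose orbits along `s` are `r`-separated for a proportion at least `c` of some long
time window. -/
def separatedTuples (T : X → X) (s : ℕ → ℕ) (r c : ℝ) (n q : ℕ) : Set (Fin n → X) :=
  {x | ∃ N, q < N ∧ ∃ F ⊆ Finset.Icc 1 N, c * N ≤ F.card ∧
    ∀ k ∈ F, ∀ i j, i < j → r < dist (T^[s k] (x i)) (T^[s k] (x j))}

lemma isOpen_proximalTuples {T : X → X} (hT : Continuous T) (s : ℕ → ℕ) (n q : ℕ) :
    IsOpen (proximalTuples T s n q) := by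
  simp only [proximalTuples, Set.ofPred_exists, Set.ofPred_and]
  refine isOpen_iUnion fun N => isOpen_const.inter (isOpen_lt ?_ continuous_const)
  have := fun k => hT.iterate k
  fun_prop

lemma isOpen_separatedTuples {T : X → X} (hT : Continuous T) (s : ℕ → ℕ) (r c : ℝ) (n q : ℕ) :
    IsOpen (separatedTuples T s r c n q) := by
  have hc := fun k => hT.iterate k
  rw [isOpen_iff_mem_nhds]
  rintro x ⟨N, hN, F, hF, hcF, h⟩
  have : ∀ᶠ y in 𝓝 x, ∀ k ∈ F, ∀ i j, i < j → r < dist (T^[s k] (y i)) (T^[s k] (y j)) := by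
    rw [Finset.eventually_all]
    refine fun k hk => eventually_all.2 fun i => eventually_all.2 fun j => ?_
    by_cases hij : i < j
    · have hcont : Continuous fun y : Fin n → X => dist (T^[s k] (y i)) (T^[s k] (y j)) := by
        fun_prop
      filter_upwards [hcont.continuousAt.eventually_const_lt (h k hk i j hij)] with y hy _ using hy
    · exact Eventually.of_forall fun y h => absurd h hij
  filter_upwards [this] with y hy using ⟨N, hN, F, hF, hcF, hy⟩

variable [CompactSpace X] [MeasurableSpace X] {T : X → X} {κ : Measure X}
  [IsProbabilityMeasure κ] {Q : ℕ → FinVar X} {s : ℕ → ℕ}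

lemma exists_mem_proximalTuples (hT : Measurable T)
    (hQ : ∀ j x y, (Q j).fn x = (Q j).fn y → dist x y < 1 / ((j : ℝ) + 1))
    (hind : ∀ j, ∀ B ∈ TopologicalSpace.countableBasis X, AsympIndep hT κ (Q j) B)
    (hs : ∀ k, k ≤ s k + 1) {n : ℕ} (q : ℕ) {V : Fin n → Set X} (hV : ∀ i, IsOpen (V i))
    (hVE : ∀ i, (V i ∩ κ.support).Nonempty) :
    ∃ x ∈ proximalTuples T s n q, ∀ i, x i ∈ V i ∩ κ.support := by
  obtain ⟨j, hj⟩ := exists_nat_gt (2 * ((q : ℝ) + 1) * (n * n))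
  obtain ⟨a, ha⟩ := exists_close_orbits hT (hQ j) (hind j) hV hVE
  set D := Metric.diam (Set.univ : Set X) with hD
  have hdist : ∀ x y : X, dist x y ≤ D := fun x y =>
    Metric.dist_le_diam_of_mem (isCompact_univ.isBounded) (Set.mem_univ x) (Set.mem_univ y)
  have hD0 : 0 ≤ D := Metric.diam_nonneg
  obtain ⟨N₀, hN₀⟩ := exists_nat_gt (2 * ((q : ℝ) + 1) * (a * (n * n * D)))
  set N := max N₀ (q + 1) with hN
  have hNq : q < N := lt_of_lt_of_le (Nat.lt_succ_self q) (le_max_right _ _)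
  have hN1 : 2 * ((q : ℝ) + 1) * (a * (n * n * D)) < N :=
    hN₀.trans_le (by exact_mod_cast le_max_left _ _)
  obtain ⟨x, hx, hclose⟩ := ha ((Finset.Icc 1 N).sup s + 1)
  refine ⟨x, ⟨N, hNq, ?_⟩, hx⟩
  have hN0 : (0 : ℝ) < N := by exact_mod_cast (Nat.zero_le q).trans_lt hNq
  have hterm : ∀ k ∈ Finset.Icc 1 N,
      ∑ i, ∑ l, dist (T^[s k] (x i)) (T^[s k] (x l)) ≤
        (if s k < a then n * n * D else 0) + n * n * (1 / ((j : ℝ) + 1)) := by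
    intro k hk
    have hε : (0 : ℝ) ≤ n * n * (1 / ((j : ℝ) + 1)) := by positivity
    split_ifs with hka
    · have : ∑ i, ∑ l, dist (T^[s k] (x i)) (T^[s k] (x l)) ≤
          ∑ _i : Fin n, ∑ _l : Fin n, D :=
        Finset.sum_le_sum fun i _ => Finset.sum_le_sum fun l _ => hdist _ _
      simp only [Finset.sum_const, Finset.card_univ, Fintype.card_fin, nsmul_eq_mul] at this
      linarith
    · have hkM : s k < (Finset.Icc 1 N).sup s + 1 := Nat.lt_succ_of_le (Finset.le_sup hk)
      have : ∑ i, ∑ l, dist (T^[s k] (x i)) (T^[s k] (x l)) ≤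
          ∑ _i : Fin n, ∑ _l : Fin n, 1 / ((j : ℝ) + 1) :=
        Finset.sum_le_sum fun i _ => Finset.sum_le_sum fun l _ =>
          (hclose (s k) (not_lt.1 hka) hkM i l).le
      simp only [Finset.sum_const, Finset.card_univ, Fintype.card_fin, nsmul_eq_mul] at this
      linarith
  refine (Finset.sum_le_sum hterm).trans_lt ?_
  rw [Finset.sum_add_distrib, ← Finset.sum_filter, Finset.sum_const, Finset.sum_const,
    Nat.card_Icc, Nat.add_sub_cancel, nsmul_eq_mul, nsmul_eq_mul]
  have h1 : (((Finset.Icc 1 N).filter fun k => s k < a).card : ℝ) * (n * n * D) ≤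
      a * (n * n * D) :=
    mul_le_mul_of_nonneg_right (by exact_mod_cast card_filter_lt_le hs N a) (by positivity)
  have hq : (0 : ℝ) < (q : ℝ) + 1 := by positivity
  have h2 : a * (n * n * D) < N / ((q : ℝ) + 1) / 2 := by
    rw [div_div, lt_div_iff₀ (by positivity)]
    linarith
  have h3 : (n : ℝ) * n * (1 / ((j : ℝ) + 1)) ≤ 1 / ((q : ℝ) + 1) / 2 := by
    rw [mul_one_div, div_div, div_le_div_iff₀ (by positivity) (by positivity)]
    linarith
  have h4 : N * ((n : ℝ) * n * (1 / ((j : ℝ) + 1))) ≤ N * (1 / ((q : ℝ) + 1) / 2) := by gcongr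
  have h5 : N * (1 / ((q : ℝ) + 1) / 2) = N / ((q : ℝ) + 1) / 2 := by ring
  linarith

/-- Positive entropy yields a Cantor set all of whose tuples are both proximal and separated
along `s`. -/
theorem exists_cantor_proximal_separated [BorelSpace X] (T : X ≃ₜ X)
    (hent : 0 < Dynamics.coverEntropy (⇑T) Set.univ) (hs : ∀ k, k ≤ s k + 1) :
    ∃ K : Set X, (K.Nonempty ∧ IsCompact K ∧ Perfect K ∧ IsTotallyDisconnected K) ∧
      ∀ n : ℕ, ∃ r > 0, ∃ c > 0, ∀ x : Fin n → X, (∀ i, x i ∈ K) → Function.Injective x →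
        ∀ q, x ∈ proximalTuples T s n q ∧ x ∈ separatedTuples T s r c n q := by
  obtain ⟨μ, _, hT, P, hP⟩ := exists_invariant_measure_rate_pos T.continuous hent
  choose Q hQ _ using fun j : ℕ =>
    exists_finVar_dist_lt μ (Nat.one_div_pos_of_nat (α := ℝ) (n := j))
  obtain ⟨κ, _, hind, hfr⟩ :=
    exists_good_measure (T := T.toMeasurableEquiv) hT hP hQ s
  choose r hr c hc hsep using exists_separated_orbits T.toMeasurableEquiv.measurable hQ hind hs hfr
  have hsep' : ∀ n q, ∀ V : Fin n → Set X, (∀ i, IsOpen (V i)) →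
      (∀ i, (V i ∩ κ.support).Nonempty) →
      ∃ x ∈ separatedTuples T s (r n / 2) (c n) n q, ∀ i, x i ∈ V i ∩ κ.support := by
    intro n q V hV hVE
    obtain ⟨N, hN, x, hx, hcard⟩ := hsep n V hV hVE (q + 1)
    refine ⟨x, ⟨N, hN, _, Finset.filter_subset _ _, hcard, fun k hk i j hij => ?_⟩, hx⟩
    exact (half_lt_self (hr n)).trans_le ((Finset.mem_filter.1 hk).2 i j hij)
  obtain ⟨f, hf⟩ := exists_surjective_nat (ℕ × ℕ × Bool)
  obtain ⟨K, hK, hKO⟩ := exists_independent_cantor (E := κ.support) (n := fun l => (f l).1)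
    (O := fun l => if (f l).2.2 then proximalTuples T s (f l).1 (f l).2.1
      else separatedTuples T s (r (f l).1 / 2) (c (f l).1) (f l).1 (f l).2.1)
    (Measure.nonempty_support (IsProbabilityMeasure.ne_zero κ))
    (fun l => by
      split_ifs
      · exact isOpen_proximalTuples T.continuous _ _ _
      · exact isOpen_separatedTuples T.continuous _ _ _ _ _)
    (fun l V hV hVE => by
      split_ifs
      · exact exists_mem_proximalTuples T.toMeasurableEquiv.measurable hQ hind hs _ hV hVE
      · exact hsep' _ _ V hV hVE)
    (fun V hV hVE => by
      obtain ⟨x, ⟨N, hN, F, hF, hcF, h⟩, hx⟩ := hsep' 2 0 (fun _ => V) (fun _ => hV) (fun _ => hVE)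
      refine ⟨x 0, hx 0, x 1, hx 1, fun heq => ?_⟩
      have hpos : (0 : ℝ) < F.card :=
        (mul_pos (hc 2) (by exact_mod_cast hN)).trans_le hcF
      obtain ⟨k, hk⟩ : F.Nonempty := Finset.card_pos.1 (by exact_mod_cast hpos)
      have := h k hk 0 1 (by decide)
      rw [heq, dist_self] at this
      linarith [hr 2])
  have key : ∀ p : ℕ × ℕ × Bool, ∀ x : Fin p.1 → X, (∀ i, x i ∈ K) → Function.Injective x →
      x ∈ if p.2.2 then proximalTuples T s p.1 p.2.1
        else separatedTuples T s (r p.1 / 2) (c p.1) p.1 p.2.1 := by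
    intro p
    obtain ⟨l, rfl⟩ := hf p
    exact hKO l
  refine ⟨K, hK, fun n => ⟨r n / 2, half_pos (hr n), c n, hc n, fun x hxK hx q => ⟨?_, ?_⟩⟩⟩
  · simpa using key (n, q, true) x hxK hx
  · simpa using key (n, q, false) x hxK hx

end Relations

end MeanLiYorke

namespace MeanLiYorke

section PairDist

variable {X : Type*} [PseudoMetricSpace X] {n : ℕ} (y : Fin n → X)

lemma maxPairDist_nonneg : 0 ≤ maxPairDist y := by
  refine Real.sSup_nonneg ?_
  rintro _ ⟨i, j, -, rfl⟩
  exact dist_nonneg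

lemma minPairDist_nonneg : 0 ≤ minPairDist y := by
  refine Real.sInf_nonneg ?_
  rintro _ ⟨i, j, -, rfl⟩
  exact dist_nonneg

lemma maxPairDist_le_sum : maxPairDist y ≤ ∑ i, ∑ j, dist (y i) (y j) := by
  refine Real.sSup_le ?_ (Finset.sum_nonneg fun _ _ => Finset.sum_nonneg fun _ _ => dist_nonneg)
  rintro _ ⟨i, j, -, rfl⟩
  refine (Finset.single_le_sum (f := fun j => dist (y i) (y j)) (fun _ _ => dist_nonneg)
    (Finset.mem_univ j)).trans ?_
  exact Finset.single_le_sum (f := fun i => ∑ j, dist (y i) (y j))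
    (fun _ _ => Finset.sum_nonneg fun _ _ => dist_nonneg) (Finset.mem_univ i)

lemma maxPairDist_le {D : ℝ} (hD : 0 ≤ D) (h : ∀ i j, dist (y i) (y j) ≤ D) :
    maxPairDist y ≤ D := by
  refine Real.sSup_le ?_ hD
  rintro _ ⟨i, j, -, rfl⟩
  exact h i j

lemma minPairDist_le {D : ℝ} (hD : 0 ≤ D) (h : ∀ i j, dist (y i) (y j) ≤ D) :
    minPairDist y ≤ D := by
  refine (Real.sInf_le_sSup _ ⟨0, ?_⟩ ⟨D, ?_⟩).trans (maxPairDist_le y hD h)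
  · rintro _ ⟨i, j, -, rfl⟩
    exact dist_nonneg
  · rintro _ ⟨i, j, -, rfl⟩
    exact h i j

lemma le_minPairDist (hn : 2 ≤ n) {r : ℝ} (h : ∀ i j, i < j → r ≤ dist (y i) (y j)) :
    r ≤ minPairDist y := by
  refine le_csInf ⟨_, ⟨0, by omega⟩, ⟨1, by omega⟩, by simp, rfl⟩ ?_
  rintro _ ⟨i, j, hij, rfl⟩
  exact h i j hij

end PairDist

lemma le_primeSeq_add_one (k : ℕ) : k ≤ primeSeq k + 1 := by
  have := Nat.add_two_le_nth_prime (k - 1)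
  unfold primeSeq
  omega

lemma inv_mul_sum_Icc_le {D : ℝ} (hD : 0 ≤ D) {u : ℕ → ℝ} (hu : ∀ k, u k ≤ D) (N : ℕ) :
    (N : ℝ)⁻¹ * ∑ k ∈ Finset.Icc 1 N, u k ≤ D := by
  rcases Nat.eq_zero_or_pos N with rfl | hN
  · simpa using hD
  · rw [inv_mul_le_iff₀ (by exact_mod_cast hN)]
    refine (Finset.sum_le_sum fun k _ => hu k).trans ?_
    simp

end MeanLiYorke

/-- Positive topological entropy implies multivariant mean Li-Yorke chaos along
the sequence of primes. -/
theorem mean_LiYorke_chaos_along_primes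
    {X : Type*} [MetricSpace X] [CompactSpace X] (T : X ≃ₜ X)
    (hent : 0 < Dynamics.coverEntropy (⇑T) Set.univ) :
    ∃ K : Set X, IsCantorSet K ∧
      ∀ n : ℕ, 2 ≤ n → ∀ x : Fin n → X, (∀ i, x i ∈ K) → Function.Injective x →
        liminf (fun N : ℕ => (N : ℝ)⁻¹ * ∑ k ∈ Finset.Icc 1 N,
            maxPairDist fun i => (⇑T)^[primeSeq k] (x i)) atTop = 0 ∧
        0 < limsup (fun N : ℕ => (N : ℝ)⁻¹ * ∑ k ∈ Finset.Icc 1 N,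
            minPairDist fun i => (⇑T)^[primeSeq k] (x i)) atTop := by
  let _ : MeasurableSpace X := borel X
  have : BorelSpace X := ⟨rfl⟩
  obtain ⟨K, hK, hKx⟩ := MeanLiYorke.exists_cantor_proximal_separated T hent
    MeanLiYorke.le_primeSeq_add_one
  refine ⟨K, hK, fun n hn x hxK hx => ?_⟩
  obtain ⟨r, hr, c, hc, hrel⟩ := hKx n
  have hdist : ∀ y z : X, dist y z ≤ Metric.diam (Set.univ : Set X) := fun y z =>
    Metric.dist_le_diam_of_mem (isCompact_univ.isBounded) (Set.mem_univ y) (Set.mem_univ z)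
  have hD : 0 ≤ Metric.diam (Set.univ : Set X) := Metric.diam_nonneg
  constructor
  · set u : ℕ → ℝ := fun N => (N : ℝ)⁻¹ * ∑ k ∈ Finset.Icc 1 N,
      maxPairDist fun i => (⇑T)^[primeSeq k] (x i) with hu
    have hu0 : ∀ N, 0 ≤ u N := fun N => mul_nonneg (by positivity)
      (Finset.sum_nonneg fun _ _ => MeanLiYorke.maxPairDist_nonneg _)
    have huD : ∀ N, u N ≤ Metric.diam (Set.univ : Set X) := fun N =>
      MeanLiYorke.inv_mul_sum_Icc_le hD
        (fun k => MeanLiYorke.maxPairDist_le _ hD fun _ _ => hdist _ _) N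
    refine le_antisymm (le_of_forall_pos_le_add fun δ hδ => ?_) ?_
    · rw [zero_add]
      refine liminf_le_of_frequently_le (frequently_atTop.2 fun q₀ => ?_)
        (isBoundedUnder_of ⟨0, hu0⟩)
      obtain ⟨q₁, hq₁⟩ := exists_nat_one_div_lt hδ
      obtain ⟨N, hN, hsum⟩ := (hrel x hxK hx (max q₀ q₁)).1
      have hN0 : (0 : ℝ) < N := by exact_mod_cast (Nat.zero_le _).trans_lt hN
      refine ⟨N, ((le_max_left _ _).trans_lt hN).le, ?_⟩
      have h1 : 1 / (((max q₀ q₁ : ℕ) : ℝ) + 1) ≤ 1 / ((q₁ : ℝ) + 1) :=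
        Nat.one_div_le_one_div (le_max_right _ _)
      have h2 : u N ≤ 1 / (((max q₀ q₁ : ℕ) : ℝ) + 1) := by
        rw [hu]
        dsimp only
        rw [inv_mul_le_iff₀ hN0, mul_one_div]
        exact (Finset.sum_le_sum fun k _ => MeanLiYorke.maxPairDist_le_sum _).trans hsum.le
      linarith
    · exact le_liminf_of_le (isBoundedUnder_of ⟨_, huD⟩).isCoboundedUnder_ge
        (Eventually.of_forall hu0)
  · refine (mul_pos hc hr).trans_le (le_limsup_of_frequently_le
      (frequently_atTop.2 fun q => ?_) (isBoundedUnder_of ⟨Metric.diam (Set.univ : Set X),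
      MeanLiYorke.inv_mul_sum_Icc_le hD
        (fun k => MeanLiYorke.minPairDist_le _ hD fun _ _ => hdist _ _)⟩))
    obtain ⟨N, hN, F, hF, hcard, hsep⟩ := (hrel x hxK hx q).2
    have hN0 : (0 : ℝ) < N := by exact_mod_cast (Nat.zero_le _).trans_lt hN
    refine ⟨N, hN.le, ?_⟩
    rw [le_inv_mul_iff₀ hN0]
    calc (N : ℝ) * (c * r) = c * N * r := by ring
      _ ≤ F.card * r := by gcongr
      _ = ∑ k ∈ F, r := by simp
      _ ≤ ∑ k ∈ F, minPairDist fun i => (⇑T)^[primeSeq k] (x i) :=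
        Finset.sum_le_sum fun k hk =>
          MeanLiYorke.le_minPairDist _ hn fun i j hij => (hsep k hk i j hij).le
      _ ≤ _ := Finset.sum_le_sum_of_subset_of_nonneg hF
        fun _ _ _ => MeanLiYorke.minPairDist_nonneg _
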